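/- arXiv:2004.06308 — 4 statements merged into one kernel-verified Lean document; each statement's English description precedes it below -/
import Mathlib

section
/- For every positive integer k and every real ν > k, the series Σ_{m=0}^∞ σ_m^{(k)} ν^{−m} converges absolutely and σ_k(ν) = ν^{1−2k} · Σ_{m=0}^∞ σ_m^{(k)} ν^{−m}. -/
/-- The Bessel function of the first kind of order `ν`,
`J_ν(x) = Σ_{m=0}^∞ ((-1)^m / (m! Γ(m+ν+1))) (x/2)^{2m+ν}` (for `x > 0`). -/
noncomputable def besselJ (ν x : ℝ) : ℝ :=
  ∑' m : ℕ, ((-1 : ℝ) ^ m / (m.factorial * Real.Gamma (m + ν + 1))) * (x / 2) ^ (2 * (m : ℝ) + ν)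

/-- `Z_ν`, the set of positive zeros of `J_ν`. -/
def besselZeros (ν : ℝ) : Set ℝ := {x : ℝ | 0 < x ∧ besselJ ν x = 0}

/-- The Rayleigh sum `σ_k(ν) = Σ_{x ∈ Z_ν} x^{-2k}`. -/
noncomputable def rayleigh (k : ℕ) (ν : ℝ) : ℝ :=
  ∑' x : besselZeros ν, ((x : ℝ) ^ (2 * k))⁻¹

/-- The rational numbers `σ_m^{(k)}`: `σ_m^{(1)} = (-1)^m/4` and, for `k ≥ 2`,
`σ_m^{(k)} = Σ_{i=0}^m Σ_{j=0}^i Σ_{n=1}^{k-1} (-k)^{m-i} σ_j^{(n)} σ_{i-j}^{(k-n)}`.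
`sigmaC k m` is `σ_m^{(k)}` (junk value `0` for `k = 0`). -/
noncomputable def sigmaC : ℕ → ℕ → ℚ := fun k =>
  Nat.strongRecOn k (fun k ih =>
    if k = 0 then fun _ => 0
    else if k = 1 then fun m => (-1 : ℚ) ^ m / 4
    else fun m =>
      let s : ℕ → ℕ → ℚ := fun n j => if h : n < k then ih n h j else 0
      ∑ i ∈ Finset.range (m + 1), ∑ j ∈ Finset.range (i + 1),
        ∑ n ∈ Finset.Icc 1 (k - 1), (-(k : ℚ)) ^ (m - i) * s n j * s (k - n) (i - j))

namespace RayB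
open Filter Topology

/-- The rising product `(ν+1)...(ν+N)`. -/
noncomputable def poch (ν : ℝ) (N : ℕ) : ℝ := ∏ i ∈ Finset.range N, (ν + 1 + i)

theorem poch_zero (ν : ℝ) : poch ν 0 = 1 := by simp [poch]

theorem poch_succ (ν : ℝ) (N : ℕ) : poch ν (N + 1) = poch ν N * (ν + 1 + N) := by
  simp [poch, Finset.prod_range_succ]

theorem poch_pos {ν : ℝ} (hν : 0 < ν) (N : ℕ) : 0 < poch ν N :=
  Finset.prod_pos fun i _ => by positivity

theorem poch_add_ge {ν : ℝ} (hν : 0 < ν) (m n : ℕ) : poch ν n ≤ poch ν (m + n) := by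
  induction m with
  | zero => simp
  | succ m ih =>
    have : m + 1 + n = (m + n) + 1 := by ring
    rw [this, poch_succ]
    have h1 := poch_pos hν (m + n)
    have : (1 : ℝ) ≤ ν + 1 + ((m + n : ℕ) : ℝ) := by
      have : (0 : ℝ) ≤ ((m + n : ℕ) : ℝ) := by positivity
      linarith
    nlinarith

theorem poch_ge_fact {ν : ℝ} (hν : 0 < ν) (n : ℕ) : (n.factorial : ℝ) ≤ poch ν n := by
  induction n with
  | zero => simp [poch_zero]
  | succ n ih =>
    rw [poch_succ, Nat.factorial_succ]
    push_cast
    have h0 : (0 : ℝ) ≤ n := by positivity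
    have h1 : (0 : ℝ) < n.factorial := by positivity
    nlinarith

theorem gamma_poch {ν : ℝ} (hν : 0 < ν) (m : ℕ) :
    Real.Gamma (m + ν + 1) = poch ν m * Real.Gamma (ν + 1) := by
  induction m with
  | zero => simp [poch_zero]
  | succ m ih =>
    have : ((m + 1 : ℕ) : ℝ) + ν + 1 = (m + ν + 1) + 1 := by push_cast; ring
    rw [this, Real.Gamma_add_one (by positivity), ih, poch_succ]
    ring

/-- coefficients of the entire functions `φ_n`. -/
noncomputable def cf (ν : ℝ) (n m : ℕ) : ℝ := (-1) ^ m / (m.factorial * poch ν (m + n))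

/-- `φ_n(z) = Σ (-z)^m / (m! (ν+1)_{m+n})`. -/
noncomputable def phi (ν : ℝ) (n : ℕ) (z : ℝ) : ℝ := ∑' m : ℕ, cf ν n m * z ^ m

theorem cf_abs {ν : ℝ} (hν : 0 < ν) (n m : ℕ) (z : ℝ) :
    ‖cf ν n m * z ^ m‖ ≤ (1 / poch ν n) * (|z| ^ m / m.factorial) := by
  have h1 := poch_pos hν n
  have h2 := poch_pos hν (m + n)
  have h3 := poch_add_ge hν m n
  have h4 : (0 : ℝ) < m.factorial := by positivity
  rw [cf, norm_mul, norm_div, norm_pow, norm_pow, norm_mul]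
  simp only [Real.norm_eq_abs, abs_neg, abs_one, one_pow, Nat.abs_cast, abs_of_pos h2]
  rw [div_mul_div_comm, div_mul_eq_mul_div, mul_comm (poch ν n)]
  gcongr

theorem summable_bound (C z : ℝ) : Summable fun m : ℕ => C * (|z| ^ m / m.factorial) :=
  (Real.summable_pow_div_factorial |z|).mul_left _

theorem phi_summable {ν : ℝ} (hν : 0 < ν) (n : ℕ) (z : ℝ) :
    Summable fun m => cf ν n m * z ^ m :=
  Summable.of_norm_bounded (summable_bound _ z) (fun m => cf_abs hν n m z)

theorem tsum_exp (z : ℝ) : ∑' m : ℕ, z ^ m / (m.factorial : ℝ) = Real.exp z := by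
  rw [Real.exp_eq_exp_ℝ, NormedSpace.exp_eq_tsum_div]

theorem phi_abs {ν : ℝ} (hν : 0 < ν) (n : ℕ) (z : ℝ) :
    |phi ν n z| ≤ Real.exp |z| / poch ν n := by
  have h := tsum_of_norm_bounded (summable_bound (1 / poch ν n) z).hasSum
    (fun m => cf_abs hν n m z)
  rw [tsum_mul_left, tsum_exp] at h
  rw [phi, ← Real.norm_eq_abs]
  refine h.trans (le_of_eq ?_)
  ring

theorem cf_rec {ν : ℝ} (hν : 0 < ν) (n m : ℕ) :
    cf ν n (m + 1) + cf ν (n + 2) m = (ν + n + 1) * cf ν (n + 1) (m + 1) := by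
  have h1 : m + 1 + n = m + n + 1 := by ring
  have h2 : m + (n + 2) = m + n + 2 := by ring
  have h3 : m + 1 + (n + 1) = m + n + 1 + 1 := by ring
  have h4 : m + n + 2 = m + n + 1 + 1 := by ring
  simp only [cf]
  rw [h1, h2, h3, h4, poch_succ ν (m + n + 1), Nat.factorial_succ]
  have := poch_pos hν (m + n + 1)
  have h5 : (0 : ℝ) < m.factorial := by positivity
  have h6 : ν + 1 + ((m + n + 1 : ℕ) : ℝ) ≠ 0 := by positivity
  push_cast at h6 ⊢
  have h7 : (m : ℝ) + 1 ≠ 0 := by positivity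
  field_simp
  ring

theorem cf_rec_zero {ν : ℝ} (hν : 0 < ν) (n : ℕ) :
    cf ν n 0 = (ν + n + 1) * cf ν (n + 1) 0 := by
  simp only [cf, zero_add]
  rw [poch_succ]
  have := poch_pos hν n
  have h6 : ν + 1 + (n : ℝ) ≠ 0 := by positivity
  simp
  field_simp
  ring

theorem phi_rec {ν : ℝ} (hν : 0 < ν) (n : ℕ) (z : ℝ) :
    phi ν n z + z * phi ν (n + 2) z = (ν + n + 1) * phi ν (n + 1) z := by
  simp only [phi]
  rw [(phi_summable hν n z).tsum_eq_zero_add, (phi_summable hν (n + 1) z).tsum_eq_zero_add,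
    ← tsum_mul_left, mul_add, ← tsum_mul_left, add_assoc, ← Summable.tsum_add]
  · congr 1
    · simp [cf_rec_zero hν n]
    · refine tsum_congr fun m => ?_
      linear_combination z ^ (m + 1) * cf_rec hν n m
  · exact (summable_nat_add_iff 1).2 (phi_summable hν n z)
  · exact (phi_summable hν (n + 2) z).mul_left z

theorem phi_ne_zero {ν : ℝ} (hν : 0 < ν) (z : ℝ) : ∃ n, phi ν n z ≠ 0 := by
  have hB : ∀ n m : ℕ, ‖cf ν n (m + 1) * z ^ (m + 1)‖ ≤
      (|z| / (poch ν n * (ν + 1 + n))) * (|z| ^ m / m.factorial) := by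
    intro n m
    have h1 := poch_pos hν n
    have h2 := poch_pos hν (m + 1 + n)
    have h3 := poch_add_ge hν m (n + 1)
    have h4 : (0 : ℝ) < m.factorial := by positivity
    rw [cf, norm_mul, norm_div, norm_pow, norm_pow, norm_mul]
    simp only [Real.norm_eq_abs, abs_neg, abs_one, one_pow, Nat.abs_cast, abs_of_pos h2]
    rw [poch_succ, show m + (n + 1) = m + 1 + n by ring] at h3
    rw [div_mul_div_comm, div_mul_eq_mul_div, mul_comm (poch ν n * _), pow_succ', one_mul]
    have h5 : (m.factorial : ℝ) ≤ (m + 1).factorial := by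
      exact_mod_cast Nat.factorial_le (Nat.le_succ m)
    gcongr
  obtain ⟨n, hn⟩ := exists_nat_gt (|z| * Real.exp |z|)
  refine ⟨n, fun h0 => ?_⟩
  have h := tsum_of_norm_bounded (summable_bound (|z| / (poch ν n * (ν + 1 + n))) z).hasSum
    (fun m => hB n m)
  rw [tsum_mul_left, tsum_exp] at h
  rw [phi, (phi_summable hν n z).tsum_eq_zero_add] at h0
  have h1 : ∑' m, cf ν n (m + 1) * z ^ (m + 1) = - (1 / poch ν n) := by
    simp [cf] at h0 ⊢
    linarith
  have hp := poch_pos hν n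
  rw [h1, norm_neg, Real.norm_of_nonneg (by positivity), div_mul_eq_mul_div,
    div_le_div_iff₀ hp (by positivity)] at h
  nlinarith

theorem besselJ_eq {ν : ℝ} (hν : 0 < ν) {x : ℝ} (hx : 0 < x) :
    besselJ ν x = (x / 2) ^ ν / Real.Gamma (ν + 1) * phi ν 0 ((x / 2) ^ 2) := by
  rw [besselJ, phi, ← tsum_mul_left]
  refine tsum_congr fun m => ?_
  have hG : 0 < Real.Gamma (ν + 1) := Real.Gamma_pos_of_pos (by positivity)
  rw [gamma_poch hν, cf, Real.rpow_add (by positivity), add_zero]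
  have : (x / 2) ^ (2 * (m : ℝ)) = ((x / 2) ^ 2) ^ m := by
    rw [← pow_mul, ← Real.rpow_natCast]; push_cast; rfl
  rw [this]
  have := poch_pos hν m
  field_simp

theorem mem_zeros {ν : ℝ} (hν : 0 < ν) {x : ℝ} (hx : 0 < x) :
    x ∈ besselZeros ν ↔ phi ν 0 ((x / 2) ^ 2) = 0 := by
  have hG : 0 < Real.Gamma (ν + 1) := Real.Gamma_pos_of_pos (by positivity)
  have h2 : 0 < (x / 2) ^ ν := by positivity
  simp [besselZeros, hx, besselJ_eq hν hx, hG.ne', h2.ne']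

end RayB
namespace RayB
open Filter Topology

abbrev Seq2 := lp (fun _ : ℕ => ℝ) 2

theorem memlp_iff (f : ℕ → ℝ) : Memℓp f 2 ↔ Summable fun i => f i ^ 2 := by
  rw [memℓp_gen_iff (by norm_num)]
  simp

theorem sq_summable (u : Seq2) : Summable fun i => u i ^ 2 := (memlp_iff _).1 (lp.memℓp u)

theorem norm_sq_hasSum (u : Seq2) : HasSum (fun i => u i ^ 2) (‖u‖ ^ 2) := by
  have := lp.hasSum_inner (𝕜 := ℝ) u u
  rw [real_inner_self_eq_norm_sq] at this
  have e : (fun i => u i ^ 2) = fun i => inner ℝ (u i) (u i) := by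
    funext i
    rw [real_inner_self_eq_norm_sq, Real.norm_eq_abs, sq_abs]
  rw [e]
  exact this

theorem seq_tendsto (u : Seq2) : Tendsto (fun i => u i) atTop (𝓝 0) := by
  have h := (sq_summable u).tendsto_atTop_zero
  have h2 := h.sqrt
  simp only [Real.sqrt_sq_eq_abs, Real.sqrt_zero] at h2
  exact (tendsto_zero_iff_abs_tendsto_zero _).2 h2

/-- Left shift on `ℓ²`. -/
noncomputable def lshift : Seq2 →L[ℝ] Seq2 :=
  LinearMap.mkContinuous
    { toFun := fun u => (⟨fun i => u (i + 1),
        (memlp_iff _).2 ((summable_nat_add_iff 1).2 (sq_summable u))⟩ : Seq2)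
      map_add' := fun _ _ => by ext; rfl
      map_smul' := fun _ _ => by ext; simp }
    1 (fun u => by
      rw [one_mul]
      refine le_of_sq_le_sq ?_ (norm_nonneg _)
      have h1 := norm_sq_hasSum u
      rw [← hasSum_nat_add_iff' 1] at h1
      have h2 := norm_sq_hasSum (⟨fun i => u (i + 1),
        (memlp_iff _).2 ((summable_nat_add_iff 1).2 (sq_summable u))⟩ : Seq2)
      have h3 := h2.unique h1
      simp only [Finset.range_one, Finset.sum_singleton] at h3
      have := sq_nonneg (u 0)
      change ‖(⟨fun i => u (i + 1),
        (memlp_iff _).2 ((summable_nat_add_iff 1).2 (sq_summable u))⟩ : Seq2)‖ ^ 2 ≤ _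
      linarith)

theorem lshift_apply (u : Seq2) (i : ℕ) : lshift u i = u (i + 1) := rfl

/-- Diagonal operators. -/
noncomputable def diag (a : ℕ → ℝ) (K : ℝ) (hK : 0 ≤ K) (ha : ∀ i, |a i| ≤ K) : Seq2 →L[ℝ] Seq2 :=
  lp.mapCLM 2 (fun i => a i • ContinuousLinearMap.id ℝ ℝ) hK
    (fun i => by simpa [norm_smul] using ha i)

theorem diag_apply (a : ℕ → ℝ) (K : ℝ) (hK : 0 ≤ K) (ha : ∀ i, |a i| ≤ K) (u : Seq2) (i : ℕ) :
    diag a K hK ha u i = a i * u i := by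
  simp [diag]

theorem inner_eq (u v : Seq2) : inner ℝ u v = ∑' i, u i * v i := by
  rw [lp.inner_eq_tsum]
  simp [mul_comm]

theorem diag_symm (a : ℕ → ℝ) (K : ℝ) (hK : 0 ≤ K) (ha : ∀ i, |a i| ≤ K) (u v : Seq2) :
    inner ℝ (diag a K hK ha u) v = inner ℝ u (diag a K hK ha v) := by
  rw [inner_eq, inner_eq]
  refine tsum_congr fun i => ?_
  rw [diag_apply, diag_apply]; ring

/-- Coordinate vectors. -/
noncomputable def ee (j : ℕ) : Seq2 := lp.single 2 j (1 : ℝ)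

theorem ee_apply (j i : ℕ) : ee j i = if i = j then 1 else 0 := by
  simp [ee, lp.single_apply, Pi.single_apply]

theorem inner_ee_left (j : ℕ) (u : Seq2) : inner ℝ (ee j) u = u j := by
  rw [ee, lp.inner_single_left]; simp

/-- Truncations. -/
noncomputable def trunc (a : ℕ → ℝ) (N : ℕ) : Seq2 →L[ℝ] Seq2 :=
  ∑ j ∈ Finset.range N, a j • (ContinuousLinearMap.toSpanSingleton ℝ (ee j)).comp
    (innerSL ℝ (ee j))

theorem trunc_succ_compact (a : ℕ → ℝ) (N : ℕ) : IsCompactOperator (trunc a N) := by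
  induction N with
  | zero => 
    simp only [trunc, Finset.range_zero, Finset.sum_empty]
    exact isCompactOperator_zero
  | succ N ih =>
    rw [trunc, Finset.sum_range_succ]
    refine ih.add ?_
    refine IsCompactOperator.smul ?_ (a N)
    have hc : IsCompactOperator (innerSL ℝ (ee N)) :=
      isCompactOperator_of_locallyCompactSpace_dom (innerSL ℝ (ee N))
    exact hc.clm_comp (ContinuousLinearMap.toSpanSingleton ℝ (ee N))

theorem trunc_apply (a : ℕ → ℝ) (N : ℕ) (u : Seq2) (i : ℕ) :
    trunc a N u i = if i < N then a i * u i else 0 := by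
  induction N with
  | zero => simp [trunc]
  | succ N ih =>
    have : trunc a (N + 1) u = trunc a N u + a N • (u N • ee N) := by
      rw [trunc, Finset.sum_range_succ, ← trunc]
      simp [inner_ee_left]
    rw [this, lp.coeFn_add, Pi.add_apply, ih, lp.coeFn_smul, Pi.smul_apply, lp.coeFn_smul,
      Pi.smul_apply, ee_apply]
    rcases lt_trichotomy i N with h | h | h
    · simp [h, h.ne, h.trans (Nat.lt_succ_self N)]
    · simp [h]
    · simp [h.ne', not_lt.2 h.le, show ¬ i < N + 1 by omega]

theorem norm_le_of_coord (u v : Seq2) (C : ℝ) (hC : 0 ≤ C) (h : ∀ i, |v i| ≤ C * |u i|) :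
    ‖v‖ ≤ C * ‖u‖ := by
  refine le_of_sq_le_sq ?_ (by positivity)
  rw [mul_pow]
  refine hasSum_le (fun i => ?_) (norm_sq_hasSum v) ((norm_sq_hasSum u).mul_left (C ^ 2))
  rw [← sq_abs (v i), ← sq_abs (u i), ← mul_pow]
  exact pow_le_pow_left₀ (abs_nonneg _) (h i) 2

theorem diag_compact (a : ℕ → ℝ) (K : ℝ) (hK : 0 ≤ K) (ha : ∀ i, |a i| ≤ K)
    (h0 : Tendsto a atTop (𝓝 0)) : IsCompactOperator (diag a K hK ha) := by
  refine isCompactOperator_of_tendsto (l := atTop) (F := trunc a) ?_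
    (Eventually.of_forall fun N => trunc_succ_compact a N)
  rw [Metric.tendsto_atTop]
  intro ε hε
  rw [Metric.tendsto_atTop] at h0
  obtain ⟨N, hN⟩ := h0 (ε / 2) (half_pos hε)
  refine ⟨N, fun n hn => ?_⟩
  rw [dist_comm, dist_eq_norm]
  refine lt_of_le_of_lt (ContinuousLinearMap.opNorm_le_bound _ (half_pos hε).le fun u => ?_)
    (half_lt_self hε)
  refine norm_le_of_coord u _ _ (half_pos hε).le fun i => ?_
  rw [sub_apply, lp.coeFn_sub, Pi.sub_apply, trunc_apply, diag_apply]
  split_ifs with h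
  · simp; positivity
  · rw [sub_zero, abs_mul]
    have := hN i (by omega)
    rw [dist_zero_right, Real.norm_eq_abs] at this
    gcongr

noncomputable def rr (ν : ℝ) (j : ℕ) : ℝ := Real.sqrt (ν + j + 1)

theorem rr_pos {ν : ℝ} (hν : 0 < ν) (j : ℕ) : 0 < rr ν j := Real.sqrt_pos.2 (by positivity)

theorem rr_sq {ν : ℝ} (hν : 0 < ν) (j : ℕ) : rr ν j ^ 2 = ν + j + 1 := Real.sq_sqrt (by positivity)

theorem rr_one {ν : ℝ} (hν : 0 < ν) (j : ℕ) : 1 ≤ rr ν j := by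
  rw [rr, Real.one_le_sqrt]
  have : (0 : ℝ) ≤ j := by positivity
  linarith

noncomputable def aa (ν : ℝ) (j : ℕ) : ℝ := 1 / (rr ν j * rr ν (j + 1))

theorem rr_tendsto (ν : ℝ) : Tendsto (rr ν) atTop atTop := by
  refine Real.tendsto_sqrt_atTop.comp ?_
  refine tendsto_atTop_add_const_right _ _ ?_
  exact tendsto_atTop_add_const_left _ _ tendsto_natCast_atTop_atTop

theorem aa_tendsto (ν : ℝ) : Tendsto (aa ν) atTop (𝓝 0) := by
  have h1 := rr_tendsto ν
  have h2 := (rr_tendsto ν).comp (tendsto_add_atTop_nat 1)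
  have := (h1.atTop_mul_atTop₀ h2).inv_tendsto_atTop
  refine this.congr fun n => ?_
  simp [aa]

theorem aa_abs {ν : ℝ} (hν : 0 < ν) (j : ℕ) : |aa ν j| ≤ 1 := by
  have h1 := rr_one hν j
  have h2 := rr_one hν (j + 1)
  have : 1 ≤ rr ν j * rr ν (j + 1) := one_le_mul_of_one_le_of_one_le h1 h2
  rw [aa, abs_of_nonneg (by positivity)]
  exact div_le_one_of_le₀ this (by positivity)

/-- The diagonal part. -/
noncomputable def dd {ν : ℝ} (hν : 0 < ν) : Seq2 →L[ℝ] Seq2 := diag (aa ν) 1 zero_le_one (aa_abs hν)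

/-- The Jacobi operator. -/
noncomputable def jac {ν : ℝ} (hν : 0 < ν) : Seq2 →L[ℝ] Seq2 :=
  (ContinuousLinearMap.adjoint lshift).comp (dd hν) + (dd hν).comp lshift

theorem jac_compact {ν : ℝ} (hν : 0 < ν) : IsCompactOperator (jac hν) := by
  have h : IsCompactOperator (dd hν) := diag_compact _ _ _ _ (aa_tendsto ν)
  exact (h.clm_comp (ContinuousLinearMap.adjoint lshift)).add (h.comp_clm lshift)

theorem jac_symm {ν : ℝ} (hν : 0 < ν) : (jac hν : Seq2 →ₗ[ℝ] Seq2).IsSymmetric := by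
  intro u v
  change inner ℝ (jac hν u) v = inner ℝ u (jac hν v)
  have hd : ∀ x y, inner ℝ (dd hν x) y = inner ℝ x (dd hν y) := diag_symm _ _ _ _
  simp only [jac, add_apply, ContinuousLinearMap.comp_apply, inner_add_left,
    inner_add_right, ContinuousLinearMap.adjoint_inner_left,
    ContinuousLinearMap.adjoint_inner_right, hd]
  ring

theorem lshift_ee_zero : lshift (ee 0) = 0 := by
  ext i; simp [lshift_apply, ee_apply]

theorem lshift_ee_succ (j : ℕ) : lshift (ee (j + 1)) = ee j := by
  ext i; simp [lshift_apply, ee_apply]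

theorem jac_apply_zero {ν : ℝ} (hν : 0 < ν) (u : Seq2) : jac hν u 0 = aa ν 0 * u 1 := by
  rw [← inner_ee_left, jac, add_apply, inner_add_right,
    ContinuousLinearMap.comp_apply, ContinuousLinearMap.adjoint_inner_right, lshift_ee_zero,
    inner_zero_left, inner_ee_left, ContinuousLinearMap.comp_apply, dd, diag_apply, lshift_apply,
    zero_add]

theorem jac_apply_succ {ν : ℝ} (hν : 0 < ν) (u : Seq2) (j : ℕ) :
    jac hν u (j + 1) = aa ν j * u j + aa ν (j + 1) * u (j + 2) := by
  rw [← inner_ee_left, jac, add_apply, inner_add_right,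
    ContinuousLinearMap.comp_apply, ContinuousLinearMap.adjoint_inner_right, lshift_ee_succ,
    inner_ee_left, inner_ee_left, ContinuousLinearMap.comp_apply, dd, diag_apply, diag_apply,
    lshift_apply]

/-- The sequence `y_0 = 0`, `y_{j+1} = u_j / r_j`. -/
noncomputable def yy (ν : ℝ) (u : Seq2) : ℕ → ℝ
  | 0 => 0
  | (j + 1) => u j / rr ν j

theorem jac_yy {ν : ℝ} (hν : 0 < ν) (u : Seq2) (j : ℕ) :
    rr ν j * jac hν u j = yy ν u j + yy ν u (j + 2) := by
  cases j with
  | zero =>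
    have h0 := rr_pos hν 0
    have h1 := rr_pos hν 1
    rw [jac_apply_zero, aa]; simp only [yy, zero_add]; field_simp
  | succ j =>
    have h0 := rr_pos hν j
    have h1 := rr_pos hν (j + 1)
    have h2 := rr_pos hν (j + 1 + 1)
    rw [jac_apply_succ, aa, aa]; simp only [yy]; field_simp

end RayB
namespace RayB
open Filter Topology

section eig
variable {ν : ℝ}

theorem yy_succ (hν : 0 < ν) (u : Seq2) (j : ℕ) : u j = rr ν j * yy ν u (j + 1) := by
  have := rr_pos hν j
  simp only [yy]; field_simp

theorem u_sq (hν : 0 < ν) (u : Seq2) (j : ℕ) : u j ^ 2 = (ν + j + 1) * yy ν u (j + 1) ^ 2 := by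
  rw [yy_succ hν, mul_pow, rr_sq hν]

theorem yy_rec {ν : ℝ} (hν : 0 < ν) {u : Seq2} {l : ℝ} (hu : jac hν u = l • u) (j : ℕ) :
    yy ν u j + yy ν u (j + 2) = l * (ν + j + 1) * yy ν u (j + 1) := by
  rw [← jac_yy hν, hu, lp.coeFn_smul, Pi.smul_apply, smul_eq_mul, yy_succ hν, ← rr_sq hν]
  ring

theorem yy_abs (hν : 0 < ν) (u : Seq2) (j : ℕ) : |yy ν u (j + 1)| ≤ |u j| := by
  simp only [yy]
  rw [abs_div, abs_of_pos (rr_pos hν j)]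
  exact div_le_self (abs_nonneg _) (rr_one hν j)

theorem yy_tendsto (hν : 0 < ν) (u : Seq2) : Tendsto (yy ν u) atTop (𝓝 0) := by
  rw [← tendsto_add_atTop_iff_nat 1]
  exact squeeze_zero_norm (yy_abs hν u) (by simpa using (seq_tendsto u).abs)

theorem yy_mul_tendsto (hν : 0 < ν) (u : Seq2) :
    Tendsto (fun n : ℕ => (ν + n + 1 / 2) * (yy ν u n * yy ν u (n + 1))) atTop (𝓝 0) := by
  rw [← tendsto_add_atTop_iff_nat 1]
  have h : Tendsto (fun n => 2 * (|u n| * |u (n + 1)|)) atTop (𝓝 0) := by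
    have h1 := (seq_tendsto u).abs
    have h2 := ((tendsto_add_atTop_iff_nat 1).2 (seq_tendsto u)).abs
    simpa using (h1.mul h2).const_mul 2
  refine squeeze_zero_norm (fun n => ?_) h
  have h1 := rr_pos hν n
  have h2 := rr_pos hν (n + 1)
  have h3 : rr ν n ≤ rr ν (n + 1) := Real.sqrt_le_sqrt (by push_cast; linarith)
  have h4 := rr_sq hν n
  have hn : (0 : ℝ) ≤ n := by positivity
  rw [yy_succ hν u n, yy_succ hν u (n + 1)]
  simp only [Real.norm_eq_abs, abs_mul, abs_of_pos h1, abs_of_pos h2]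
  have h5 : |ν + ((n + 1 : ℕ) : ℝ) + 1 / 2| ≤ 2 * (rr ν n * rr ν (n + 1)) := by
    rw [abs_of_nonneg (by positivity)]
    push_cast
    nlinarith
  calc _ ≤ 2 * (rr ν n * rr ν (n + 1)) * (|yy ν u (n + 1)| * |yy ν u (n + 1 + 1)|) := by gcongr
    _ = _ := by ring

theorem eig_norm {ν : ℝ} (hν : 0 < ν) {u : Seq2} {l : ℝ} (hu : jac hν u = l • u) :
    u 0 ^ 2 = (ν + 1) * l ^ 2 / 2 * ‖u‖ ^ 2 := by
  set D : ℕ → ℝ := fun n => yy ν u n ^ 2 + yy ν u (n + 1) ^ 2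
    - l * ((ν + n + 1 / 2) * (yy ν u n * yy ν u (n + 1))) with hD
  have hstep : ∀ n, D n - D (n + 1) = l ^ 2 / 2 * u n ^ 2 := by
    intro n
    have h := yy_rec hν hu n
    rw [u_sq hν]
    simp only [hD]
    push_cast
    have e : yy ν u (n + 1 + 1) = l * (ν + n + 1) * yy ν u (n + 1) - yy ν u n := by
      rw [← h]; ring_nf
    rw [e]
    ring
  have hsum : ∀ N, ∑ n ∈ Finset.range N, l ^ 2 / 2 * u n ^ 2 = D 0 - D N := by
    intro N
    rw [← Finset.sum_range_sub' D N]
    exact Finset.sum_congr rfl fun n _ => (hstep n).symm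
  have hDt : Tendsto D atTop (𝓝 0) := by
    have h1 := yy_tendsto hν u
    have h2 := (tendsto_add_atTop_iff_nat 1).2 h1
    have h3 := yy_mul_tendsto hν u
    have h5 := ((h1.pow 2).add (h2.pow 2)).sub (h3.const_mul l)
    have e : (0 : ℝ) ^ 2 + 0 ^ 2 - l * 0 = 0 := by ring
    rw [e] at h5
    exact h5
  have h1 := ((norm_sq_hasSum u).mul_left (l ^ 2 / 2)).tendsto_sum_nat
  simp_rw [hsum] at h1
  have h2 := tendsto_nhds_unique h1 (hDt.const_sub (D 0))
  have h3 := u_sq hν u 0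
  simp only [hD] at h2
  simp only [yy, zero_add] at h2 h3
  push_cast at h3
  rw [h3]
  simp only [add_zero]
  linear_combination (-(ν + 1)) * h2

theorem eig_ne_zero {ν : ℝ} (hν : 0 < ν) {u : Seq2} {l : ℝ} (hu : jac hν u = l • u)
    (h0 : u 0 = 0) : u = 0 := by
  have h1 : ∀ n, yy ν u n = 0 ∧ yy ν u (n + 1) = 0 := by
    intro n
    induction n with
    | zero => simp [yy, h0]
    | succ n ih =>
      refine ⟨ih.2, ?_⟩
      have := yy_rec hν hu n
      rw [ih.1, ih.2] at this
      simpa using this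
  ext i
  rw [yy_succ hν, (h1 i).2]; simp

/-- The Bessel sequence. -/
noncomputable def zz (ν s : ℝ) (n : ℕ) : ℝ := s ^ n * phi ν n (s ^ 2)

theorem zz_rec {ν : ℝ} (hν : 0 < ν) {l : ℝ} (hl : l ≠ 0) (j : ℕ) :
    zz ν l⁻¹ j + zz ν l⁻¹ (j + 2) = l * (ν + j + 1) * zz ν l⁻¹ (j + 1) := by
  have h := phi_rec hν j (l⁻¹ ^ 2)
  have e : l * (ν + j + 1) * zz ν l⁻¹ (j + 1)
      = (l * l⁻¹) * l⁻¹ ^ j * ((ν + j + 1) * phi ν (j + 1) (l⁻¹ ^ 2)) := by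
    simp only [zz]; ring
  rw [e, ← h, mul_inv_cancel₀ hl]
  simp only [zz]; ring

theorem zz_abs {ν : ℝ} (hν : 0 < ν) (s : ℝ) (n : ℕ) :
    |zz ν s n| ≤ Real.exp (s ^ 2) * (|s| ^ n / poch ν n) := by
  rw [zz, abs_mul, abs_pow]
  have := phi_abs hν n (s ^ 2)
  rw [abs_of_nonneg (sq_nonneg s)] at this
  calc _ ≤ |s| ^ n * (Real.exp (s ^ 2) / poch ν n) := by gcongr
    _ = _ := by ring

theorem zz_tendsto {ν : ℝ} (hν : 0 < ν) (s : ℝ) : Tendsto (zz ν s) atTop (𝓝 0) := by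
  have h : Tendsto (fun n : ℕ => Real.exp (s ^ 2) * (|s| ^ n / n.factorial)) atTop (𝓝 0) := by
    simpa using (FloorSemiring.tendsto_pow_div_factorial_atTop |s|).const_mul (Real.exp (s ^ 2))
  refine squeeze_zero_norm (fun n => (zz_abs hν s n).trans ?_) h
  have := poch_ge_fact hν n
  gcongr

theorem eig_zero {ν : ℝ} (hν : 0 < ν) {u : Seq2} {l : ℝ} (hu : jac hν u = l • u) (hl : l ≠ 0)
    (h0 : u ≠ 0) : phi ν 0 (l⁻¹ ^ 2) = 0 := by
  set W : ℕ → ℝ := fun n => yy ν u n * zz ν l⁻¹ (n + 1) - yy ν u (n + 1) * zz ν l⁻¹ n with hW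
  have hc : ∀ n, W n = W 0 := by
    intro n
    induction n with
    | zero => rfl
    | succ n ih =>
      rw [← ih]
      simp only [hW]
      linear_combination yy ν u (n + 1) * zz_rec hν hl n - zz ν l⁻¹ (n + 1) * yy_rec hν hu n
  have ht : Tendsto W atTop (𝓝 0) := by
    have h1 := yy_tendsto hν u
    have h2 := (tendsto_add_atTop_iff_nat 1).2 h1
    have h3 := zz_tendsto hν l⁻¹
    have h4 := (tendsto_add_atTop_iff_nat 1).2 h3
    simpa using (h1.mul h4).sub (h2.mul h3)
  have h1 : W 0 = 0 := by
    refine tendsto_nhds_unique ?_ ht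
    exact tendsto_const_nhds.congr fun n => (hc n).symm
  simp only [hW, yy, zz] at h1
  have h2 : u 0 ≠ 0 := fun h => h0 (eig_ne_zero hν hu h)
  have h3 := (rr_pos hν 0).ne'
  simp [h2, h3] at h1
  simpa using h1

theorem memlp_zz {ν : ℝ} (hν : 0 < ν) (s : ℝ) :
    Memℓp (fun j => rr ν j * zz ν s (j + 1)) 2 := by
  rw [memlp_iff]
  refine Summable.of_nonneg_of_le (fun _ => sq_nonneg _) (fun j => ?_)
    ((Real.summable_pow_div_factorial (|s| ^ 2)).mul_left (Real.exp (s ^ 2) ^ 2 * |s| ^ 2))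
  have h := zz_abs hν s (j + 1)
  have h1 := poch_ge_fact hν j
  have hp := poch_pos hν j
  have hj : (1 : ℝ) ≤ j.factorial := by exact_mod_cast Nat.succ_le_of_lt (Nat.factorial_pos j)
  have hn : (1 : ℝ) ≤ ν + j + 1 := by
    have : (0 : ℝ) ≤ j := by positivity
    linarith
  rw [mul_pow, rr_sq hν, ← sq_abs (zz ν s (j + 1))]
  calc _ ≤ (ν + j + 1) * (Real.exp (s ^ 2) * (|s| ^ (j + 1) / poch ν (j + 1))) ^ 2 := by gcongr
    _ = Real.exp (s ^ 2) ^ 2 * |s| ^ 2 * ((|s| ^ 2) ^ j / ((ν + j + 1) * poch ν j ^ 2)) := by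
      rw [poch_succ]
      have : ν + 1 + (j : ℝ) = ν + j + 1 := by ring
      rw [this]
      field_simp
      ring
    _ ≤ _ := by
      gcongr
      nlinarith

theorem exists_eig {ν : ℝ} (hν : 0 < ν) {l : ℝ} (hl : l ≠ 0) (hz : phi ν 0 (l⁻¹ ^ 2) = 0) :
    ∃ u : Seq2, u ≠ 0 ∧ jac hν u = l • u := by
  set u : Seq2 := ⟨fun j => rr ν j * zz ν l⁻¹ (j + 1), memlp_zz hν l⁻¹⟩ with hu
  have huj : ∀ j, u j = rr ν j * zz ν l⁻¹ (j + 1) := fun j => rfl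
  have hy : ∀ n, yy ν u n = zz ν l⁻¹ n := by
    intro n
    cases n with
    | zero => rw [zz, hz, yy, mul_zero]
    | succ n =>
      have := rr_pos hν n
      simp only [yy, huj]; field_simp
  refine ⟨u, ?_, ?_⟩
  · intro h0
    obtain ⟨n, hn⟩ := phi_ne_zero hν (l⁻¹ ^ 2)
    have h1 : zz ν l⁻¹ n = 0 := by
      rw [← hy]
      cases n with
      | zero => rfl
      | succ n => simp [yy, h0]
    simp [zz, hl] at h1
    simp at hn
    exact hn h1
  · ext j
    have h := jac_yy hν u j
    have h1 := rr_pos hν j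
    rw [hy, hy, zz_rec hν hl, ← rr_sq hν] at h
    rw [lp.coeFn_smul, Pi.smul_apply, smul_eq_mul, huj]
    have : rr ν j * (jac hν u j) = rr ν j * (l * (rr ν j * zz ν l⁻¹ (j + 1))) := by
      rw [h]; ring
    exact mul_left_cancel₀ h1.ne' this

end eig

end RayB
namespace RayB
open Filter Topology

/-- The set of eigenvalues. -/
def Lam (ν : ℝ) : Set ℝ := {l | l ≠ 0 ∧ phi ν 0 (l⁻¹ ^ 2) = 0}

theorem exists_unit {ν : ℝ} (hν : 0 < ν) (l : Lam ν) :
    ∃ u : Seq2, ‖u‖ = 1 ∧ jac hν u = (l : ℝ) • u := by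
  obtain ⟨u, h0, hu⟩ := exists_eig hν l.2.1 l.2.2
  refine ⟨‖u‖⁻¹ • u, ?_, ?_⟩
  · rw [norm_smul, norm_inv, norm_norm, inv_mul_cancel₀ (norm_ne_zero_iff.2 h0)]
  · rw [map_smul, hu, smul_comm]

theorem moments {ν : ℝ} (hν : 0 < ν) (i : ℕ) :
    HasSum (fun l : Lam ν => (ν + 1) / 2 * (l : ℝ) ^ (i + 2))
      (inner ℝ (ee 0) ((jac hν ^ i) (ee 0))) := by
  choose b hb1 hb2 using exists_unit hν
  have hsym : ∀ x y, inner ℝ (jac hν x) y = inner ℝ x (jac hν y) := jac_symm hν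
  have horth : Orthonormal ℝ b := by
    refine ⟨hb1, fun l m hlm => ?_⟩
    have h := hsym (b l) (b m)
    rw [hb2, hb2, real_inner_smul_left, real_inner_smul_right] at h
    have h1 : ((l : ℝ) - m) * inner ℝ (b l) (b m) = 0 := by linarith
    rcases mul_eq_zero.1 h1 with h2 | h2
    · exact absurd (Subtype.ext (sub_eq_zero.1 h2)) hlm
    · exact h2
  have hb0 : ∀ l, b l 0 ≠ 0 := by
    intro l h
    have h1 := eig_ne_zero hν (hb2 l) h
    have h2 := hb1 l
    rw [h1, norm_zero] at h2
    exact zero_ne_one h2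
  have hsup : (⨆ μ, Module.End.eigenspace (jac hν : Module.End ℝ Seq2) μ) ≤
      Submodule.span ℝ (Set.range b) := by
    refine iSup_le fun μ u hu => ?_
    rw [Module.End.mem_eigenspace_iff] at hu
    have hu' : jac hν u = μ • u := hu
    by_cases h0 : u = 0
    · rw [h0]; exact Submodule.zero_mem _
    have hμ : μ ≠ 0 := by
      rintro rfl
      have h1 := eig_norm hν hu'
      refine h0 (eig_ne_zero hν hu' ?_)
      simpa using h1
    have hm : μ ∈ Lam ν := ⟨hμ, eig_zero hν hu' hμ h0⟩
    set v := b ⟨μ, hm⟩ with hv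
    have hv2 : jac hν v = μ • v := hb2 ⟨μ, hm⟩
    have hv0 : v 0 ≠ 0 := hb0 ⟨μ, hm⟩
    have h2 : u - (u 0 / v 0) • v = 0 := by
      refine eig_ne_zero hν (l := μ) ?_ ?_
      · rw [map_sub, map_smul, hu', hv2, smul_sub, smul_comm]
      · rw [lp.coeFn_sub, Pi.sub_apply, lp.coeFn_smul, Pi.smul_apply, smul_eq_mul]
        field_simp
        ring
    rw [sub_eq_zero.1 h2]
    exact Submodule.smul_mem _ _ (Submodule.subset_span ⟨_, rfl⟩)
  have hbot : (Submodule.span ℝ (Set.range b))ᗮ = ⊥ := by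
    rw [eq_bot_iff, ← ContinuousLinearMap.orthogonalComplement_iSup_eigenspaces_eq_bot
      (jac_compact hν) (jac_symm hν)]
    exact Submodule.orthogonal_le hsup
  have hpow : ∀ l x, inner ℝ (b l) ((jac hν ^ i) x) = (l : ℝ) ^ i * inner ℝ (b l) x := by
    intro l x
    induction i with
    | zero => simp
    | succ i ih =>
      rw [pow_succ', mul_apply_eq_comp, ← hsym, hb2, real_inner_smul_left, ih]
      ring
  have h := (HilbertBasis.mkOfOrthogonalEqBot horth hbot).hasSum_inner_mul_inner (ee 0)
    ((jac hν ^ i) (ee 0))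
  refine h.congr_fun fun l => ?_
  rw [HilbertBasis.coe_mkOfOrthogonalEqBot, hpow, real_inner_comm (ee 0) (b l), inner_ee_left]
  have h1 := eig_norm hν (hb2 l)
  rw [hb1] at h1
  linear_combination (-(l : ℝ) ^ i) * h1

/-- The moments. -/
noncomputable def hh {ν : ℝ} (hν : 0 < ν) (i : ℕ) : ℝ := inner ℝ (ee 0) ((jac hν ^ i) (ee 0))

theorem Lam_neg {ν : ℝ} {l : ℝ} (h : l ∈ Lam ν) : -l ∈ Lam ν := by
  refine ⟨neg_ne_zero.2 h.1, ?_⟩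
  rw [inv_neg, neg_sq]; exact h.2

/-- Negation on eigenvalues. -/
def negEquiv (ν : ℝ) : Lam ν ≃ Lam ν where
  toFun l := ⟨-l, Lam_neg l.2⟩
  invFun l := ⟨-l, Lam_neg l.2⟩
  left_inv l := by simp
  right_inv l := by simp

theorem hh_odd {ν : ℝ} (hν : 0 < ν) (i : ℕ) : hh hν (2 * i + 1) = 0 := by
  have h := moments hν (2 * i + 1)
  have h1 := (negEquiv ν).hasSum_iff.2 h
  have h2 := h.neg
  have e : ((fun l : Lam ν => (ν + 1) / 2 * (l : ℝ) ^ (2 * i + 1 + 2)) ∘ negEquiv ν) =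
      fun l : Lam ν => -((ν + 1) / 2 * (l : ℝ) ^ (2 * i + 1 + 2)) := by
    funext l
    have ho : Odd (2 * i + 1 + 2) := ⟨i + 1, by ring⟩
    simp only [Function.comp, negEquiv, Equiv.coe_fn_mk]
    rw [ho.neg_pow]; ring
  rw [e] at h1
  have h3 := h1.unique h2
  rw [hh]; linarith

theorem mem_Lam {ν : ℝ} (hν : 0 < ν) {x : ℝ} (hx : x ∈ besselZeros ν) : 2 / x ∈ Lam ν := by
  have h0 := hx.1
  refine ⟨by positivity, ?_⟩
  rw [inv_div]
  exact (mem_zeros hν h0).1 hx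

/-- Eigenvalues versus zeros. -/
noncomputable def toLam {ν : ℝ} (hν : 0 < ν) : besselZeros ν ⊕ besselZeros ν → Lam ν :=
  Sum.elim (fun x => ⟨2 / x, mem_Lam hν x.2⟩) (fun x => ⟨-(2 / x), Lam_neg (mem_Lam hν x.2)⟩)

theorem toLam_bij {ν : ℝ} (hν : 0 < ν) : Function.Bijective (toLam hν) := by
  constructor
  · rintro (⟨x, hx⟩ | ⟨x, hx⟩) (⟨y, hy⟩ | ⟨y, hy⟩) h
    all_goals
      have h0 := hx.1
      have h1 := hy.1
      have h2 : 0 < 2 / x := by positivity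
      have h3 : 0 < 2 / y := by positivity
      simp only [toLam, Sum.elim_inl, Sum.elim_inr, Subtype.mk.injEq] at h
    · have : x = y := by field_simp at h; linarith
      subst this; rfl
    · linarith
    · linarith
    · have : x = y := by
        have := neg_injective h
        field_simp at this; linarith
      subst this; rfl
  · rintro ⟨l, hl⟩
    rcases lt_or_gt_of_ne hl.1 with h | h
    · have hm : 2 / (-l) ∈ besselZeros ν := by
        rw [mem_zeros hν (div_pos two_pos (neg_pos.2 h))]
        have := (Lam_neg hl).2
        convert this using 3
        field_simp
      refine ⟨Sum.inr ⟨_, hm⟩, ?_⟩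
      simp only [toLam, Sum.elim_inr]
      congr 1
      field_simp
    · have hm : 2 / l ∈ besselZeros ν := by
        rw [mem_zeros hν (div_pos two_pos h)]
        have := hl.2
        convert this using 3
        field_simp
      refine ⟨Sum.inl ⟨_, hm⟩, ?_⟩
      simp only [toLam, Sum.elim_inl]
      congr 1
      field_simp

theorem hh_even {ν : ℝ} (hν : 0 < ν) (i : ℕ) :
    hh hν (2 * i) = (ν + 1) * 4 ^ (i + 1) * rayleigh (i + 1) ν := by
  have h := moments hν (2 * i)
  have h1 := (Equiv.ofBijective _ (toLam_bij hν)).hasSum_iff.2 h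
  set g : besselZeros ν → ℝ := fun x => (ν + 1) / 2 * 4 ^ (i + 1) * ((x : ℝ) ^ (2 * (i + 1)))⁻¹
    with hg
  have e : ((fun l : Lam ν => (ν + 1) / 2 * (l : ℝ) ^ (2 * i + 2)) ∘
      (Equiv.ofBijective _ (toLam_bij hν))) = Sum.elim g g := by
    funext x
    have h4 : (4 : ℝ) ^ (i + 1) = 2 ^ (2 * (i + 1)) := by rw [pow_mul]; norm_num
    have h5 : 2 * i + 2 = 2 * (i + 1) := by ring
    have h6 : Even (2 * (i + 1)) := even_two_mul _
    rcases x with x | x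
    · simp only [Function.comp, Equiv.ofBijective_apply, toLam, Sum.elim_inl, hg]
      rw [h4, h5, div_pow]; ring
    · simp only [Function.comp, Equiv.ofBijective_apply, toLam, Sum.elim_inr, hg]
      rw [h4, h5, h6.neg_pow, div_pow]; ring
  rw [e] at h1
  have hs : Summable g := h1.summable.comp_injective Sum.inl_injective
  have h2 : HasSum (Sum.elim g g) (∑' x, g x + ∑' x, g x) := HasSum.sum hs.hasSum hs.hasSum
  have h3 := h1.unique h2
  rw [hh, h3, rayleigh, hg, tsum_mul_left]
  ring

end RayB
namespace RayB
open Filter Topology PowerSeries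

noncomputable def Gs (ν : ℝ) (n : ℕ) : PowerSeries ℝ :=
  PowerSeries.mk fun m => if Even m then cf ν n (m / 2) else 0

theorem Gs_even (ν : ℝ) (n t : ℕ) : coeff (2 * t) (Gs ν n) = cf ν n t := by
  simp [Gs]

theorem Gs_odd (ν : ℝ) (n t : ℕ) : coeff (2 * t + 1) (Gs ν n) = 0 := by
  simp [Gs]

theorem ext_parity {f g : PowerSeries ℝ} (h0 : ∀ t, coeff (2 * t) f = coeff (2 * t) g)
    (h1 : ∀ t, coeff (2 * t + 1) f = coeff (2 * t + 1) g) : f = g := by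
  ext m
  rcases Nat.even_or_odd' m with ⟨t, rfl | rfl⟩
  · exact h0 t
  · exact h1 t

theorem Gs_rec {ν : ℝ} (hν : 0 < ν) (n : ℕ) :
    Gs ν n + X ^ 2 * Gs ν (n + 2) = (ν + n + 1) • Gs ν (n + 1) := by
  refine ext_parity (fun t => ?_) (fun t => ?_)
  · cases t with
    | zero =>
      have := cf_rec_zero hν n
      rw [map_add, PowerSeries.coeff_smul, Gs_even, Gs_even, coeff_X_pow_mul']
      simpa using this
    | succ t =>
      rw [map_add, PowerSeries.coeff_smul, Gs_even, Gs_even, show 2 * (t + 1) = 2 * t + 2 by ring,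
        coeff_X_pow_mul, Gs_even, smul_eq_mul, ← cf_rec hν]
  · rw [map_add, PowerSeries.coeff_smul, Gs_odd, Gs_odd]
    cases t with
    | zero => simp [coeff_X_pow_mul']
    | succ t =>
      rw [show 2 * (t + 1) + 1 = (2 * t + 1) + 2 by ring, coeff_X_pow_mul, Gs_odd]; simp

noncomputable def vc (ν : ℝ) (m j : ℕ) : ℝ := rr ν j * coeff m (X ^ (j + 1) * Gs ν (j + 1))

theorem vc_mem (ν : ℝ) (m : ℕ) : Memℓp (vc ν m) 2 := by
  rw [memlp_iff]
  refine summable_of_ne_finset_zero (s := Finset.range m) fun j hj => ?_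
  rw [Finset.mem_range, not_lt] at hj
  rw [vc, coeff_X_pow_mul', if_neg (by omega)]; simp

noncomputable def vv (ν : ℝ) (m : ℕ) : Seq2 := ⟨vc ν m, vc_mem ν m⟩

theorem vv_apply (ν : ℝ) (m j : ℕ) :
    vv ν m j = rr ν j * coeff m (X ^ (j + 1) * Gs ν (j + 1)) := rfl

theorem yy_vv {ν : ℝ} (hν : 0 < ν) (m j : ℕ) :
    yy ν (vv ν m) (j + 1) = coeff m (X ^ (j + 1) * Gs ν (j + 1)) := by
  have := rr_pos hν j
  rw [yy, vv_apply]; field_simp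

theorem vv_zero (ν : ℝ) : vv ν 0 = 0 := by
  ext j
  rw [vv_apply]; simp

theorem vv_succ {ν : ℝ} (hν : 0 < ν) (m : ℕ) :
    vv ν (m + 1) = jac hν (vv ν m) + (coeff m (Gs ν 0) / rr ν 0) • ee 0 := by
  ext j
  have hr := rr_pos hν j
  refine mul_left_cancel₀ hr.ne' ?_
  have hj := jac_yy hν (vv ν m) j
  have key : rr ν j * vv ν (m + 1) j =
      coeff m (X ^ j * Gs ν j) + coeff m (X ^ (j + 2) * Gs ν (j + 2)) := by
    rw [vv_apply, ← mul_assoc, ← sq, rr_sq hν, ← smul_eq_mul, ← PowerSeries.coeff_smul,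
      ← mul_smul_comm, ← Gs_rec hν, ← map_add, pow_succ', mul_assoc, coeff_succ_X_mul]
    congr 1
    ring
  rw [key, lp.coeFn_add, Pi.add_apply, mul_add, hj, yy_vv hν, lp.coeFn_smul, Pi.smul_apply,
    ee_apply]
  cases j with
  | zero => simp [yy]; field_simp; ring
  | succ j => rw [yy_vv hν]; simp

theorem vv_sum {ν : ℝ} (hν : 0 < ν) (m : ℕ) :
    vv ν (m + 1) = ∑ i ∈ Finset.range (m + 1),
      (coeff (m - i) (Gs ν 0) / rr ν 0) • (jac hν ^ i) (ee 0) := by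
  induction m with
  | zero => rw [vv_succ hν, vv_zero]; simp
  | succ m ih =>
    rw [vv_succ hν, ih, Finset.sum_range_succ' _ (m + 1), map_sum]
    congr 1
    · refine Finset.sum_congr rfl fun i _ => ?_
      rw [map_smul, pow_succ', mul_apply_eq_comp, Nat.add_sub_add_right]

noncomputable def Hs {ν : ℝ} (hν : 0 < ν) : PowerSeries ℝ := PowerSeries.mk (hh hν)

theorem Gs_one {ν : ℝ} (hν : 0 < ν) : C (ν + 1) * Gs ν 1 = Gs ν 0 * Hs hν := by
  ext m
  have h := congrArg (fun u => inner ℝ (ee 0) u) (vv_sum hν m)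
  have hr := rr_pos hν 0
  have h2 := rr_sq hν 0
  simp only [inner_ee_left, inner_sum, real_inner_smul_right] at h
  rw [vv_apply, zero_add, pow_one, coeff_succ_X_mul] at h
  rw [coeff_C_mul, mul_comm (Gs ν 0), coeff_mul, Finset.Nat.sum_antidiagonal_eq_sum_range_succ_mk]
  have h3 : (ν + 1) * coeff m (Gs ν 1) = rr ν 0 * (rr ν 0 * coeff m (Gs ν 1)) := by
    rw [← mul_assoc, ← sq, h2]; simp
  rw [h3, h, Finset.mul_sum]
  refine Finset.sum_congr rfl fun i _ => ?_
  simp only [Hs, coeff_mk, hh]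
  field_simp
  rw [inner_ee_left]

theorem Gs_der_zero {ν : ℝ} (hν : 0 < ν) : derivative ℝ (Gs ν 0) = -(2 * X * Gs ν 1) := by
  have e : (2 * X * Gs ν 1 : PowerSeries ℝ) = C 2 * (X * Gs ν 1) := by
    rw [mul_assoc]; rfl
  rw [e]
  refine ext_parity (fun t => ?_) (fun t => ?_)
  · rw [coeff_derivative, Gs_odd, map_neg, coeff_C_mul]
    cases t with
    | zero => simp
    | succ t =>
      rw [show 2 * (t + 1) = (2 * t + 1) + 1 by ring, coeff_succ_X_mul, Gs_odd]; simp
  · rw [coeff_derivative, show 2 * t + 1 + 1 = 2 * (t + 1) by ring, Gs_even, map_neg, coeff_C_mul,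
      coeff_succ_X_mul, Gs_even, cf, cf, Nat.factorial_succ, add_zero]
    have := poch_pos hν (t + 1)
    push_cast
    field_simp
    ring

theorem Gs_der_one {ν : ℝ} (hν : 0 < ν) :
    X * derivative ℝ (Gs ν 1) = 2 * (Gs ν 0 - C (ν + 1) * Gs ν 1) := by
  have e : (2 * (Gs ν 0 - C (ν + 1) * Gs ν 1) : PowerSeries ℝ)
      = C 2 * (Gs ν 0 - C (ν + 1) * Gs ν 1) := rfl
  have hX : ∀ (f : PowerSeries ℝ) (n : ℕ), coeff n (X * derivative ℝ f) = n * coeff n f := by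
    intro f n
    cases n with
    | zero => simp
    | succ n => rw [coeff_succ_X_mul, coeff_derivative]; push_cast; ring
  rw [e]
  refine ext_parity (fun t => ?_) (fun t => ?_)
  · rw [hX, coeff_C_mul, map_sub, coeff_C_mul, Gs_even, Gs_even, cf, cf, add_zero, poch_succ]
    have := poch_pos hν t
    have h6 : ν + 1 + (t : ℝ) ≠ 0 := by positivity
    push_cast
    field_simp
    ring
  · rw [hX, coeff_C_mul, map_sub, coeff_C_mul, Gs_odd, Gs_odd]; simp

theorem riccati {ν : ℝ} (hν : 0 < ν) :
    C (ν + 1) * (X * derivative ℝ (Hs hν)) + 2 * C (ν + 1) ^ 2 * Hs hν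
      = 2 * C (ν + 1) ^ 2 + 2 * X ^ 2 * (Hs hν * Hs hν) := by
  have hg : Gs ν 0 ≠ 0 := by
    intro h
    have h1 := Gs_even ν 0 0
    rw [h] at h1
    simp [cf, poch_zero] at h1
  have h1 := Gs_one hν
  have h2 := Gs_der_zero hν
  have h3 := Gs_der_one hν
  have h4 := congrArg (derivative ℝ) h1
  simp only [Derivation.leibniz, smul_eq_mul] at h4
  have hC : derivative ℝ (C (ν + 1)) = 0 := by simp
  rw [hC, h2] at h4
  refine mul_left_cancel₀ hg ?_
  linear_combination (2 * X ^ 2 * Hs hν - 2 * C (ν + 1) ^ 2) * h1 + C (ν + 1) ^ 2 * h3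
    - C (ν + 1) * X * h4

end RayB
namespace RayB
open Filter Topology PowerSeries

theorem sum_even_range (f : ℕ → ℝ) (hf : ∀ i, f (2 * i + 1) = 0) (n : ℕ) :
    ∑ i ∈ Finset.range (2 * n + 1), f i = ∑ i ∈ Finset.range (n + 1), f (2 * i) := by
  induction n with
  | zero => simp
  | succ n ih =>
    rw [Finset.sum_range_succ _ (n + 1), ← ih, show 2 * (n + 1) + 1 = 2 * n + 1 + 1 + 1 by ring,
      Finset.sum_range_succ, Finset.sum_range_succ _ (2 * n + 1), hf, add_zero]
    rfl

theorem coeff_X_der (f : PowerSeries ℝ) (n : ℕ) :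
    coeff n (X * derivative ℝ f) = n * coeff n f := by
  cases n with
  | zero => simp
  | succ n => rw [coeff_succ_X_mul, coeff_derivative]; push_cast; ring

theorem rayleigh_one {ν : ℝ} (hν : 0 < ν) : rayleigh 1 ν = 1 / (4 * (ν + 1)) := by
  have h := hh_even hν 0
  have h1 : hh hν 0 = 1 := by
    simp only [hh, pow_zero]
    rw [inner_ee_left]
    simp [ee_apply]
  rw [mul_zero, h1] at h
  norm_num at h
  field_simp
  linarith

theorem rayleigh_rec {ν : ℝ} (hν : 0 < ν) (t : ℕ) :
    (ν + (t + 2)) * rayleigh (t + 2) ν =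
      ∑ i ∈ Finset.range (t + 1), rayleigh (i + 1) ν * rayleigh (t - i + 1) ν := by
  have h := congrArg (coeff (2 * t + 2)) (riccati hν)
  have e1 : (2 * C (ν + 1) ^ 2 * Hs hν : PowerSeries ℝ) = C (2 * (ν + 1) ^ 2) * Hs hν := by
    rw [map_mul C, map_pow C]; rfl
  have e2 : (2 * C (ν + 1) ^ 2 : PowerSeries ℝ) = C (2 * (ν + 1) ^ 2) := by
    rw [map_mul C, map_pow C]; rfl
  have e3 : (2 * X ^ 2 * (Hs hν * Hs hν) : PowerSeries ℝ) = C 2 * (X ^ 2 * (Hs hν * Hs hν)) := by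
    rw [mul_assoc]; rfl
  rw [e1, e2, e3] at h
  rw [map_add (coeff _), map_add (coeff _), coeff_C_mul, coeff_C_mul, coeff_C_mul, coeff_X_der, coeff_C,
    if_neg (by omega), coeff_X_pow_mul, coeff_mul,
    Finset.Nat.sum_antidiagonal_eq_sum_range_succ_mk] at h
  simp only [Hs, coeff_mk] at h
  have ho : ∀ i, (fun i => hh hν i * hh hν (2 * t - i)) (2 * i + 1) = 0 := by
    intro i; simp [hh_odd]
  have hs := sum_even_range (fun i => hh hν i * hh hν (2 * t - i)) ho t
  simp only [Nat.succ_eq_add_one] at h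
  rw [hs] at h
  have hs2 : ∑ i ∈ Finset.range (t + 1), hh hν (2 * i) * hh hν (2 * t - 2 * i) =
      (ν + 1) ^ 2 * 4 ^ (t + 2) *
      ∑ i ∈ Finset.range (t + 1), rayleigh (i + 1) ν * rayleigh (t - i + 1) ν := by
    rw [Finset.mul_sum]
    refine Finset.sum_congr rfl fun i hi => ?_
    have hi' : i ≤ t := by simpa [Nat.lt_succ_iff] using hi
    rw [← Nat.mul_sub, hh_even, hh_even]
    have : (4 : ℝ) ^ (t + 2) = 4 ^ (i + 1) * 4 ^ (t - i + 1) := by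
      rw [← pow_add]; congr 1; omega
    rw [this]; ring
  rw [hs2, show 2 * t + 2 = 2 * (t + 1) by ring, hh_even] at h
  have hc : (2 * (ν + 1) ^ 2 * 4 ^ (t + 2) : ℝ) ≠ 0 := by positivity
  refine mul_left_cancel₀ hc ?_
  push_cast at h
  linear_combination h

end RayB
namespace RayB
open Filter Topology

theorem sigmaC_one (m : ℕ) : sigmaC 1 m = (-1 : ℚ) ^ m / 4 := by
  unfold sigmaC
  rw [Nat.strongRecOn_eq]
  simp

theorem sigmaC_rec (t m : ℕ) : sigmaC (t + 2) m =
    ∑ i ∈ Finset.range (m + 1), ∑ j ∈ Finset.range (i + 1), ∑ n ∈ Finset.range (t + 1),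
      (-((t : ℚ) + 2)) ^ (m - i) * sigmaC (n + 1) j * sigmaC (t - n + 1) (i - j) := by
  have h : sigmaC (t + 2) = if (t + 2) = 0 then fun _ => 0
    else if (t + 2) = 1 then fun m => (-1 : ℚ) ^ m / 4
    else fun m =>
      let s : ℕ → ℕ → ℚ := fun n j => if h : n < (t + 2) then sigmaC n j else 0
      ∑ i ∈ Finset.range (m + 1), ∑ j ∈ Finset.range (i + 1),
        ∑ n ∈ Finset.Icc 1 ((t + 2) - 1),
          (-((t + 2 : ℕ) : ℚ)) ^ (m - i) * s n j * s ((t + 2) - n) (i - j) := by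
    conv_lhs => unfold sigmaC
    rw [Nat.strongRecOn_eq]
    rfl
  rw [h, if_neg (by omega), if_neg (by omega)]
  refine Finset.sum_congr rfl fun i _ => Finset.sum_congr rfl fun j _ => ?_
  have e : Finset.Icc 1 (t + 2 - 1) = Finset.Ico 1 (t + 2) := by
    ext x; simp; omega
  rw [e, Finset.sum_Ico_eq_sum_range]
  refine Finset.sum_congr rfl fun n hn => ?_
  have hn' : n ≤ t := by
    have := Finset.mem_range.1 hn; omega
  simp only
  rw [dif_pos (by omega), dif_pos (by omega), show t + 2 - (1 + n) = t - n + 1 by omega,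
    show 1 + n = n + 1 by ring]
  push_cast
  rfl

/-- The normalized terms. -/
noncomputable def tm (ν : ℝ) (k m : ℕ) : ℝ := (sigmaC k m : ℝ) / ν ^ m

theorem tm_one (ν : ℝ) (m : ℕ) : tm ν 1 m = 1 / 4 * (-1 / ν) ^ m := by
  rw [tm, sigmaC_one]; push_cast; rw [div_pow]; ring

theorem tm_rec {ν : ℝ} (hν : 0 < ν) (t m : ℕ) : tm ν (t + 2) m =
    ∑ i ∈ Finset.range (m + 1), (∑ n ∈ Finset.range (t + 1), ∑ j ∈ Finset.range (i + 1),
      tm ν (n + 1) j * tm ν (t - n + 1) (i - j)) * (-((t : ℝ) + 2) / ν) ^ (m - i) := by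
  rw [tm, sigmaC_rec]
  push_cast
  rw [Finset.sum_div]
  refine Finset.sum_congr rfl fun i hi => ?_
  rw [Finset.sum_comm, Finset.sum_mul, Finset.sum_div]
  refine Finset.sum_congr rfl fun n _ => ?_
  rw [Finset.sum_mul, Finset.sum_div]
  refine Finset.sum_congr rfl fun j hj => ?_
  have h1 := Finset.mem_range.1 hi
  have h2 := Finset.mem_range.1 hj
  have : ν ^ m = ν ^ j * ν ^ (i - j) * ν ^ (m - i) := by
    rw [← pow_add, ← pow_add]; congr 1; omega
  rw [this, tm, tm, div_pow]
  field_simp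

theorem main_aux (k : ℕ) : ∀ ν : ℝ, (k : ℝ) + 1 < ν →
    Summable (fun m => ‖tm ν (k + 1) m‖) ∧
      ν ^ (2 * k + 1) * rayleigh (k + 1) ν = ∑' m, tm ν (k + 1) m := by
  induction k using Nat.strong_induction_on with
  | _ k ih =>
  intro ν hν
  have hk0 : (0 : ℝ) ≤ k := k.cast_nonneg
  have h0 : 0 < ν := by linarith
  cases k with
  | zero =>
    have hr : ‖(-1 / ν : ℝ)‖ < 1 := by
      rw [norm_div, norm_neg, norm_one, Real.norm_of_nonneg h0.le, div_lt_one h0]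
      simpa using hν
    simp only [zero_add, tm_one]
    constructor
    · simp only [norm_mul, norm_pow]
      exact (summable_geometric_of_lt_one (norm_nonneg _) hr).mul_left _
    · rw [tsum_mul_left, tsum_geometric_of_norm_lt_one hr, rayleigh_one h0]
      have : (1 - -1 / ν) = (ν + 1) / ν := by field_simp; ring
      rw [this]
      field_simp
      simp
  | succ t =>
    push_cast at hν
    have ht0 : (0 : ℝ) ≤ t := t.cast_nonneg
    have hr : ‖(-((t : ℝ) + 2) / ν : ℝ)‖ < 1 := by
      rw [norm_div, norm_neg, Real.norm_of_nonneg h0.le, div_lt_one h0,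
        Real.norm_of_nonneg (by positivity)]
      linarith
    have ihn : ∀ n ∈ Finset.range (t + 1), Summable (fun m => ‖tm ν (n + 1) m‖) ∧
        ν ^ (2 * n + 1) * rayleigh (n + 1) ν = ∑' m, tm ν (n + 1) m := by
      intro n hn
      have hn' := Finset.mem_range.1 hn
      refine ih n hn' ν ?_
      have : (n : ℝ) ≤ t := by exact_mod_cast Nat.lt_succ_iff.1 hn'
      linarith
    have ihm : ∀ n ∈ Finset.range (t + 1), Summable (fun m => ‖tm ν (t - n + 1) m‖) ∧
        ν ^ (2 * (t - n) + 1) * rayleigh (t - n + 1) ν = ∑' m, tm ν (t - n + 1) m := by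
      intro n hn
      exact ihn (t - n) (Finset.mem_range.2 (by omega))
    set c : ℕ → ℝ := fun i => ∑ n ∈ Finset.range (t + 1), ∑ j ∈ Finset.range (i + 1),
      tm ν (n + 1) j * tm ν (t - n + 1) (i - j) with hc
    set r : ℝ := -((t : ℝ) + 2) / ν with hrdef
    have hcn : ∀ n ∈ Finset.range (t + 1), Summable (fun i => ‖∑ j ∈ Finset.range (i + 1),
        tm ν (n + 1) j * tm ν (t - n + 1) (i - j)‖) := fun n hn =>
      summable_norm_sum_mul_range_of_summable_norm (ihn n hn).1 (ihm n hn).1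
    have hcs : Summable fun i => ‖c i‖ := by
      refine Summable.of_nonneg_of_le (fun _ => norm_nonneg _) (fun i => norm_sum_le _ _)
        (summable_sum hcn)
    have hgs : Summable fun i => ‖r ^ i‖ := by
      simp only [norm_pow]
      exact summable_geometric_of_lt_one (norm_nonneg _) hr
    have htm : tm ν (t + 1 + 1) = fun m => ∑ i ∈ Finset.range (m + 1), c i * r ^ (m - i) := by
      funext m; exact tm_rec h0 t m
    rw [htm]
    refine ⟨summable_norm_sum_mul_range_of_summable_norm hcs hgs, ?_⟩
    rw [← tsum_mul_tsum_eq_tsum_sum_range_of_summable_norm hcs hgs,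
      tsum_geometric_of_norm_lt_one hr]
    have hct : ∑' i, c i = ν ^ (2 * t + 2) *
        ∑ i ∈ Finset.range (t + 1), rayleigh (i + 1) ν * rayleigh (t - i + 1) ν := by
      rw [hc, Summable.tsum_finsetSum fun n hn => (hcn n hn).of_norm, Finset.mul_sum]
      refine Finset.sum_congr rfl fun n hn => ?_
      rw [← tsum_mul_tsum_eq_tsum_sum_range_of_summable_norm (ihn n hn).1 (ihm n hn).1,
        ← (ihn n hn).2, ← (ihm n hn).2]
      have : ν ^ (2 * t + 2) = ν ^ (2 * n + 1) * ν ^ (2 * (t - n) + 1) := by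
        have := Finset.mem_range.1 hn
        rw [← pow_add]; congr 1; omega
      rw [this]; ring
    rw [hct, ← rayleigh_rec h0]
    have h1r : 1 - r = (ν + (t + 2)) / ν := by
      rw [hrdef]; field_simp; ring
    have hp : ν + ((t : ℝ) + 2) ≠ 0 := by positivity
    rw [h1r]
    field_simp
    ring

end RayB

/-- For every positive integer `k` and real `ν > k`, the series `Σ_m σ_m^{(k)} ν^{-m}`
converges absolutely and `σ_k(ν) = ν^{1-2k} Σ_{m=0}^∞ σ_m^{(k)} ν^{-m}`. -/
theorem rayleigh_laurent_expansion (k : ℕ) (hk : 1 ≤ k) (ν : ℝ) (hν : (k : ℝ) < ν) :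
    Summable (fun m : ℕ => |(sigmaC k m : ℝ) / ν ^ m|) ∧
    rayleigh k ν = ν ^ (1 - 2 * (k : ℤ)) * ∑' m : ℕ, (sigmaC k m : ℝ) / ν ^ m := by
  obtain ⟨l, rfl⟩ : ∃ l, k = l + 1 := ⟨k - 1, by omega⟩
  push_cast at hν
  have h0 : 0 < ν := by
    have : (0 : ℝ) ≤ l := l.cast_nonneg
    linarith
  obtain ⟨h1, h2⟩ := RayB.main_aux l ν hν
  refine ⟨h1, ?_⟩
  change _ = _ * ∑' m, RayB.tm ν (l + 1) m
  rw [← h2, ← mul_assoc, ← zpow_natCast, ← zpow_add₀ h0.ne']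
  push_cast
  rw [show (1 - 2 * ((l : ℤ) + 1) + (2 * l + 1)) = 0 by ring, zpow_zero, one_mul]
end

section
/- For every positive integer k and every positive real ν, the Rayleigh sum satisfies σ_k(ν) ≤ (binom(2k,k) / (2^{2k+1}(2k−1))) · ν^{1−2k} ≤ ν^{1−2k}. -/
open Filter Topology Finset in
theorem ray_green (f g : ℕ → ℝ) (N : ℕ) :
    ∑ n ∈ range N, ((f n + f (n+2)) * g (n+1) - f (n+1) * (g n + g (n+2)))
      = (f 0 * g 1 - f 1 * g 0) - (f N * g (N+1) - f (N+1) * g N) := by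
  induction N with
  | zero => simp
  | succ N ih => rw [sum_range_succ, ih]; ring

/-- iterates of the (unsymmetrised) Jacobi operator on the first basis vector -/
noncomputable def rayC (ν : ℝ) : ℕ → ℕ → ℝ
  | 0, n => if n = 1 then 1 else 0
  | _+1, 0 => 0
  | m+1, n+1 => (rayC ν m n + rayC ν m (n+2)) / (2 * (ν + n + 1))

/-- ballot numbers -/
noncomputable def rayB : ℕ → ℕ → ℝ
  | 0, n => if n = 1 then 1 else 0
  | _+1, 0 => 0
  | m+1, n+1 => rayB m n + rayB m (n+2)

theorem rayC_zero (ν : ℝ) (m : ℕ) : rayC ν m 0 = 0 := by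
  cases m <;> simp [rayC]

theorem rayB_zero (m : ℕ) : rayB m 0 = 0 := by
  cases m <;> simp [rayB]

theorem rayC_supp (ν : ℝ) (m n : ℕ) (h : m + 1 < n) : rayC ν m n = 0 := by
  induction m generalizing n with
  | zero => simp [rayC]; omega
  | succ m ih =>
    obtain ⟨n, rfl⟩ : ∃ k, n = k + 1 := ⟨n - 1, by omega⟩
    simp [rayC, ih n (by omega), ih (n+2) (by omega)]

theorem rayB_supp (m n : ℕ) (h : m + 1 < n) : rayB m n = 0 := by
  induction m generalizing n with
  | zero => simp [rayB]; omega
  | succ m ih =>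
    obtain ⟨n, rfl⟩ : ∃ k, n = k + 1 := ⟨n - 1, by omega⟩
    simp [rayB, ih n (by omega), ih (n+2) (by omega)]

theorem rayC_nonneg (ν : ℝ) (hν : 0 < ν) (m n : ℕ) : 0 ≤ rayC ν m n := by
  induction m generalizing n with
  | zero => simp only [rayC]; split_ifs <;> norm_num
  | succ m ih =>
    cases n with
    | zero => simp [rayC]
    | succ n =>
      have := ih n; have := ih (n+2)
      simp only [rayC]; positivity

theorem rayC_le (ν : ℝ) (hν : 0 < ν) (m n : ℕ) : rayC ν m n ≤ rayB m n / (2 * ν) ^ m := by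
  induction m generalizing n with
  | zero => simp [rayC, rayB]
  | succ m ih =>
    cases n with
    | zero => simp [rayC, rayB]
    | succ n =>
      have h1 := ih n
      have h2 := ih (n+2)
      have := rayC_nonneg ν hν m n
      have := rayC_nonneg ν hν m (n+2)
      simp only [rayC, rayB]
      calc (rayC ν m n + rayC ν m (n+2)) / (2 * (ν + n + 1))
          ≤ (rayC ν m n + rayC ν m (n+2)) / (2 * ν) := by
            apply div_le_div_of_nonneg_left (by positivity) (by positivity)
            have : (0:ℝ) ≤ n := n.cast_nonneg
            linarith
        _ ≤ (rayB m n / (2 * ν) ^ m + rayB m (n+2) / (2 * ν) ^ m) / (2 * ν) := by gcongr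
        _ = _ := by rw [pow_succ]; field_simp

theorem rayB_formula (q d : ℕ) :
    rayB (2*q+d) (d+1) = (d+1) * (2*q+d).factorial / (q.factorial * (q+d+1).factorial) := by
  induction q generalizing d with
  | zero =>
    have : rayB d (d+1) = 1 := by
      induction d with
      | zero => simp [rayB]
      | succ d ih => simp [rayB, ih, rayB_supp d (d+1+2) (by omega)]
    simp only [mul_zero, zero_add, this, Nat.factorial_succ]
    have := Nat.factorial_pos d
    push_cast
    field_simp
    simp
  | succ q ih =>
    induction d with
    | zero =>
      have e : rayB (2*(q+1)+0) (0+1) = rayB (2*q+1) (1+1) := by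
        show rayB (2*q+1+1) (0+1) = _
        simp [rayB]
      rw [e, ih 1]
      have h1 : 2*(q+1)+0 = 2*q+1+1 := by ring
      have h2 : q+1+0+1 = q+1+1 := by ring
      rw [h1, h2, Nat.factorial_succ (2*q+1), Nat.factorial_succ (q+1), Nat.factorial_succ q]
      have := Nat.factorial_pos q
      push_cast
      field_simp
      ring
    | succ d ihd =>
      have e : rayB (2*(q+1)+(d+1)) (d+1+1) = rayB (2*(q+1)+d) (d+1) + rayB (2*q+(d+2)) (d+2+1) := by
        show rayB (2*q+2+d+1) (d+1+1) = _
        rw [rayB, show 2*(q+1)+d = 2*q+2+d by ring, show 2*q+(d+2) = 2*q+2+d by ring]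
      rw [e, ihd, ih (d+2)]
      have h1 : 2*(q+1)+d = 2*q+d+2 := by ring
      have h2 : 2*q+(d+2) = 2*q+d+2 := by ring
      have h3 : 2*(q+1)+(d+1) = 2*q+d+2+1 := by ring
      have h4 : q+1+d+1 = q+d+2 := by ring
      have h5 : q+(d+2)+1 = q+d+2+1 := by ring
      have h6 : q+1+(d+1)+1 = q+d+2+1 := by ring
      rw [h1, h2, h3, h4, h5, h6, Nat.factorial_succ (2*q+d+2), Nat.factorial_succ (q+d+2), Nat.factorial_succ q]
      have := Nat.factorial_pos q
      have := Nat.factorial_pos (q+d+2)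
      push_cast
      field_simp
      ring

open Finset in
theorem rayC_sym (ν : ℝ) (hν : 0 < ν) (p q N : ℕ) (h : p + q + 3 < N) :
    ∑ n ∈ range N, (ν+n+1) * (rayC ν (p+1) (n+1) * rayC ν q (n+1))
      = ∑ n ∈ range N, (ν+n+1) * (rayC ν p (n+1) * rayC ν (q+1) (n+1)) := by
  have g := ray_green (rayC ν p) (rayC ν q) N
  rw [rayC_zero, rayC_zero, rayC_supp ν p N (by omega), rayC_supp ν q N (by omega)] at g
  simp only [zero_mul, mul_zero, sub_self] at g
  rw [← sub_eq_zero, ← sum_sub_distrib, ← mul_eq_zero_iff_left (two_ne_zero), mul_sum, ← g]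
  apply sum_congr rfl
  intro n _
  have : ν+n+1 ≠ 0 := by positivity
  simp only [rayC]
  field_simp

open Finset in
theorem rayC_norm (ν : ℝ) (hν : 0 < ν) (p q N : ℕ) (h : p + q + 4 < N) :
    ∑ n ∈ range N, (ν+n+1) * (rayC ν p (n+1) * rayC ν q (n+1)) = (ν+1) * rayC ν (p+q) 1 := by
  induction q generalizing p with
  | zero =>
    rw [sum_eq_single 0]
    · simp [rayC]
    · intro b _ hb; simp [rayC, hb]
    · intro h; simp at h; omega
  | succ q ih =>
    rw [← rayC_sym ν hν p q N (by omega), ih (p+1) (by omega)]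
    congr 2; ring

open Finset in
theorem ray_bessel {T : Finset ℝ} (w c : ℕ → ℝ) (hw : ∀ n, 0 ≤ w n) (u : ℝ → ℕ → ℝ) (M : ℝ)
    (p q : ℝ → ℝ)
    (hM : HasSum (fun n => w n * (c n * c n)) M)
    (hp : ∀ x ∈ T, HasSum (fun n => w n * (c n * u x n)) (p x))
    (hq : ∀ x ∈ T, HasSum (fun n => w n * (u x n * u x n)) (q x))
    (ho : ∀ x ∈ T, ∀ y ∈ T, x ≠ y → HasSum (fun n => w n * (u x n * u y n)) 0)
    (hq0 : ∀ x ∈ T, 0 < q x) :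
    ∑ x ∈ T, p x ^ 2 / q x ≤ M := by
  have h2 : HasSum (fun n => ∑ x ∈ T, ∑ y ∈ T, (p x / q x) * (p y / q y) * (w n * (u x n * u y n)))
      (∑ x ∈ T, ∑ y ∈ T, (p x / q x) * (p y / q y) * (if x = y then q x else 0)) := by
    refine hasSum_sum fun x hx => hasSum_sum fun y hy => HasSum.mul_left _ ?_
    split_ifs with e
    · subst e; exact hq x hx
    · exact ho x hx y hy e
  have h1 : HasSum (fun n => ∑ x ∈ T, (p x / q x) * (w n * (c n * u x n)))
      (∑ x ∈ T, (p x / q x) * p x) :=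
    hasSum_sum fun x hx => (hp x hx).mul_left _
  have h3 := (hM.sub (h1.mul_left 2)).add h2
  have h4 := h3.nonneg (fun n => by
    have : w n * (c n * c n) - 2 * ∑ x ∈ T, (p x / q x) * (w n * (c n * u x n)) +
        ∑ x ∈ T, ∑ y ∈ T, (p x / q x) * (p y / q y) * (w n * (u x n * u y n))
        = w n * (c n - ∑ x ∈ T, (p x / q x) * u x n) ^ 2 := by
      have e1 : ∑ x ∈ T, (p x / q x) * (w n * (c n * u x n))
          = w n * c n * ∑ x ∈ T, (p x / q x) * u x n := by
        rw [mul_sum]; exact sum_congr rfl fun x _ => by ring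
      have e2 : ∑ x ∈ T, ∑ y ∈ T, (p x / q x) * (p y / q y) * (w n * (u x n * u y n))
          = w n * ((∑ x ∈ T, (p x / q x) * u x n) * (∑ x ∈ T, (p x / q x) * u x n)) := by
        rw [sum_mul_sum, mul_sum]
        refine sum_congr rfl fun x _ => ?_
        rw [mul_sum]; exact sum_congr rfl fun y _ => by ring
      rw [e1, e2]; ring
    show 0 ≤ w n * (c n * c n) - 2 * ∑ x ∈ T, (p x / q x) * (w n * (c n * u x n)) +
        ∑ x ∈ T, ∑ y ∈ T, (p x / q x) * (p y / q y) * (w n * (u x n * u y n))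
    rw [this]
    exact mul_nonneg (hw n) (sq_nonneg _))
  have e1 : ∑ x ∈ T, (p x / q x) * p x = ∑ x ∈ T, p x ^ 2 / q x :=
    sum_congr rfl fun x _ => by ring
  have e2 : ∑ x ∈ T, ∑ y ∈ T, (p x / q x) * (p y / q y) * (if x = y then q x else 0)
      = ∑ x ∈ T, p x ^ 2 / q x := by
    refine sum_congr rfl fun x hx => ?_
    have := (hq0 x hx).ne'
    simp [hx]
    field_simp
  rw [e1, e2] at h4
  linarith

/-- decaying solution of the recurrence vanishing at zero -/
structure RaySol (ν x : ℝ) (j : ℕ → ℝ) : Prop where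
  hx : x ≠ 0
  h0 : j 0 = 0
  h1 : j 1 ≠ 0
  hrec : ∀ n : ℕ, j n + j (n+2) = 2 * (ν + n + 1) / x * j (n+1)
  hdec : Filter.Tendsto (fun n : ℕ => (n:ℝ) * j n) Filter.atTop (nhds 0)

open Filter Topology Finset

theorem RaySol.tend {ν x : ℝ} {j : ℕ → ℝ} (h : RaySol ν x j) : Tendsto j atTop (𝓝 0) := by
  refine squeeze_zero_norm' ?_ (by simpa using h.hdec.norm)
  filter_upwards [eventually_ge_atTop 1] with n hn
  have : (1:ℝ) ≤ (n:ℝ) := by exact_mod_cast hn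
  rw [Real.norm_eq_abs]
  nlinarith [abs_nonneg (j n)]

theorem RaySol.norm {ν x : ℝ} (hν : 0 < ν) {j : ℕ → ℝ} (h : RaySol ν x j) :
    HasSum (fun n : ℕ => (ν+n+1) * (j (n+1) * j (n+1))) (x^2 * j 1 ^ 2 / 2) := by
  rw [hasSum_iff_tendsto_nat_of_nonneg (fun n => by
    have := mul_self_nonneg (j (n+1)); positivity)]
  have key : ∀ N, ∑ n ∈ range N, (ν+n+1) * (j (n+1) * j (n+1)) =
      x^2 / 2 * (j 1 ^ 2 - (j N ^ 2 + j (N+1) ^ 2 - (2*(ν+N)+1)/x * (j N * j (N+1)))) := by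
    intro N
    induction N with
    | zero => simp [h.h0]
    | succ N ih =>
      have e := h.hrec N
      have : j (N+2) = 2 * (ν + N + 1) / x * j (N+1) - j N := by linarith
      rw [sum_range_succ, ih, this]
      have := h.hx
      push_cast
      field_simp
      ring
  simp_rw [key]
  have t0 := h.tend
  have t1 := (tendsto_add_atTop_iff_nat 1).2 t0
  have t2 : Tendsto (fun N : ℕ => (2*(ν+N)+1)/x * (j N * j (N+1))) atTop (𝓝 0) := by
    have := (((h.hdec.mul t1).const_mul 2).add ((t0.mul t1).const_mul (2*ν+1))).div_const x
    simp only [mul_zero, add_zero, zero_div] at this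
    refine this.congr fun n => ?_
    ring
  have := ((((t0.pow 2).add (t1.pow 2)).sub t2).const_sub (j 1 ^ 2)).const_mul (x^2/2)
  convert this using 2
  ring

theorem RaySol.orth {ν x y : ℝ} (hν : 0 < ν) {j k : ℕ → ℝ} (h : RaySol ν x j) (h' : RaySol ν y k)
    (hxy : x ≠ y) : HasSum (fun n : ℕ => (ν+n+1) * (j (n+1) * k (n+1))) 0 := by
  have s : Summable (fun n : ℕ => (ν+n+1) * (j (n+1) * k (n+1))) := by
    refine Summable.of_norm_bounded ((h.norm hν).summable.add (h'.norm hν).summable) fun n => ?_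
    have : 0 ≤ ν + n + 1 := by positivity
    rw [norm_mul, Real.norm_of_nonneg this, ← mul_add]
    gcongr
    rw [Real.norm_eq_abs, abs_le]
    constructor <;> nlinarith [sq_nonneg (j (n+1) + k (n+1)), sq_nonneg (j (n+1) - k (n+1)), sq_nonneg (j (n+1)), sq_nonneg (k (n+1))]
  have key : ∀ N, ∑ n ∈ range N, (ν+n+1) * (j (n+1) * k (n+1)) =
      - (j N * k (N+1) - j (N+1) * k N) / (2 / x - 2 / y) := by
    intro N
    have g := ray_green j k N
    rw [h.h0, h'.h0] at g
    have hx := h.hx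
    have hy := h'.hx
    have ne : 2 / x - 2 / y ≠ 0 := by
      intro e
      apply hxy
      field_simp at e
      linarith
    rw [eq_div_iff ne, sum_mul]
    have : ∀ n ∈ range N, (ν+n+1) * (j (n+1) * k (n+1)) * (2 / x - 2 / y)
       = ((j n + j (n+2)) * k (n+1) - j (n+1) * (k n + k (n+2))) := by
      intro n _
      rw [h.hrec, h'.hrec]; ring
    rw [sum_congr rfl this, g]; ring
  have t0 := h.tend
  have t1 := (tendsto_add_atTop_iff_nat 1).2 t0
  have s0 := h'.tend
  have s1 := (tendsto_add_atTop_iff_nat 1).2 s0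
  have := ((t0.mul s1).sub (t1.mul s0)).neg.div_const (2 / x - 2 / y)
  simp only [mul_zero, sub_self, neg_zero, zero_div] at this
  have t := s.hasSum.tendsto_sum_nat
  simp_rw [key] at t
  rw [tendsto_nhds_unique this t]
  exact s.hasSum

theorem RaySol.coef {ν x : ℝ} (hν : 0 < ν) {j : ℕ → ℝ} (h : RaySol ν x j) (m N : ℕ) (hN : m + 2 < N) :
    ∑ n ∈ range N, (ν+n+1) * (rayC ν m (n+1) * j (n+1)) = (ν+1) * j 1 / x ^ m := by
  induction m with
  | zero =>
    rw [sum_eq_single 0]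
    · simp [rayC]
    · intro b _ hb; simp [rayC, hb]
    · intro h; simp at h; omega
  | succ m ih =>
    have g := ray_green (rayC ν m) j N
    rw [h.h0, rayC_zero, rayC_supp ν m N (by omega), rayC_supp ν m (N+1) (by omega)] at g
    simp only [zero_mul, mul_zero, sub_self] at g
    have hx := h.hx
    rw [pow_succ, ← div_div, ← ih (by omega), sum_div, ← sub_eq_zero, ← sum_sub_distrib,
      ← mul_eq_zero_iff_left (two_ne_zero), mul_sum, ← g]
    apply sum_congr rfl
    intro n _
    rw [h.hrec]
    have : ν+n+1 ≠ 0 := by positivity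
    simp only [rayC]
    field_simp

theorem ray_main (ν : ℝ) (hν : 0 < ν) (T : Finset ℝ) (j : ℝ → ℕ → ℝ)
    (hT : ∀ x ∈ T, RaySol ν x (j x)) (m : ℕ) :
    ∑ x ∈ T, 2 * (ν+1) * (x ^ (2*(m+1)))⁻¹ ≤ rayC ν (2*m) 1 := by
  have hfin : ∀ g : ℕ → ℝ, HasSum (fun n : ℕ => (ν+n+1) * (rayC ν m (n+1) * g n))
      (∑ n ∈ range (2*m+5), (ν+n+1) * (rayC ν m (n+1) * g n)) := by
    intro g
    apply hasSum_sum_of_ne_finset_zero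
    intro n hn
    simp at hn
    rw [rayC_supp ν m (n+1) (by omega)]; ring
  have := ray_bessel (T := T) (fun n => ν+n+1) (fun n => rayC ν m (n+1)) (fun n => by positivity)
    (fun x n => j x (n+1)) ((ν+1) * rayC ν (2*m) 1) (fun x => (ν+1) * j x 1 / x ^ m)
    (fun x => x^2 * j x 1 ^ 2 / 2)
    (by
      have := hfin (fun n => rayC ν m (n+1))
      rwa [rayC_norm ν hν m m _ (by omega), ← two_mul] at this)
    (fun x hx => by
      have := hfin (fun n => j x (n+1))
      rwa [(hT x hx).coef hν m _ (by omega)] at this)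
    (fun x hx => (hT x hx).norm hν)
    (fun x hx y hy hxy => (hT x hx).orth hν (hT y hy) hxy)
    (fun x hx => by
      have := (hT x hx).hx
      have := (hT x hx).h1
      positivity)
  have e : ∑ x ∈ T, ((ν+1) * j x 1 / x ^ m) ^ 2 / (x^2 * j x 1 ^ 2 / 2)
      = (ν+1) * ∑ x ∈ T, 2 * (ν+1) * (x ^ (2*(m+1)))⁻¹ := by
    rw [mul_sum]
    refine sum_congr rfl fun x hx => ?_
    have := (hT x hx).hx
    have := (hT x hx).h1
    field_simp
    ring
  rw [e] at this
  exact le_of_mul_le_mul_left this (by positivity)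

/-- normalised Bessel series -/
noncomputable def rayT (ν y : ℝ) (n : ℕ) : ℝ :=
  ∑' m : ℕ, (-1:ℝ)^m * y^m / (m.factorial * Real.Gamma (ν + ((m + n : ℕ):ℝ) + 1))

theorem rayG_pos (ν : ℝ) (hν : 0 < ν) (n : ℕ) : 0 < Real.Gamma (ν + n + 1) :=
  Real.Gamma_pos_of_pos (by positivity)

theorem rayG_succ (ν : ℝ) (hν : 0 < ν) (n : ℕ) :
    Real.Gamma (ν + ((n+1:ℕ):ℝ) + 1) = (ν + n + 1) * Real.Gamma (ν + n + 1) := by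
  rw [← Real.Gamma_add_one (by positivity)]; congr 1; push_cast; ring

theorem rayG_mono (ν : ℝ) (hν : 0 < ν) : Monotone (fun n : ℕ => Real.Gamma (ν + n + 1)) := by
  refine monotone_nat_of_le_succ fun n => ?_
  rw [rayG_succ ν hν]
  have := rayG_pos ν hν n
  have : (0:ℝ) ≤ n := n.cast_nonneg
  nlinarith

theorem rayG_fact (ν : ℝ) (hν : 0 < ν) (n : ℕ) :
    n.factorial * Real.Gamma (ν + 1) ≤ Real.Gamma (ν + n + 1) := by
  induction n with
  | zero => simp
  | succ n ih =>
    rw [rayG_succ ν hν, Nat.factorial_succ]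
    push_cast
    rw [mul_assoc]
    have := Real.Gamma_pos_of_pos (show 0 < ν + 1 by positivity)
    gcongr
    linarith

theorem rayT_bound (ν y : ℝ) (hν : 0 < ν) (hy : 0 ≤ y) (n m : ℕ) :
    ‖(-1:ℝ)^m * y^m / (m.factorial * Real.Gamma (ν + ((m + n : ℕ):ℝ) + 1))‖ ≤
      y^m / m.factorial * (Real.Gamma (ν + n + 1))⁻¹ := by
  have h1 := rayG_pos ν hν n
  have h2 := rayG_pos ν hν (m+n)
  have h3 := rayG_mono ν hν (show n ≤ m + n by omega)
  simp only at h3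
  have hf : (0:ℝ) < m.factorial := by positivity
  rw [norm_div, norm_mul, norm_pow, norm_neg, norm_one, one_pow, one_mul, norm_mul,
    Real.norm_of_nonneg (pow_nonneg hy m), Real.norm_of_nonneg h2.le, Real.norm_of_nonneg hf.le,
    ← div_div, div_eq_mul_inv (_ / _)]
  gcongr

theorem ray_exp (y : ℝ) : HasSum (fun m : ℕ => y^m / m.factorial) (Real.exp y) := by
  rw [Real.exp_eq_exp_ℝ]; exact NormedSpace.expSeries_div_hasSum_exp y

theorem rayT_summable (ν y : ℝ) (hν : 0 < ν) (hy : 0 ≤ y) (n : ℕ) :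
    Summable (fun m : ℕ => (-1:ℝ)^m * y^m / (m.factorial * Real.Gamma (ν + ((m + n : ℕ):ℝ) + 1))) :=
  Summable.of_norm_bounded ((ray_exp y).summable.mul_right _) (rayT_bound ν y hν hy n)

theorem rayT_le (ν y : ℝ) (hν : 0 < ν) (hy : 0 ≤ y) (n : ℕ) :
    |rayT ν y n| ≤ Real.exp y * (Real.Gamma (ν + n + 1))⁻¹ :=
  tsum_of_norm_bounded ((ray_exp y).mul_right _) (rayT_bound ν y hν hy n)

theorem rayT_rec (ν y : ℝ) (hν : 0 < ν) (hy : 0 ≤ y) (n : ℕ) :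
    rayT ν y n + y * rayT ν y (n+2) = (ν + n + 1) * rayT ν y (n+1) := by
  have s0 := (rayT_summable ν y hν hy n)
  have s1 := (rayT_summable ν y hν hy (n+1))
  have s2 := (rayT_summable ν y hν hy (n+2))
  have G1 := rayG_pos ν hν
  unfold rayT
  rw [s0.tsum_eq_zero_add, s1.tsum_eq_zero_add, ← tsum_mul_left, mul_add, ← tsum_mul_left, add_assoc,
    ← ((summable_nat_add_iff 1).2 s0).tsum_add (s2.mul_left y)]
  congr 1
  · have := G1 n
    simp only [pow_zero, mul_one, Nat.factorial_zero, Nat.cast_one, one_mul, zero_add]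
    rw [rayG_succ ν hν n]
    have : ν + n + 1 ≠ 0 := by positivity
    field_simp
  · refine tsum_congr fun m => ?_
    have e1 : m + (n+2) = m+1+n+1 := by ring
    have e2 : m + 1 + (n+1) = m+1+n+1 := by ring
    rw [e1, e2, rayG_succ ν hν (m+1+n), Nat.factorial_succ]
    have := G1 (m+1+n)
    have : ν + ((m+1+n:ℕ):ℝ) + 1 ≠ 0 := by positivity
    have : (0:ℝ) < m.factorial := by positivity
    have hm : (m:ℝ)+1 ≠ 0 := by positivity
    generalize hg : Real.Gamma (ν + ((m+1+n:ℕ):ℝ) + 1) = g at *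
    push_cast at *
    field_simp
    ring

theorem rayT_ne (ν y : ℝ) (hν : 0 < ν) (hy : 0 < y) (h0 : rayT ν y 0 = 0) : rayT ν y 1 ≠ 0 := by
  intro h1
  have all : ∀ n, rayT ν y n = 0 ∧ rayT ν y (n+1) = 0 := by
    intro n
    induction n with
    | zero => exact ⟨h0, h1⟩
    | succ n ih =>
      refine ⟨ih.2, ?_⟩
      have := rayT_rec ν y hν hy.le n
      rw [ih.1, ih.2] at this
      simpa [hy.ne'] using this
  obtain ⟨n, hn⟩ := exists_nat_gt (y * Real.exp y)
  have ha := (all n).1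
  have s0 := rayT_summable ν y hν hy.le n
  unfold rayT at ha
  rw [s0.tsum_eq_zero_add] at ha
  have G := rayG_pos ν hν n
  have b : ‖∑' m : ℕ, (-1:ℝ)^(m+1) * y^(m+1) / ((m+1).factorial * Real.Gamma (ν + ((m + 1 + n : ℕ):ℝ) + 1))‖
      ≤ y * (Real.exp y * (Real.Gamma (ν + ((n+1:ℕ):ℝ) + 1))⁻¹) := by
    refine tsum_of_norm_bounded (((ray_exp y).mul_right _).mul_left y) fun m => ?_
    have := rayT_bound ν y hν hy.le (n+1) m
    have e : m + (n+1) = m + 1 + n := by ring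
    rw [e] at this
    have e2 : (-1:ℝ)^(m+1) * y^(m+1) / ((m+1).factorial * Real.Gamma (ν + ((m + 1 + n : ℕ):ℝ) + 1))
      = (-y / (m+1)) * ((-1:ℝ)^m * y^m / (m.factorial * Real.Gamma (ν + ((m + 1 + n : ℕ):ℝ) + 1))) := by
      rw [Nat.factorial_succ]
      have := rayG_pos ν hν (m+1+n)
      push_cast at *
      field_simp
      ring
    rw [e2, norm_mul]
    refine mul_le_mul ?_ this (norm_nonneg _) hy.le
    rw [norm_div, norm_neg, Real.norm_of_nonneg hy.le, Real.norm_of_nonneg (by positivity)]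
    apply div_le_self hy.le
    have : (0:ℝ) ≤ m := m.cast_nonneg
    linarith
  rw [← eq_neg_iff_add_eq_zero] at ha
  rw [← norm_neg, ← ha, rayG_succ ν hν] at b
  simp only [pow_zero, mul_one, Nat.factorial_zero, Nat.cast_one, one_mul, zero_add] at b
  rw [Real.norm_of_nonneg (by positivity), mul_inv] at b
  have hs : 0 < ν + n + 1 := by positivity
  field_simp at b
  linarith

theorem ray_sol (ν x : ℝ) (hν : 0 < ν) (hx : x ≠ 0) (h0 : rayT ν (x^2/4) 0 = 0) :
    RaySol ν x (fun n => (x/2)^n * rayT ν (x^2/4) n) where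
  hx := hx
  h0 := by simp [h0]
  h1 := by
    have := rayT_ne ν (x^2/4) hν (by positivity) h0
    simp [hx, this]
  hrec n := by
    have := rayT_rec ν (x^2/4) hν (by positivity) n
    have e : (x/2)^n * rayT ν (x^2/4) n + (x/2)^(n+2) * rayT ν (x^2/4) (n+2)
      = (x/2)^n * (rayT ν (x^2/4) n + (x^2/4) * rayT ν (x^2/4) (n+2)) := by ring
    rw [e, this, pow_succ]
    field_simp
    ring
  hdec := by
    set y := x^2/4
    have hy : 0 ≤ y := by positivity
    have g0 := Real.Gamma_pos_of_pos (show 0 < ν + 1 by positivity)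
    rw [← tendsto_add_atTop_iff_nat 1]
    have t := (FloorSemiring.tendsto_pow_div_factorial_atTop (|x|/2)).const_mul
      (|x|/2 * (Real.exp y * (Real.Gamma (ν+1))⁻¹))
    rw [mul_zero] at t
    refine squeeze_zero_norm (fun n => ?_) t
    have b := rayT_le ν y hν hy (n+1)
    have f := rayG_fact ν hν (n+1)
    have b2 : |rayT ν y (n+1)| ≤ Real.exp y * ((n+1).factorial * Real.Gamma (ν + 1))⁻¹ :=
      b.trans (by gcongr)
    rw [norm_mul, norm_mul, norm_pow, norm_div, Real.norm_eq_abs x, Real.norm_eq_abs (rayT _ _ _)]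
    simp only [Real.norm_natCast, Real.norm_ofNat]
    calc ((n+1:ℕ):ℝ) * ((|x|/2)^(n+1) * |rayT ν y (n+1)|)
        ≤ ((n+1:ℕ):ℝ) * ((|x|/2)^(n+1) * (Real.exp y * ((n+1).factorial * Real.Gamma (ν + 1))⁻¹)) := by
          gcongr
      _ = _ := by
          rw [Nat.factorial_succ]; push_cast
          have : (0:ℝ) < n.factorial := by positivity
          field_simp
          ring

theorem bessel_rayT (ν x : ℝ) (hx : 0 < x) :
    besselJ ν x = (x/2)^ν * rayT ν (x^2/4) 0 := by
  unfold besselJ rayT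
  rw [← tsum_mul_left]
  refine tsum_congr fun m => ?_
  rw [Real.rpow_add (by positivity), show (2 * (m:ℝ)) = ((2*m:ℕ):ℝ) by push_cast; ring,
    Real.rpow_natCast, pow_mul, show (x/2)^2 = x^2/4 by ring,
    show (m:ℝ) + ν + 1 = ν + ((m+0:ℕ):ℝ) + 1 by push_cast; ring]
  ring

theorem ray_finset (ν : ℝ) (hν : 0 < ν) (S : Finset ℝ) (hS : ∀ x ∈ S, x ∈ besselZeros ν) (m : ℕ) :
    4 * (ν+1) * ∑ x ∈ S, (x ^ (2*(m+1)))⁻¹ ≤ rayC ν (2*m) 1 := by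
  have hz : ∀ x ∈ S, 0 < x ∧ rayT ν (x^2/4) 0 = 0 := by
    intro x hx
    obtain ⟨h1, h2⟩ := hS x hx
    rw [bessel_rayT ν x h1] at h2
    have : (x/2)^ν ≠ 0 := (Real.rpow_pos_of_pos (by positivity) _).ne'
    exact ⟨h1, by simpa [this] using h2⟩
  have hd : Disjoint S (S.image (fun x => -x)) := by
    rw [Finset.disjoint_left]
    intro a ha hb
    simp only [Finset.mem_image] at hb
    obtain ⟨b, hb, rfl⟩ := hb
    have := (hz _ ha).1; have := (hz _ hb).1
    linarith
  have := ray_main ν hν (S ∪ S.image (fun x => -x)) (fun x n => (x/2)^n * rayT ν (x^2/4) n) (by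
    intro x hx
    rw [Finset.mem_union] at hx
    rcases hx with hx | hx
    · exact ray_sol ν x hν (hz x hx).1.ne' (hz x hx).2
    · simp only [Finset.mem_image] at hx
      obtain ⟨b, hb, rfl⟩ := hx
      refine ray_sol ν (-b) hν (neg_ne_zero.2 (hz b hb).1.ne') ?_
      rw [neg_sq]; exact (hz b hb).2) m
  rw [Finset.sum_union hd, Finset.sum_image (by intro a _ b _ h; exact neg_injective h)] at this
  simp only [pow_mul, neg_sq] at this ⊢
  rw [← mul_sum] at this
  linarith

theorem rayB_cat (m : ℕ) : rayB (2*m) 1 =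
    2^(2*(m+1)) * (((2 * (m+1)).choose (m+1) : ℝ) / (2 ^ (2 * (m+1) + 1) * (2 * ((m+1:ℕ) : ℝ) - 1))) := by
  have := rayB_formula m 0
  simp only [add_zero, zero_add] at this
  rw [this, Nat.cast_choose ℝ (by omega : m+1 ≤ 2*(m+1)), show 2*(m+1)-(m+1) = m+1 by omega,
    show 2*(m+1) = 2*m+1+1 by ring, Nat.factorial_succ (2*m+1), Nat.factorial_succ (2*m), Nat.factorial_succ m]
  have : (0:ℝ) < m.factorial := by positivity
  have h2 : 2 * (((m+1:ℕ)):ℝ) - 1 = 2*m+1 := by push_cast; ring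
  rw [h2]
  push_cast
  field_simp
  ring

/-- For every positive integer `k` and positive real `ν`,
`σ_k(ν) ≤ (C(2k,k)/(2^{2k+1}(2k-1))) ν^{1-2k} ≤ ν^{1-2k}`. -/
theorem rayleigh_le (k : ℕ) (hk : 1 ≤ k) (ν : ℝ) (hν : 0 < ν) :
    rayleigh k ν ≤
      ((2 * k).choose k : ℝ) / (2 ^ (2 * k + 1) * (2 * (k : ℝ) - 1)) * ν ^ (1 - 2 * (k : ℤ)) ∧
    ((2 * k).choose k : ℝ) / (2 ^ (2 * k + 1) * (2 * (k : ℝ) - 1)) * ν ^ (1 - 2 * (k : ℤ)) ≤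
      ν ^ (1 - 2 * (k : ℤ)) := by
  have hp : 0 < ν ^ (1 - 2 * (k : ℤ)) := zpow_pos hν _
  have hk1 : (1:ℝ) ≤ k := by exact_mod_cast hk
  have hd : (1:ℝ) ≤ 2 * (k:ℝ) - 1 := by linarith
  constructor
  · refine Real.tsum_le_of_sum_le ?_ ?_
    · intro x
      have := x.2.1
      positivity
    · intro S
      obtain ⟨m, rfl⟩ : ∃ m, k = m + 1 := ⟨k - 1, by omega⟩
      have h1 := ray_finset ν hν (S.map (Function.Embedding.subtype _)) (by
        intro x hx
        simp only [Finset.mem_map] at hx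
        obtain ⟨a, _, rfl⟩ := hx
        exact a.2) m
      rw [Finset.sum_map] at h1
      simp only [Function.Embedding.subtype_apply] at h1
      have h2 := h1.trans (rayC_le ν hν (2*m) 1)
      rw [rayB_cat] at h2
      set a := ((2 * (m+1)).choose (m+1) : ℝ) / (2 ^ (2 * (m+1) + 1) * (2 * ((m+1:ℕ) : ℝ) - 1)) with ha
      have ha0 : 0 ≤ a := by positivity
      set s := ∑ i ∈ S, ((i:ℝ) ^ (2 * (m + 1)))⁻¹ with hs
      have hs0 : 0 ≤ s := Finset.sum_nonneg fun i _ => by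
        have := i.2.1
        positivity
      have e : ν ^ (1 - 2 * ((m+1:ℕ) : ℤ)) = (ν ^ (2*m+1))⁻¹ := by
        rw [← zpow_natCast, ← zpow_neg]; congr 1
      rw [e]
      have h3 : 4 * ν * s ≤ 4 * (a / ν ^ (2*m)) := by
        calc 4 * ν * s ≤ 4 * (ν+1) * s := by gcongr; linarith
          _ ≤ _ := h2
          _ = _ := by rw [mul_pow, mul_add, pow_add]; field_simp; norm_num; ring
      rw [← div_eq_mul_inv, pow_succ, ← div_div, le_div_iff₀ hν]
      linarith
  · have hc : ((2 * k).choose k : ℝ) ≤ 2 ^ (2 * k) := by exact_mod_cast Nat.choose_le_two_pow _ _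
    refine mul_le_of_le_one_left hp.le ?_
    rw [div_le_one (by positivity), pow_succ]
    have : (0:ℝ) < 2 ^ (2*k) := by positivity
    nlinarith
end

section
/- For every real ν > −1, the first Rayleigh sum satisfies σ_1(ν) = 1/(4(ν+1)). -/
section Aux
open Complex Metric Filter Topology

theorem rb_finite {F : ℂ → ℂ} (hF : Differentiable ℂ F) (h0 : F 0 ≠ 0) (R : ℝ) :
    {z | F z = 0 ∧ ‖z‖ ≤ R}.Finite := by
  by_contra hinf
  have hinf' : {z | F z = 0 ∧ ‖z‖ ≤ R}.Infinite := hinf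
  obtain ⟨a, -, ha⟩ := hinf'.exists_accPt_of_subset_isCompact (isCompact_closedBall (0:ℂ) R)
    (fun z hz => by simpa using hz.2)
  have hfr : ∃ᶠ z in 𝓝[≠] a, F z = 0 := by
    rw [accPt_iff_frequently_nhdsNE] at ha
    exact ha.mono fun z hz => hz.1
  have han : AnalyticOnNhd ℂ F Set.univ := fun z _ => hF.analyticAt z
  have := han.eqOn_zero_of_preconnected_of_frequently_eq_zero isPreconnected_univ
    (Set.mem_univ a) hfr (Set.mem_univ (0:ℂ))
  exact h0 this

theorem rb_factor {F : ℂ → ℂ} (hF : Differentiable ℂ F) (s : Finset ℂ)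
    (h0 : ∀ a ∈ s, a ≠ 0) (hs : ∀ a ∈ s, F a = 0) :
    ∃ G : ℂ → ℂ, Differentiable ℂ G ∧ ∀ z, F z = (∏ a ∈ s, (1 - z / a)) * G z := by
  classical
  induction s using Finset.induction with
  | empty => exact ⟨F, hF, by simp⟩
  | insert b s hb ih =>
    obtain ⟨G, hG, hFG⟩ := ih (fun a ha => h0 a (by simp [ha])) (fun a ha => hs a (by simp [ha]))
    have hGb : G b = 0 := by
      have h1 := hFG b
      rw [hs b (by simp)] at h1
      rcases mul_eq_zero.mp h1.symm with h | h
      · obtain ⟨a, ha, hab⟩ := Finset.prod_eq_zero_iff.mp h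
        have ha0 := h0 a (by simp [ha])
        field_simp at hab
        have : a = b := by linear_combination hab
        exact absurd (this ▸ ha) hb
      · exact h
    have hb0 := h0 b (by simp)
    refine ⟨fun z => -b * dslope G b z, ?_, fun z => ?_⟩
    · refine Differentiable.const_mul ?_ _
      rw [← differentiableOn_univ]
      exact (Complex.differentiableOn_dslope (by simp)).mpr hG.differentiableOn
    · rw [Finset.prod_insert hb, hFG z]
      have : G z = (z - b) * dslope G b z := by
        have := sub_smul_dslope G b z
        rw [hGb, sub_zero] at this
        simpa using this.symm
      rw [this]; field_simp; ring

theorem rb_logbound {G : ℂ → ℂ} (hG : Differentiable ℂ G) (h0 : G 0 = 1) {R M : ℝ}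
    (hR : 0 < R) (hM : 0 < M) (hne : ∀ z ∈ ball (0:ℂ) R, G z ≠ 0)
    (hb : ∀ z ∈ ball (0:ℂ) R, ‖G z‖ ≤ Real.exp M) : ‖deriv G 0‖ ≤ 4 * M / R := by
  have hdG : Differentiable ℂ (deriv G) := by
    intro z
    exact (hG.analyticAt z).deriv.differentiableAt
  have hd : DifferentiableOn ℂ (fun z => deriv G z / G z) (ball 0 R) :=
    hdG.differentiableOn.div hG.differentiableOn hne
  obtain ⟨g, hg0, hg⟩ := hd.isExactOn_ball.with_val_at 0 0
  have hm0 : (0:ℂ) ∈ ball (0:ℂ) R := by simp [hR]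
  have hexp : ∀ z ∈ ball (0:ℂ) R, G z * exp (-g z) = 1 := by
    have hder : ∀ z ∈ ball (0:ℂ) R, HasDerivAt (fun z => G z * exp (-g z)) 0 z := by
      intro z hz
      have := (hG z).hasDerivAt.mul ((hg z hz).neg.cexp)
      convert! this using 1
      have := hne z hz
      field_simp
      ring
    intro z hz
    have hc := (isOpen_ball (x := (0:ℂ)) (ε := R)).is_const_of_deriv_eq_zero
      (convex_ball _ _).isPreconnected
      (fun z hz => (hder z hz).differentiableAt.differentiableWithinAt)
      (fun z hz => (hder z hz).deriv) hz hm0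
    simpa [hg0, h0] using hc
  have hgd : DifferentiableOn ℂ g (ball 0 R) := fun z hz =>
    (hg z hz).differentiableAt.differentiableWithinAt
  have hre : Set.MapsTo g (ball 0 R) {z | z.re ≤ M} := by
    intro z hz
    have h1 := hexp z hz
    have h2 : G z = exp (g z) := by
      rw [exp_neg] at h1
      field_simp at h1
      exact h1
    have h3 := hb z hz
    rw [h2, norm_exp] at h3
    exact Real.exp_le_exp.mp h3
  have hgb : ∀ z ∈ sphere (0:ℂ) (R/2), ‖g z‖ ≤ 2 * M := by
    intro z hz
    have hz' : ‖z‖ = R/2 := by simpa using hz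
    have := borelCaratheodory_zero hM hgd hre hR (z := z) (by simp [hz']; linarith) hg0
    rw [hz'] at this
    convert this using 1
    field_simp; ring
  have hcl : DiffContOnCl ℂ g (ball 0 (R/2)) := by
    apply DifferentiableOn.diffContOnCl
    rw [closure_ball _ (by positivity)]
    exact hgd.mono (closedBall_subset_ball (by linarith))
  have := norm_deriv_le_of_forall_mem_sphere_norm_le (by positivity : 0 < R/2) hcl hgb
  rw [(hg 0 hm0).deriv, h0, div_one] at this
  convert this using 1
  field_simp; ring

theorem rb_prod_hasDerivAt (s : Finset ℂ) :
    HasDerivAt (fun z : ℂ => ∏ a ∈ s, (1 - z / a)) (-∑ a ∈ s, 1 / a) 0 := by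
  have h : ∀ a ∈ s, HasDerivAt (fun z : ℂ => (1 - z / a)) (-(1/a)) 0 := by
    intro a _
    simpa using ((hasDerivAt_id (0:ℂ)).div_const a).const_sub 1
  have := HasDerivAt.fun_finsetProd h
  simpa using this

theorem rb_core {F : ℂ → ℂ} (hF : Differentiable ℂ F) (h0 : F 0 = 1)
    (hgr : ∀ ε > 0, ∃ C : ℝ, ∀ z, ‖F z‖ ≤ C * Real.exp (ε * ‖z‖))
    (hsimp : ∀ z, F z = 0 → deriv F z ≠ 0) (ε : ℝ) (hε : 0 < ε) :
    ∃ R₀ : ℝ, ∀ R ≥ R₀, ∀ s : Finset ℂ, (∀ z, z ∈ s ↔ F z = 0 ∧ ‖z‖ ≤ R) →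
      ‖deriv F 0 + ∑ a ∈ s, 1 / a‖ ≤ ε := by
  obtain ⟨C, hC⟩ := hgr (ε/16) (by positivity)
  have hC1 : 1 ≤ C := by simpa [h0] using hC 0
  refine ⟨max 1 (8 * Real.log C / ε), fun R hR s hs => ?_⟩
  have hR1 : 1 ≤ R := le_trans (le_max_left _ _) hR
  have hR0 : 0 < R := by linarith
  have hR2 : 8 * Real.log C / ε ≤ R := le_trans (le_max_right _ _) hR
  have hs0 : ∀ a ∈ s, a ≠ 0 := by
    rintro a ha rfl
    have := ((hs 0).mp ha).1
    simp [h0] at this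
  obtain ⟨G, hG, hFG⟩ := rb_factor hF s hs0 (fun a ha => ((hs a).mp ha).1)
  have hG0 : G 0 = 1 := by have := hFG 0; simpa [h0] using this.symm
  have hderiv : deriv F 0 = -∑ a ∈ s, 1 / a + deriv G 0 := by
    have h1 := (rb_prod_hasDerivAt s).mul (hG 0).hasDerivAt
    have h2 : F = (fun z => (∏ a ∈ s, (1 - z / a))) * G := funext hFG
    rw [h2, h1.deriv]
    simp [hG0]
  have hne : ∀ z ∈ ball (0:ℂ) R, G z ≠ 0 := by
    intro z hz hGz
    have hFz : F z = 0 := by rw [hFG, hGz, mul_zero]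
    have hzs : z ∈ s := (hs z).mpr ⟨hFz, by simpa using (mem_ball_zero_iff.mp hz).le⟩
    apply hsimp z hFz
    have hP : DifferentiableAt ℂ (fun z : ℂ => ∏ a ∈ s, (1 - z / a)) z := by fun_prop
    have h1 := hP.hasDerivAt.mul (hG z).hasDerivAt
    have h2 : F = (fun z => (∏ a ∈ s, (1 - z / a))) * G := funext hFG
    rw [h2, h1.deriv, hGz, Finset.prod_eq_zero hzs]
    · simp
    · have := hs0 z hzs
      field_simp; ring
  set M := Real.log C + ε / 8 * R with hMdef
  have hlog : 0 ≤ Real.log C := Real.log_nonneg hC1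
  have hM : 0 < M := by positivity
  have hsph : ∀ z ∈ frontier (ball (0:ℂ) (2*R)), ‖G z‖ ≤ Real.exp M := by
    intro z hz
    rw [frontier_ball _ (by positivity)] at hz
    have hz' : ‖z‖ = 2 * R := by simpa using hz
    have h1 : ‖F z‖ ≤ Real.exp M := by
      refine (hC z).trans (le_of_eq ?_)
      rw [hMdef, Real.exp_add, Real.exp_log (by linarith), hz']
      ring_nf
    have h2 : 1 ≤ ‖∏ a ∈ s, (1 - z / a)‖ := by
      rw [norm_prod]
      have : ∏ a ∈ s, (1:ℝ) ≤ ∏ a ∈ s, ‖1 - z / a‖ := by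
        apply Finset.prod_le_prod
        · intros; norm_num
        · intro a ha
          have ha0 : 0 < ‖a‖ := norm_pos_iff.mpr (hs0 a ha)
          have haR := ((hs a).mp ha).2
          have h3 : 2 ≤ ‖z / a‖ := by
            rw [norm_div, le_div_iff₀ ha0, hz']; linarith
          have h4 := norm_sub_norm_le (z / a) 1
          rw [norm_sub_rev] at h4
          simp only [norm_one] at h4
          linarith
      simpa using this
    rw [hFG, norm_mul] at h1
    nlinarith [norm_nonneg (G z)]
  have hb : ∀ z ∈ ball (0:ℂ) R, ‖G z‖ ≤ Real.exp M := by
    intro z hz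
    refine norm_le_of_forall_mem_frontier_norm_le isBounded_ball hG.diffContOnCl hsph ?_
    exact subset_closure (ball_subset_ball (by linarith) hz)
  have hfin := rb_logbound hG hG0 hR0 hM hne hb
  have : deriv F 0 + ∑ a ∈ s, 1 / a = deriv G 0 := by rw [hderiv]; ring
  rw [this]
  refine hfin.trans ?_
  rw [div_le_iff₀ hR0, hMdef]
  rw [div_le_iff₀ hε] at hR2
  linarith

noncomputable def rbPS (c : ℕ → ℝ) (z : ℂ) : ℂ := ∑' m : ℕ, (c m : ℂ) * z ^ m

def rbEnt (c : ℕ → ℝ) : Prop := ∀ K > 0, ∃ C : ℝ, ∀ m : ℕ, |c m| * m.factorial ≤ C * K ^ m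

def rbD (c : ℕ → ℝ) (m : ℕ) : ℝ := (m + 1) * c (m + 1)

theorem rbEnt_D {c : ℕ → ℝ} (h : rbEnt c) : rbEnt (rbD c) := by
  intro K hK
  obtain ⟨C, hC⟩ := h K hK
  refine ⟨C * K, fun m => ?_⟩
  have := hC (m + 1)
  rw [rbD, abs_mul, abs_of_nonneg (by positivity : (0:ℝ) ≤ m + 1)]
  rw [Nat.factorial_succ] at this
  push_cast at this
  calc _ = |c (m+1)| * ((m + 1) * m.factorial) := by ring
    _ ≤ _ := this
    _ = _ := by ring

theorem rbEnt_term {c : ℕ → ℝ} {K C : ℝ} (hC : ∀ m : ℕ, |c m| * m.factorial ≤ C * K ^ m)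
    (r : ℝ) (hr : 0 ≤ r) (m : ℕ) : |c m| * r ^ m ≤ C * ((K * r) ^ m / m.factorial) := by
  have hf : (0:ℝ) < m.factorial := by positivity
  have h1 : |c m| ≤ C * K ^ m / m.factorial := by
    rw [le_div_iff₀ hf]; exact hC m
  calc |c m| * r ^ m ≤ C * K ^ m / m.factorial * r ^ m := by gcongr
    _ = _ := by rw [mul_pow]; ring

theorem rbEnt_summable {c : ℕ → ℝ} (h : rbEnt c) (r : ℝ) (hr : 0 ≤ r) :
    Summable fun m => |c m| * r ^ m := by
  obtain ⟨C, hC⟩ := h 1 one_pos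
  exact Summable.of_nonneg_of_le (fun m => by positivity) (rbEnt_term hC r hr)
    ((Real.summable_pow_div_factorial _).mul_left C)

theorem rbPS_summable {c : ℕ → ℝ} (h : rbEnt c) (z : ℂ) :
    Summable fun m => (c m : ℂ) * z ^ m := by
  apply Summable.of_norm
  simpa using rbEnt_summable h ‖z‖ (norm_nonneg z)

theorem rbPS_growth {c : ℕ → ℝ} (h : rbEnt c) (ε : ℝ) (hε : 0 < ε) :
    ∃ C : ℝ, ∀ z, ‖rbPS c z‖ ≤ C * Real.exp (ε * ‖z‖) := by
  obtain ⟨C, hC⟩ := h ε hε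
  refine ⟨C, fun z => ?_⟩
  have h1 : HasSum (fun m : ℕ => C * ((ε * ‖z‖) ^ m / m.factorial)) (C * Real.exp (ε * ‖z‖)) := by
    apply HasSum.mul_left
    have := (Real.summable_pow_div_factorial (ε * ‖z‖)).hasSum
    rwa [← congrFun (NormedSpace.exp_eq_tsum_div (𝔸 := ℝ)) (ε * ‖z‖), ← Real.exp_eq_exp_ℝ] at this
  refine tsum_of_norm_bounded h1 fun m => ?_
  simpa using rbEnt_term hC ‖z‖ (norm_nonneg z) m

theorem rbPS_hasDerivAt {c : ℕ → ℝ} (h : rbEnt c) (z : ℂ) :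
    HasDerivAt (rbPS c) (rbPS (rbD c) z) z := by
  set r := ‖z‖ + 1 with hr
  have hr0 : 0 ≤ r := by positivity
  have hu : Summable fun m : ℕ => |c m| * (m * r ^ (m - 1)) := by
    rw [← summable_nat_add_iff 1]
    have := rbEnt_summable (rbEnt_D h) r hr0
    refine this.congr fun m => ?_
    rw [rbD, abs_mul, abs_of_nonneg (by positivity : (0:ℝ) ≤ m + 1)]
    rw [Nat.add_sub_cancel]; push_cast; ring
  have key := hasDerivAt_tsum_of_isPreconnected (𝕜 := ℂ) (F := ℂ)
    (g := fun (m : ℕ) (z : ℂ) => (c m : ℂ) * z ^ m)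
    (g' := fun (m : ℕ) (z : ℂ) => (c m : ℂ) * (m * z ^ (m - 1)))
    (y₀ := 0) (y := z) hu (isOpen_ball (x := (0:ℂ)) (ε := r))
    (convex_ball _ _).isPreconnected
    (fun m y _ => (hasDerivAt_pow m y).const_mul _)
    (fun m y hy => by
      have hy' : ‖y‖ ≤ r := (mem_ball_zero_iff.mp hy).le
      simp only [norm_mul, norm_pow, Complex.norm_real, Real.norm_eq_abs, Complex.norm_natCast]
      gcongr)
    (by simp; positivity) (rbPS_summable h 0) (by simp [hr])
  have hs : Summable fun m : ℕ => (c m : ℂ) * (m * z ^ (m - 1)) := by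
    refine Summable.of_norm_bounded hu fun m => ?_
    simp only [norm_mul, norm_pow, Complex.norm_real, Real.norm_eq_abs, Complex.norm_natCast]
    gcongr
    linarith
  have he : ∑' m : ℕ, (c m : ℂ) * (m * z ^ (m - 1)) = rbPS (rbD c) z := by
    rw [hs.tsum_eq_zero_add, rbPS]
    simp only [Nat.cast_zero, zero_mul, mul_zero, zero_add, rbD]
    congr 1; funext m
    rw [Nat.add_sub_cancel]; push_cast; ring
  rw [he] at key
  exact key

noncomputable def rbc (ν : ℝ) (m : ℕ) : ℝ :=
  (-1) ^ m * (Real.Gamma (ν + 1) / (m.factorial * Real.Gamma (m + ν + 1)))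

theorem rb_gamma_pos {ν : ℝ} (hν : -1 < ν) (m : ℕ) : 0 < Real.Gamma (m + ν + 1) :=
  Real.Gamma_pos_of_pos (by have : (0:ℝ) ≤ m := by positivity
                            linarith)

theorem rb_gamma_succ {ν : ℝ} (hν : -1 < ν) (m : ℕ) :
    Real.Gamma ((m + 1 : ℕ) + ν + 1) = (m + ν + 1) * Real.Gamma (m + ν + 1) := by
  rw [← Real.Gamma_add_one]
  · push_cast; ring_nf
  · have : (0:ℝ) ≤ m := by positivity
    linarith

theorem rbc_zero {ν : ℝ} (hν : -1 < ν) : rbc ν 0 = 1 := by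
  have := rb_gamma_pos hν 0
  simp at this
  simp [rbc, this.ne']

theorem rbc_succ {ν : ℝ} (hν : -1 < ν) (m : ℕ) :
    (m + 1) * (m + ν + 1) * rbc ν (m + 1) = - rbc ν m := by
  have h := (rb_gamma_pos hν m).ne'
  have h2 : (m:ℝ) + ν + 1 ≠ 0 := by have : (0:ℝ) ≤ m := by positivity
                                    linarith
  rw [rbc, rbc, rb_gamma_succ hν, Nat.factorial_succ]
  push_cast
  field_simp
  ring

theorem rbc_ent {ν : ℝ} (hν : -1 < ν) : rbEnt (rbc ν) := by
  intro K hK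
  set e : ℕ → ℝ := fun m => |rbc ν m| * m.factorial / K ^ m with he
  have hee : ∀ m, e m = Real.Gamma (ν + 1) / Real.Gamma (m + ν + 1) / K ^ m := by
    intro m
    have h := (rb_gamma_pos hν m)
    have h' : 0 < Real.Gamma (ν + 1) := by simpa using rb_gamma_pos hν 0
    simp only [he, rbc]
    rw [abs_mul, abs_pow, abs_neg, abs_one, one_pow, one_mul, abs_of_pos (by positivity)]
    field_simp
  have hpos : ∀ m, 0 < e m := by
    intro m
    have h := (rb_gamma_pos hν m)
    have h' : 0 < Real.Gamma (ν + 1) := by simpa using rb_gamma_pos hν 0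
    rw [hee]; positivity
  have hsum : Summable e := by
    refine summable_of_ratio_test_tendsto_lt_one (l := 0) one_pos
      (Eventually.of_forall fun m => (hpos m).ne') ?_
    have : (fun m => ‖e (m+1)‖ / ‖e m‖) = fun m : ℕ => (1 / K) / (m + ν + 1) := by
      funext m
      have h := (rb_gamma_pos hν m)
      have h' : 0 < Real.Gamma (ν + 1) := by simpa using rb_gamma_pos hν 0
      have h2 : 0 < (m:ℝ) + ν + 1 := by have : (0:ℝ) ≤ m := by positivity
                                        linarith
      rw [Real.norm_of_nonneg (hpos _).le, Real.norm_of_nonneg (hpos _).le, hee, hee,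
        rb_gamma_succ hν]
      field_simp
      rw [pow_succ]
    rw [this]
    apply Tendsto.const_div_atTop
    simp only [add_assoc]
    exact tendsto_atTop_add_const_right _ _ tendsto_natCast_atTop_atTop
  refine ⟨∑' m, e m, fun m => ?_⟩
  have := hsum.le_tsum m (fun j _ => (hpos j).le)
  rwa [he, div_le_iff₀ (by positivity)] at this

theorem rb_ode {ν : ℝ} (hν : -1 < ν) (z : ℂ) :
    z * rbPS (rbD (rbD (rbc ν))) z + (ν + 1) * rbPS (rbD (rbc ν)) z + rbPS (rbc ν) z = 0 := by
  have h0 := rbc_ent hν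
  have h1 := rbEnt_D h0
  have h2 := rbEnt_D h1
  have s0 := (rbPS_summable h0 z).hasSum
  have s1 := ((rbPS_summable h1 z).hasSum).mul_left ((ν:ℂ) + 1)
  have s2 : HasSum (fun m : ℕ => ((m * rbD (rbc ν) m : ℝ) : ℂ) * z ^ m)
      (z * rbPS (rbD (rbD (rbc ν))) z) := by
    rw [← hasSum_nat_add_iff' 1]
    have := ((rbPS_summable h2 z).hasSum).mul_left z
    simp only [Finset.range_one, Finset.sum_singleton, Nat.cast_zero, zero_mul, ofReal_zero,
      sub_zero]
    refine (congrArg (fun f => HasSum f (z * rbPS (rbD (rbD (rbc ν))) z)) (funext fun m => ?_)).mpr this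
    simp only [rbD]; push_cast; ring
  have s := (s2.add s1).add s0
  refine s.unique ?_
  convert! hasSum_zero with m
  have := rbc_succ hν m
  have h' : (m * rbD (rbc ν) m + (ν + 1) * rbD (rbc ν) m + rbc ν m : ℝ) = 0 := by
    rw [rbD]; linear_combination this
  have h'' := congrArg (fun x : ℝ => (x : ℂ) * z ^ m) h'
  simp only [ofReal_zero, zero_mul] at h''
  rw [← h'']; push_cast; ring

theorem rb_mono {V V' : ℝ → ℝ} {b : ℝ} (hb : 0 < b) (hc : ContinuousOn V (Set.Icc 0 b))
    (hd : ∀ t ∈ Set.Ioo 0 b, HasDerivAt V (V' t) t) (hn : ∀ t ∈ Set.Ioo 0 b, 0 ≤ V' t)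
    (h0 : V 0 = 0) (h1 : V b = 0) : ∀ t ∈ Set.Ioo 0 b, V' t = 0 := by
  have hm : MonotoneOn V (Set.Icc 0 b) := by
    refine monotoneOn_of_deriv_nonneg (convex_Icc _ _) hc ?_ ?_
    · rw [interior_Icc]
      exact fun t ht => (hd t ht).differentiableAt.differentiableWithinAt
    · rw [interior_Icc]
      intro t ht
      rw [(hd t ht).deriv]; exact hn t ht
  have hz : ∀ t ∈ Set.Ioo 0 b, V t = 0 := by
    intro t ht
    have ht' := Set.Ioo_subset_Icc_self ht
    have a1 := hm (Set.left_mem_Icc.mpr hb.le) ht' ht.1.le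
    have a2 := hm ht' (Set.right_mem_Icc.mpr hb.le) ht.2.le
    linarith
  intro t ht
  have hev : V =ᶠ[𝓝 t] fun _ => 0 :=
    Filter.eventuallyEq_of_mem (isOpen_Ioo.mem_nhds ht) hz
  exact (hd t ht).unique ((hasDerivAt_const t (0:ℝ)).congr_of_eventuallyEq hev)

theorem rb_F0 {ν : ℝ} (hν : -1 < ν) : rbPS (rbc ν) 0 = 1 := by
  rw [rbPS, tsum_eq_single 0]
  · simp [rbc_zero hν]
  · intro m hm; simp [hm]

theorem rb_F1_0 {ν : ℝ} (hν : -1 < ν) : rbPS (rbD (rbc ν)) 0 = -(1 / (ν + 1) : ℝ) := by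
  rw [rbPS, tsum_eq_single 0]
  · have h := rbc_succ hν 0
    rw [rbc_zero hν] at h
    have h2 : ν + 1 ≠ 0 := by linarith
    have : rbD (rbc ν) 0 = -(1 / (ν + 1)) := by
      simp [rbD] at h ⊢
      field_simp
      linarith
    rw [this]; simp
  · intro m hm; simp [hm]

theorem rb_cont {ν : ℝ} (hν : -1 < ν) : Continuous (rbPS (rbc ν)) :=
  continuous_iff_continuousAt.mpr fun z => (rbPS_hasDerivAt (rbc_ent hν) z).continuousAt

theorem rb_cont1 {ν : ℝ} (hν : -1 < ν) : Continuous (rbPS (rbD (rbc ν))) :=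
  continuous_iff_continuousAt.mpr fun z => (rbPS_hasDerivAt (rbEnt_D (rbc_ent hν)) z).continuousAt

/-- a continuous function vanishing on `(0,b)` vanishes at `0` -/
theorem rb_limit {p : ℝ → ℝ} (hp : Continuous p) {b : ℝ} (hb : 0 < b)
    (h : ∀ t ∈ Set.Ioo 0 b, p t = 0) : p 0 = 0 := by
  have : Set.EqOn p (fun _ => 0) (closure (Set.Ioo 0 b)) :=
    Set.EqOn.closure (fun t ht => h t ht) hp continuous_const
  exact this (by rw [closure_Ioo hb.ne]; exact Set.left_mem_Icc.mpr hb.le)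

theorem rb_real_zero {ν : ℝ} (hν : -1 < ν) (l : ℂ) (hl : rbPS (rbc ν) l = 0) : l.im = 0 := by
  by_contra him
  have hd0 := rbPS_hasDerivAt (rbc_ent hν)
  have hd1 := rbPS_hasDerivAt (rbEnt_D (rbc_ent hν))
  set F := rbPS (rbc ν)
  set F1 := rbPS (rbD (rbc ν))
  set F2 := rbPS (rbD (rbD (rbc ν)))
  have hcF : Continuous F := rb_cont hν
  have hcF1 : Continuous F1 := rb_cont1 hν
  have hlin : ∀ t : ℝ, HasDerivAt (fun t : ℝ => l * (t:ℂ)) l t := by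
    intro t
    simpa using (Complex.ofRealCLM.hasDerivAt (x := t)).const_mul l
  have hp : ∀ t : ℝ, HasDerivAt (fun t : ℝ => F (l * t)) (l * F1 (l * t)) t := by
    intro t
    have := (hd0 (l * t)).comp t (hlin t)
    rw [mul_comm]; exact this
  have hq : ∀ t : ℝ, HasDerivAt (fun t : ℝ => l * F1 (l * t)) (l * (l * F2 (l * t))) t := by
    intro t
    have := ((hd1 (l * t)).comp t (hlin t)).const_mul l
    rw [mul_comm l (F2 _)]; exact this
  have hre : ∀ {f : ℝ → ℂ} {f' : ℂ} {t : ℝ}, HasDerivAt f f' t →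
      HasDerivAt (fun t => (f t).re) f'.re t := fun h =>
    Complex.reCLM.hasFDerivAt.comp_hasDerivAt _ h
  have hime : ∀ {f : ℝ → ℂ} {f' : ℂ} {t : ℝ}, HasDerivAt f f' t →
      HasDerivAt (fun t => (f t).im) f'.im t := fun h =>
    Complex.imCLM.hasFDerivAt.comp_hasDerivAt _ h
  set V : ℝ → ℝ := fun t => t ^ (ν + 1) * (-l.im * ((l * F1 (l * t)).im * (F (l * t)).re
    - (l * F1 (l * t)).re * (F (l * t)).im)) with hV
  set V' : ℝ → ℝ := fun t => t ^ ν * (l.im ^ 2 * ((F (l * t)).re ^ 2 + (F (l * t)).im ^ 2)) with hV'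
  have hlc : Continuous fun t : ℝ => l * (t : ℂ) := by fun_prop
  have key := rb_mono (V := V) (V' := V') one_pos ?_ ?_ ?_ ?_ ?_
  · have hz : ∀ t ∈ Set.Ioo (0:ℝ) 1, (F (l * t)).re = 0 := by
      intro t ht
      have h1 := key t ht
      have ht0 : t ^ ν ≠ 0 := (Real.rpow_pos_of_pos ht.1 ν).ne'
      simp only [hV', mul_eq_zero, ht0, false_or, pow_eq_zero_iff two_ne_zero, him] at h1
      nlinarith [sq_nonneg (F (l * t)).re, sq_nonneg (F (l * t)).im]
    have := rb_limit (p := fun t : ℝ => (F (l * t)).re)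
      (Complex.continuous_re.comp (hcF.comp hlc)) one_pos hz
    have h00 : F 0 = 1 := rb_F0 hν
    simp [h00] at this
  · apply Continuous.continuousOn
    have c1 : Continuous fun t : ℝ => F (l * t) := hcF.comp hlc
    have c2 : Continuous fun t : ℝ => F1 (l * t) := hcF1.comp hlc
    have c3 : Continuous fun t : ℝ => t ^ (ν + 1) :=
      Real.continuous_rpow_const (by linarith)
    have := Complex.continuous_re
    have := Complex.continuous_im
    fun_prop
  · intro t ht
    have hpow : HasDerivAt (fun t : ℝ => t ^ (ν + 1)) ((ν + 1) * t ^ ν) t := by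
      simpa using Real.hasDerivAt_rpow_const (x := t) (p := ν + 1) (Or.inl ht.1.ne')
    have hh := hpow.mul (((((hime (hq t)).mul (hre (hp t))).sub
      ((hre (hq t)).mul (hime (hp t))))).const_mul (-l.im))
    convert! hh using 1
    have hode : (l * t) * F2 (l * t) + (ν + 1) * F1 (l * t) + F (l * t) = 0 := rb_ode hν (l * t)
    have ho2 : (t:ℂ) * (l * (l * F2 (l * t))) = -(ν + 1) * (l * F1 (l * t)) - l * F (l * t) := by
      linear_combination l * hode
    have hr := congrArg Complex.re ho2
    have hi := congrArg Complex.im ho2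
    simp only [Complex.mul_re, Complex.mul_im, Complex.ofReal_re, Complex.ofReal_im, Complex.sub_re,
      Complex.sub_im, Complex.neg_re, Complex.neg_im, Complex.add_re, Complex.add_im,
      Complex.one_re, Complex.one_im] at hr hi
    rw [Real.rpow_add_one ht.1.ne']
    simp only [hV', Complex.mul_re, Complex.mul_im, Pi.sub_apply, Pi.mul_apply]
    linear_combination (t ^ ν * l.im) * ((F (l * t)).re * hi - (F (l * t)).im * hr)
  · intro t ht
    have := (Real.rpow_pos_of_pos ht.1 ν).le
    simp only [hV']; positivity
  · simp only [hV]
    rw [Real.zero_rpow (by linarith)]; simp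
  · simp [hV, hl]

theorem rb_simple {ν : ℝ} (hν : -1 < ν) (a : ℝ) (ha : 0 < a) (h : rbPS (rbc ν) a = 0) :
    rbPS (rbD (rbc ν)) a ≠ 0 := by
  intro h1
  have hd0 := rbPS_hasDerivAt (rbc_ent hν)
  have hd1 := rbPS_hasDerivAt (rbEnt_D (rbc_ent hν))
  set F := rbPS (rbc ν)
  set F1 := rbPS (rbD (rbc ν))
  set F2 := rbPS (rbD (rbD (rbc ν)))
  have hcF : Continuous F := rb_cont hν
  have hcF1 : Continuous F1 := rb_cont1 hν
  obtain ⟨N, hN⟩ := exists_nat_gt |2 * ν + 1|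
  have hN0 : (0:ℝ) < N := lt_of_le_of_lt (abs_nonneg _) hN
  have hN1 : 2 * ν + 1 < N := lt_of_le_of_lt (le_abs_self _) hN
  obtain ⟨n, rfl⟩ : ∃ n, N = n + 1 := ⟨N - 1, by have : 0 < N := by exact_mod_cast hN0
                                                 omega⟩
  set V : ℝ → ℝ := fun x => x ^ (n + 1) * ((F x).re ^ 2 + x * (F1 x).re ^ 2) with hV
  set V' : ℝ → ℝ := fun x => x ^ n * (((n + 1 : ℕ) : ℝ) * (F x).re ^ 2
    + (((n + 1 : ℕ) : ℝ) - (2 * ν + 1)) * x * (F1 x).re ^ 2) with hV'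
  have key := rb_mono (V := V) (V' := V') ha ?_ ?_ ?_ ?_ ?_
  · have hz : ∀ t ∈ Set.Ioo (0:ℝ) a, (F t).re = 0 := by
      intro t ht
      have h1 := key t ht
      have ht0 : t ^ n ≠ 0 := (pow_pos ht.1 n).ne'
      simp only [hV', mul_eq_zero, ht0, false_or] at h1
      have t1 : 0 ≤ (((n + 1 : ℕ) : ℝ) - (2 * ν + 1)) * t * (F1 t).re ^ 2 := by
        have := ht.1
        have : 0 < ((n + 1 : ℕ) : ℝ) - (2 * ν + 1) := by linarith
        positivity
      have t2 : ((n + 1 : ℕ) : ℝ) * (F t).re ^ 2 = 0 := by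
        have : 0 ≤ ((n + 1 : ℕ) : ℝ) * (F t).re ^ 2 := by positivity
        linarith
      simpa [hN0.ne', -Nat.cast_add] using t2
    have := rb_limit (p := fun t : ℝ => (F t).re)
      (Complex.continuous_re.comp (hcF.comp Complex.continuous_ofReal)) ha hz
    have h00 : F 0 = 1 := rb_F0 hν
    simp [h00] at this
  · apply Continuous.continuousOn
    have c1 : Continuous fun t : ℝ => (F t).re :=
      Complex.continuous_re.comp (hcF.comp Complex.continuous_ofReal)
    have c2 : Continuous fun t : ℝ => (F1 t).re :=
      Complex.continuous_re.comp (hcF1.comp Complex.continuous_ofReal)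
    fun_prop
  · intro t ht
    have hp := (hd0 t).real_of_complex
    have hq := (hd1 t).real_of_complex
    have hh := (hasDerivAt_pow (n+1) t).mul ((hp.pow 2).add ((hasDerivAt_id t).mul (hq.pow 2)))
    convert! hh using 1
    have hode : t * F2 t + (ν + 1) * F1 t + F t = 0 := rb_ode hν t
    have hr := congrArg Complex.re hode
    simp at hr
    simp only [hV', Pi.pow_apply, id, Nat.add_sub_cancel, Pi.add_apply, Pi.mul_apply]
    push_cast
    ring_nf at hr ⊢
    linear_combination (-2 * t ^ n * t * (F1 t).re) * hr
  · intro t ht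
    have := ht.1
    have : 0 < ((n + 1 : ℕ) : ℝ) - (2 * ν + 1) := by linarith
    simp only [hV']; positivity
  · simp [hV]
  · simp [hV, h, h1]

theorem rb_pos_zero {ν : ℝ} (hν : -1 < ν) (x : ℝ) (h : rbPS (rbc ν) x = 0) : 0 < x := by
  by_contra hx
  have hx' : 0 ≤ -x := by linarith
  have hs := rbPS_summable (rbc_ent hν) x
  have hsr : Summable fun m => rbc ν m * x ^ m := by
    rw [← Complex.summable_ofReal]; exact_mod_cast hs
  have h2 : ∑' m, rbc ν m * x ^ m = 0 := by
    have : ((∑' m, rbc ν m * x ^ m : ℝ) : ℂ) = 0 := by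
      rw [Complex.ofReal_tsum, ← h, rbPS]; push_cast; rfl
    exact_mod_cast this
  have hnn : ∀ m, 0 ≤ rbc ν m * x ^ m := by
    intro m
    have h' : 0 < Real.Gamma (ν + 1) := by simpa using rb_gamma_pos hν 0
    have h3 := rb_gamma_pos hν m
    have : rbc ν m * x ^ m = (Real.Gamma (ν + 1) / (m.factorial * Real.Gamma (m + ν + 1))) * (-x) ^ m := by
      rw [rbc, neg_pow x]; ring
    rw [this]; positivity
  have := hsr.le_tsum 0 (fun j _ => hnn j)
  rw [h2, rbc_zero hν] at this
  norm_num at this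

theorem rb_diff {ν : ℝ} (hν : -1 < ν) : Differentiable ℂ (rbPS (rbc ν)) :=
  fun z => (rbPS_hasDerivAt (rbc_ent hν) z).differentiableAt

theorem rb_bessel {ν : ℝ} (hν : -1 < ν) (x : ℝ) (hx : 0 < x) :
    besselJ ν x = 0 ↔ rbPS (rbc ν) ((x ^ 2 / 4 : ℝ) : ℂ) = 0 := by
  have h' : 0 < Real.Gamma (ν + 1) := by simpa using rb_gamma_pos hν 0
  have hp : 0 < (x / 2) ^ ν := Real.rpow_pos_of_pos (by positivity) ν
  have h1 : besselJ ν x = (x / 2) ^ ν / Real.Gamma (ν + 1) *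
      ∑' m, rbc ν m * (x ^ 2 / 4) ^ m := by
    rw [besselJ, ← tsum_mul_left]
    congr 1; funext m
    have h3 := rb_gamma_pos hν m
    have h4 : (x / 2) ^ (2 * (m:ℝ) + ν) = (x ^ 2 / 4) ^ m * (x / 2) ^ ν := by
      rw [Real.rpow_add (by positivity)]
      have : (2 * (m:ℝ)) = ((2 * m : ℕ) : ℝ) := by push_cast; ring
      rw [this, Real.rpow_natCast, pow_mul]
      congr 2; ring
    rw [h4, rbc]
    field_simp
  have h2 : rbPS (rbc ν) ((x ^ 2 / 4 : ℝ) : ℂ) = ((∑' m, rbc ν m * (x ^ 2 / 4) ^ m : ℝ) : ℂ) := by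
    rw [Complex.ofReal_tsum, rbPS]; push_cast; rfl
  rw [h1, h2, Complex.ofReal_eq_zero, mul_eq_zero]
  have : (x / 2) ^ ν / Real.Gamma (ν + 1) ≠ 0 := by positivity
  simp [this]

theorem rb_main {ν : ℝ} (hν : -1 < ν) :
    HasSum (fun x : besselZeros ν => (((x : ℝ)) ^ 2)⁻¹) (1 / (4 * (ν + 1))) := by
  classical
  set F := rbPS (rbc ν) with hF
  have hF0 : F 0 = 1 := rb_F0 hν
  set φ : besselZeros ν → ℂ := fun x => (((x : ℝ) ^ 2 / 4 : ℝ) : ℂ) with hφ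
  have hinj : Function.Injective φ := by
    intro x y hxy
    have h1 : (x : ℝ) ^ 2 / 4 = (y : ℝ) ^ 2 / 4 := Complex.ofReal_injective hxy
    have hx := x.2.1
    have hy := y.2.1
    apply Subtype.ext
    nlinarith
  have hrange : ∀ z, F z = 0 → ∃ x, φ x = z := by
    intro z hz
    have him := rb_real_zero hν z hz
    have hzr : z = (z.re : ℂ) := Complex.ext rfl (by simp [him])
    have hpos : 0 < z.re := rb_pos_zero hν z.re (by rw [← hzr]; exact hz)
    have hx : 0 < 2 * Real.sqrt z.re := by positivity
    have hsq : (2 * Real.sqrt z.re) ^ 2 / 4 = z.re := by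
      rw [mul_pow, Real.sq_sqrt hpos.le]; ring
    refine ⟨⟨2 * Real.sqrt z.re, hx, ?_⟩, ?_⟩
    · rw [rb_bessel hν _ hx, hsq, ← hzr]; exact hz
    · simp only [hφ, hsq]; exact hzr.symm
  have hzero : ∀ x, F (φ x) = 0 := fun x => (rb_bessel hν _ x.2.1).mp x.2.2
  have hderiv : ∀ z, deriv F z = rbPS (rbD (rbc ν)) z := fun z =>
    (rbPS_hasDerivAt (rbc_ent hν) z).deriv
  have hsimple : ∀ z, F z = 0 → deriv F z ≠ 0 := by
    intro z hz
    obtain ⟨x, rfl⟩ := hrange z hz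
    rw [hderiv]
    have hx := x.2.1
    exact rb_simple hν _ (by positivity) hz
  have hfin := fun R => rb_finite (rb_diff hν) (by rw [rb_F0 hν]; exact one_ne_zero) R
  set t : ℝ → Finset (besselZeros ν) := fun R => (hfin R).toFinset.preimage φ hinj.injOn with ht
  have hsum : ∀ R, ∑ a ∈ (hfin R).toFinset, 1 / a =
      ((4 * ∑ x ∈ t R, ((x : ℝ) ^ 2)⁻¹ : ℝ) : ℂ) := by
    intro R
    rw [← Finset.sum_preimage φ (hfin R).toFinset hinj.injOn (fun a => 1 / a)]
    · push_cast
      rw [Finset.mul_sum]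
      refine Finset.sum_congr rfl fun x _ => ?_
      simp [hφ]; ring
    · intro z hz hn
      exact absurd (hrange z ((hfin R).mem_toFinset.mp hz).1) hn
  have hcore : ∀ ε > 0, ∃ R₀, ∀ R ≥ R₀,
      |∑ x ∈ t R, ((x : ℝ) ^ 2)⁻¹ - 1 / (4 * (ν + 1))| ≤ ε := by
    intro ε hε
    obtain ⟨R₀, h⟩ := rb_core (rb_diff hν) hF0 (rbPS_growth (rbc_ent hν)) hsimple ε hε
    refine ⟨R₀, fun R hR => ?_⟩
    have h1 := h R hR (hfin R).toFinset (fun z => (hfin R).mem_toFinset)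
    rw [hsum, hderiv, rb_F1_0 hν, ← Complex.ofReal_neg, ← Complex.ofReal_add,
      Complex.norm_real, Real.norm_eq_abs] at h1
    have hv : ν + 1 ≠ 0 := by linarith
    have : -(1 / (ν + 1)) + 4 * ∑ x ∈ t R, ((x : ℝ) ^ 2)⁻¹ =
        4 * (∑ x ∈ t R, ((x : ℝ) ^ 2)⁻¹ - 1 / (4 * (ν + 1))) := by
      field_simp; ring
    rw [this, abs_mul, abs_of_pos (by norm_num : (0:ℝ) < 4)] at h1
    have := abs_nonneg (∑ x ∈ t R, ((x : ℝ) ^ 2)⁻¹ - 1 / (4 * (ν + 1)))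
    linarith
  refine hasSum_of_isLUB_of_nonneg _ (fun x => by positivity) ⟨?_, ?_⟩
  · rintro _ ⟨s, rfl⟩
    refine le_of_forall_pos_le_add fun ε hε => ?_
    obtain ⟨R₀, h⟩ := hcore ε hε
    set R := max R₀ (∑ x ∈ s, ‖φ x‖)
    have h1 := (abs_le.mp (h R (le_max_left _ _))).2
    have hsub : s ⊆ t R := by
      intro x hx
      simp only [ht, Finset.mem_preimage, Set.Finite.mem_toFinset]
      refine ⟨hzero x, le_trans ?_ (le_max_right _ _)⟩
      exact Finset.single_le_sum (f := fun x => ‖φ x‖) (fun _ _ => norm_nonneg _) hx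
    have h2 : ∑ x ∈ s, ((x : ℝ) ^ 2)⁻¹ ≤ ∑ x ∈ t R, ((x : ℝ) ^ 2)⁻¹ :=
      Finset.sum_le_sum_of_subset_of_nonneg hsub (fun x _ _ => by positivity)
    simp only
    linarith
  · intro b hb
    refine le_of_forall_pos_le_add fun ε hε => ?_
    obtain ⟨R₀, h⟩ := hcore ε hε
    have h1 := (abs_le.mp (h R₀ le_rfl)).1
    have h2 := hb ⟨t R₀, rfl⟩
    simp only at h2
    linarith

end Aux

/-- For every real `ν > -1`, the first Rayleigh sum is `σ_1(ν) = 1/(4(ν+1))`. -/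
theorem rayleigh_one (ν : ℝ) (hν : -1 < ν) : rayleigh 1 ν = 1 / (4 * (ν + 1)) := by
  rw [rayleigh]
  simpa using (rb_main hν).tsum_eq
end

section
/- Let ν ≥ 0 and let s be the smallest positive zero of φ_ν′ (which exists). Then s < x² for every x ∈ Z_ν, and the series Σ_{k=1}^∞ s^k σ_k(ν) converges with Σ_{k=1}^∞ s^k σ_k(ν) = 1, provided ν is sufficiently large. -/
/-- The normalised Bessel function
`φ_ν(z) = z Σ_{m=0}^∞ ((-1)^m Γ(ν+1)/(4^m m! Γ(ν+m+1))) z^m`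
(equal to `2^ν Γ(ν+1) z^{1-ν/2} J_ν(√z)` for `z > 0`). -/
noncomputable def phi (ν : ℝ) (z : ℝ) : ℝ :=
  z * ∑' m : ℕ, ((-1 : ℝ) ^ m * Real.Gamma (ν + 1) /
    (4 ^ m * m.factorial * Real.Gamma (ν + m + 1))) * z ^ m

open Finset Filter Topology

noncomputable def lagP (a : ℝ) (m : ℕ) : ℝ := ∏ i ∈ range m, (a + 1 + i)

noncomputable def lag (n : ℕ) (a x : ℝ) : ℝ :=
  ∑ m ∈ range (n + 1), ((-1 : ℝ) ^ m * n.choose m / lagP a m) * x ^ m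

lemma lagP_pos {a : ℝ} (ha : 0 ≤ a) (m : ℕ) : 0 < lagP a m :=
  prod_pos fun i _ => by positivity

lemma lagP_succ (a : ℝ) (m : ℕ) : lagP a (m + 1) = lagP a m * (a + 1 + m) := by
  simp [lagP, prod_range_succ]

lemma lagP_succ' (a : ℝ) (m : ℕ) : lagP a (m + 1) = (a + 1) * lagP (a + 1) m := by
  unfold lagP
  rw [prod_range_succ', mul_comm]
  simp only [Nat.cast_zero, add_zero]
  congr 1
  apply prod_congr rfl
  intro i _
  push_cast
  ring

lemma lagP_ge_factorial {a : ℝ} (ha : 0 ≤ a) (m : ℕ) : (m.factorial : ℝ) ≤ lagP a m := by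
  induction m with
  | zero => simp [lagP]
  | succ m ih =>
    rw [lagP_succ, Nat.factorial_succ]
    push_cast
    rw [mul_comm]
    apply mul_le_mul ih (by linarith) (by positivity) (lagP_pos ha m).le

lemma lag_zero_arg (n : ℕ) (a : ℝ) : lag n a 0 = 1 := by
  unfold lag
  rw [sum_range_succ']
  simp [lagP]

lemma lag_hasDerivAt (n : ℕ) {a : ℝ} (ha : 0 ≤ a) (x : ℝ) :
    HasDerivAt (lag (n + 1) a) (-((n + 1) / (a + 1)) * lag n (a + 1) x) x := by
  have h : HasDerivAt (lag (n + 1) a) (∑ m ∈ range (n + 1 + 1),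
      ((-1 : ℝ) ^ m * (n + 1).choose m / lagP a m) * (m * x ^ (m - 1))) x := by
    unfold lag
    apply HasDerivAt.fun_sum
    intro m _
    exact (hasDerivAt_pow m x).const_mul _
  convert h using 1
  rw [sum_range_succ', lag, mul_sum]
  simp only [Nat.cast_zero, zero_mul, mul_zero, add_zero]
  apply sum_congr rfl
  intro m _
  rw [lagP_succ']
  have h1 : ((n + 1).choose (m + 1) : ℝ) * ((m : ℝ) + 1) = (n + 1) * n.choose m := by
    have := Nat.add_one_mul_choose_eq n m
    exact_mod_cast this.symm
  have := (lagP_pos (by linarith : (0:ℝ) ≤ a + 1) m).ne'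
  have h2 : a + 1 ≠ 0 := by positivity
  field_simp
  push_cast
  rw [pow_succ]
  linear_combination (-1 : ℝ) ^ m * x ^ m * h1

lemma lag_rodrigues (n : ℕ) {a : ℝ} (ha : 0 ≤ a) (x : ℝ) : ∃ D, HasDerivAt (lag n (a + 1)) D x ∧
    (a + 1) * lag n (a + 1) x + x * D - x * lag n (a + 1) x = (a + 1) * lag (n + 1) a x := by
  refine ⟨∑ m ∈ range (n + 1),
      ((-1 : ℝ) ^ m * n.choose m / lagP (a + 1) m) * (m * x ^ (m - 1)), ?_, ?_⟩
  · unfold lag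
    apply HasDerivAt.fun_sum
    intro m _
    exact (hasDerivAt_pow m x).const_mul _
  · have e1 : (a + 1) * lag n (a + 1) x + x * ∑ m ∈ range (n + 1),
        ((-1 : ℝ) ^ m * n.choose m / lagP (a + 1) m) * (m * x ^ (m - 1)) =
        ∑ m ∈ range (n + 2), ((-1 : ℝ) ^ m * n.choose m / lagP (a + 1) m) * (a + 1 + m) * x ^ m := by
      rw [sum_range_succ _ (n + 1), lag, mul_sum, mul_sum, ← sum_add_distrib]
      simp only [Nat.choose_succ_self, Nat.cast_zero, mul_zero, zero_div, zero_mul, add_zero]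
      apply sum_congr rfl
      intro m _
      rcases m with _ | m
      · simp [mul_comm]
      · simp only [Nat.add_sub_cancel]
        ring
    rw [e1, lag, lag, sum_range_succ', sum_range_succ' _ (n + 1), mul_sum, mul_add (a + 1), mul_sum,
      add_sub_right_comm, ← sum_sub_distrib]
    congr 1
    · apply sum_congr rfl
      intro m _
      have hp := (lagP_pos (by linarith : (0:ℝ) ≤ a + 1) m).ne'
      have h2 : a + 1 ≠ 0 := by positivity
      have h3 : a + 1 + 1 + (m : ℝ) ≠ 0 := by positivity
      rw [lagP_succ' a m, lagP_succ (a + 1) m, Nat.choose_succ_succ]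
      push_cast
      field_simp
      ring
    · simp [lagP]

noncomputable def rodG (n : ℕ) (a x : ℝ) : ℝ := x ^ (a + 1) * Real.exp (-x) * lag n (a + 1) x

lemma rodG_hasDerivAt (n : ℕ) {a : ℝ} (ha : 0 ≤ a) {x : ℝ} (hx : 0 < x) :
    HasDerivAt (rodG n a) (x ^ a * Real.exp (-x) * ((a + 1) * lag (n + 1) a x)) x := by
  obtain ⟨D, hD, hE⟩ := lag_rodrigues n ha x
  have h1 := Real.hasDerivAt_rpow_const (x := x) (p := a + 1) (Or.inl hx.ne')
  have h2 : HasDerivAt (fun y : ℝ => Real.exp (-y)) (Real.exp (-x) * -1) x :=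
    (hasDerivAt_neg x).exp
  have h3 := (h1.mul h2).mul hD
  refine HasDerivAt.congr_deriv h3 ?_
  rw [← hE]
  have : x ^ (a + 1) = x ^ a * x := Real.rpow_add_one hx.ne' a
  simp only [Pi.mul_apply, add_sub_cancel_right]
  rw [this]
  ring

lemma lag_continuous (n : ℕ) (a : ℝ) : Continuous (lag n a) := by
  unfold lag; fun_prop

lemma rodG_continuous (n : ℕ) {a : ℝ} (ha : 0 ≤ a) : Continuous (rodG n a) := by
  unfold rodG
  have := lag_continuous n (a + 1)
  have h2 : Continuous (fun x : ℝ => x ^ (a + 1)) := Real.continuous_rpow_const (by linarith)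
  fun_prop

lemma rodG_tendsto (n : ℕ) (a : ℝ) : Tendsto (rodG n a) atTop (𝓝 0) := by
  have : ∀ᶠ x in atTop, (∑ m ∈ range (n + 1), ((-1 : ℝ) ^ m * n.choose m / lagP (a + 1) m) *
      (x ^ (a + 1 + m) * Real.exp (-x))) = rodG n a x := by
    filter_upwards [eventually_gt_atTop 0] with x hx
    unfold rodG lag
    rw [mul_sum]
    apply sum_congr rfl
    intro m _
    rw [Real.rpow_add hx, Real.rpow_natCast]
    ring
  refine Tendsto.congr' this ?_
  rw [show (0 : ℝ) = ∑ m ∈ range (n + 1), ((-1 : ℝ) ^ m * n.choose m / lagP (a + 1) m) * 0 by simp]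
  apply tendsto_finsetSum
  intro m _
  apply Tendsto.const_mul
  simpa using tendsto_rpow_mul_exp_neg_mul_atTop_nhds_zero (a + 1 + m) 1 one_pos

/-- Rolle on a half line. -/
lemma rolle_infty {g g' : ℝ → ℝ} {b : ℝ} (hc : Continuous g) (hb : g b = 0)
    (ht : Tendsto g atTop (𝓝 0)) (hd : ∀ x > b, HasDerivAt g (g' x) x) :
    ∃ x > b, g' x = 0 := by
  by_cases h0 : ∃ c > b, g c = 0
  · obtain ⟨c, hc1, hc2⟩ := h0
    obtain ⟨x, hx, hx'⟩ := exists_hasDerivAt_eq_zero hc1 hc.continuousOn (by rw [hb, hc2])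
      (fun x hx => hd x hx.1)
    exact ⟨x, hx.1, hx'⟩
  · push Not at h0
    set c := b + 1
    have hcb : b < c := by simp [c]
    have hc0 : 0 < |g c| := abs_pos.2 (h0 c hcb)
    have := (ht.abs).eventually_lt_const (u := |g c|) (by rw [abs_zero]; exact hc0)
    obtain ⟨d, hd1, hd2⟩ := (this.and (eventually_gt_atTop c)).exists
    obtain ⟨e, he, he2⟩ : ∃ e ∈ Set.Ioo b c, |g e| = |g d| := by
      have := intermediate_value_Ioo hcb.le (hc.abs).continuousOn
      apply this
      refine ⟨?_, hd1⟩
      simpa [hb] using h0 d (by linarith)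
    rcases abs_eq_abs.1 he2 with h | h
    · obtain ⟨x, hx, hx'⟩ := exists_hasDerivAt_eq_zero (he.2.trans hd2) hc.continuousOn h
        (fun x hx => hd x (he.1.trans hx.1))
      exact ⟨x, he.1.trans hx.1, hx'⟩
    · exfalso
      have hz : (0:ℝ) ∈ Set.uIcc (g e) (g d) := by
        rw [h, Set.mem_uIcc]
        rcases le_total 0 (g d) with h | h
        · left; constructor <;> linarith
        · right; constructor <;> linarith
      obtain ⟨y, hy, hy0⟩ := intermediate_value_uIcc (a := e) (b := d) hc.continuousOn hz
      rw [Set.uIcc_of_le (he.2.trans hd2).le] at hy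
      exact h0 y (lt_of_lt_of_le he.1 hy.1) hy0

lemma lag_roots (n : ℕ) : ∀ a : ℝ, 0 ≤ a → ∃ b : ℕ → ℝ, (∀ i < n, 0 < b i ∧ lag n a (b i) = 0) ∧
    ∀ i j, i < j → j < n → b i < b j := by
  induction n with
  | zero => intro a _; exact ⟨fun _ => 0, by simp, by simp⟩
  | succ n ih =>
    intro a ha
    obtain ⟨b, hb1, hb2⟩ := ih (a + 1) (by linarith)
    let c : ℕ → ℝ := fun i => Nat.casesOn i 0 b
    have c0 : c 0 = 0 := rfl
    have cs : ∀ i, c (i + 1) = b i := fun i => rfl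
    have hg : ∀ i ≤ n, rodG n a (c i) = 0 := by
      intro i hi
      rcases i with _ | i
      · rw [c0, rodG, Real.zero_rpow (by linarith)]; simp
      · rw [cs, rodG, (hb1 i (by omega)).2, mul_zero]
    have hc0 : ∀ i ≤ n, 0 ≤ c i := by
      intro i hi
      rcases i with _ | i
      · exact le_rfl
      · exact (hb1 i (by omega)).1.le
    have hcm : ∀ i < n, c i < c (i + 1) := by
      intro i hi
      rcases i with _ | i
      · exact (hb1 0 hi).1
      · exact hb2 i (i + 1) (by omega) (by omega)
    have key : ∀ x > 0, x ^ a * Real.exp (-x) * ((a + 1) * lag (n + 1) a x) = 0 →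
        lag (n + 1) a x = 0 := by
      intro x hx h
      have h1 : x ^ a ≠ 0 := (Real.rpow_pos_of_pos hx a).ne'
      have h2 : Real.exp (-x) ≠ 0 := (Real.exp_pos _).ne'
      have h3 : a + 1 ≠ 0 := by positivity
      simpa [h1, h2, h3] using h
    have hex : ∀ i, ∃ x, (i ≤ n → c i < x ∧ lag (n + 1) a x = 0) ∧ (i < n → x < c (i + 1)) := by
      intro i
      rcases lt_trichotomy i n with hi | hi | hi
      · obtain ⟨x, hx, hx'⟩ := exists_hasDerivAt_eq_zero (hcm i hi)
          (rodG_continuous n ha).continuousOn (by rw [hg i hi.le, hg (i + 1) hi])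
          (fun x hx => rodG_hasDerivAt n ha ((hc0 i hi.le).trans_lt hx.1))
        exact ⟨x, fun _ => ⟨hx.1, key x ((hc0 i hi.le).trans_lt hx.1) hx'⟩, fun _ => hx.2⟩
      · obtain ⟨x, hx, hx'⟩ := rolle_infty (rodG_continuous n ha) (hg i hi.le)
          (rodG_tendsto n a) (fun x hx => rodG_hasDerivAt n ha ((hc0 i hi.le).trans_lt hx))
        exact ⟨x, fun _ => ⟨hx, key x ((hc0 i hi.le).trans_lt hx) hx'⟩, fun h => by omega⟩
      · exact ⟨0, by omega, by omega⟩
    choose r hr1 hr2 using hex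
    refine ⟨r, fun i hi => ⟨(hc0 i (by omega)).trans_lt (hr1 i (by omega)).1,
      (hr1 i (by omega)).2⟩, ?_⟩
    intro i j hij
    induction j, hij using Nat.le_induction with
    | base =>
      intro h
      exact (hr2 i (by omega)).trans (hr1 (i + 1) (by omega)).1
    | succ j hj ihj =>
      intro h
      exact (ihj (by omega)).trans ((hr2 j (by omega)).trans (hr1 (j + 1) (by omega)).1)

lemma lag_prod (n : ℕ) (a : ℝ) (b : ℕ → ℝ) (hb : ∀ i < n, 0 < b i ∧ lag n a (b i) = 0)
    (hb2 : ∀ i j, i < j → j < n → b i < b j) (x : ℝ) :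
    lag n a x = ∏ i ∈ range n, (1 - x / b i) := by
  let p : Polynomial ℝ := ∑ m ∈ range (n + 1),
    Polynomial.C ((-1 : ℝ) ^ m * n.choose m / lagP a m) * Polynomial.X ^ m
  let q : Polynomial ℝ := ∏ i ∈ range n, (Polynomial.C (-(b i)⁻¹) * Polynomial.X + Polynomial.C 1)
  have hp : ∀ x, p.eval x = lag n a x := by
    intro x; simp [p, lag, Polynomial.eval_finsetSum]
  have hq : ∀ x, q.eval x = ∏ i ∈ range n, (1 - x / b i) := by
    intro x
    simp only [q, Polynomial.eval_prod]
    apply prod_congr rfl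
    intro i _
    simp
    ring
  have hinj : Set.InjOn b (range n) := by
    intro i hi j hj h
    simp only [coe_range, Set.mem_Iio] at hi hj
    rcases lt_trichotomy i j with h1 | h1 | h1
    · exact absurd h (hb2 i j h1 hj).ne
    · exact h1
    · exact absurd h (hb2 j i h1 hi).ne'
  let s : Finset ℝ := insert 0 ((range n).image b)
  have hs : #s = n + 1 := by
    rw [card_insert_of_notMem, card_image_of_injOn hinj, card_range]
    intro h
    obtain ⟨i, hi, h⟩ := mem_image.1 h
    exact (hb i (by simpa using hi)).1.ne' h
  have hpq : p = q := by
    apply Polynomial.eq_of_degrees_lt_of_eval_finset_eq s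
    · rw [hs]
      refine (Polynomial.degree_sum_le _ _).trans_lt ?_
      rw [Finset.sup_lt_iff (WithBot.bot_lt_coe _)]
      intro m hm
      refine (Polynomial.degree_C_mul_X_pow_le _ _).trans_lt ?_
      exact_mod_cast mem_range.1 hm
    · rw [hs]
      refine (Polynomial.degree_prod_le _ _).trans_lt ?_
      refine (sum_le_sum (g := fun _ => (1 : WithBot ℕ)) fun i _ => Polynomial.degree_linear_le).trans_lt ?_
      simp only [sum_const, card_range, nsmul_one]
      exact_mod_cast Nat.lt_succ_self n
    · intro y hy
      rw [hp, hq]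
      rcases mem_insert.1 hy with h | h
      · simp [h, lag_zero_arg]
      · obtain ⟨i, hi, h⟩ := mem_image.1 h
        rw [← h, (hb i (by simpa using hi)).2, eq_comm, prod_eq_zero_iff]
        refine ⟨i, hi, ?_⟩
        rw [div_self (hb i (by simpa using hi)).1.ne', sub_self]
  rw [← hp, hpq, hq]

noncomputable def besF (a z : ℝ) : ℝ :=
  ∑' m : ℕ, ((-1 : ℝ) ^ m / (4 ^ m * m.factorial * lagP a m)) * z ^ m

lemma lagP_ge_one {a : ℝ} (ha : 0 ≤ a) (m : ℕ) : 1 ≤ lagP a m :=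
  le_trans (by exact_mod_cast Nat.one_le_iff_ne_zero.2 (Nat.factorial_ne_zero m))
    (lagP_ge_factorial ha m)

lemma besF_term_bound {a : ℝ} (ha : 0 ≤ a) (z : ℝ) (m : ℕ) :
    ‖((-1 : ℝ) ^ m / (4 ^ m * m.factorial * lagP a m)) * z ^ m‖ ≤ |z| ^ m / m.factorial := by
  have h1 := lagP_ge_one ha m
  have h4 : (1:ℝ) ≤ 4 ^ m := one_le_pow₀ (by norm_num)
  have hf : (0:ℝ) < m.factorial := by positivity
  rw [norm_mul, norm_div, norm_pow, norm_pow, Real.norm_eq_abs, Real.norm_eq_abs, Real.norm_eq_abs,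
    abs_neg, abs_one, one_pow, abs_of_pos (by positivity), one_div_mul_eq_div]
  apply div_le_div_of_nonneg_left (by positivity) hf
  calc (m.factorial : ℝ) = 1 * m.factorial * 1 := by ring
    _ ≤ _ := by gcongr

lemma besF_summable {a : ℝ} (ha : 0 ≤ a) (z : ℝ) :
    Summable fun m : ℕ => ((-1 : ℝ) ^ m / (4 ^ m * m.factorial * lagP a m)) * z ^ m :=
  Summable.of_norm_bounded (Real.summable_pow_div_factorial |z|) (besF_term_bound ha z)

lemma lag_eq_tsum (n : ℕ) (a x : ℝ) :
    lag n a x = ∑' m : ℕ, ((-1 : ℝ) ^ m * n.choose m / lagP a m) * x ^ m := by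
  rw [tsum_eq_sum (s := range (n + 1))]
  · rfl
  · intro m hm
    rw [Nat.choose_eq_zero_of_lt (by simpa using hm)]
    simp

lemma choose_tendsto (m : ℕ) :
    Tendsto (fun n : ℕ => (n.choose m : ℝ) / n ^ m) atTop (𝓝 (1 / m.factorial)) := by
  have h := ProbabilityTheory.tendsto_choose_mul_pow_atTop (p := fun n : ℕ => 1 / (n:ℝ)) (r := 1) m
    (by
      refine tendsto_const_nhds.congr' ?_
      filter_upwards [eventually_gt_atTop 0] with n hn
      field_simp)
  simpa [div_eq_mul_inv] using h

lemma lag_tendsto {a : ℝ} (ha : 0 ≤ a) {k : ℕ → ℕ} (hk : Tendsto k atTop atTop) {y : ℕ → ℝ} {z : ℝ}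
    (hy : Tendsto (fun i => (k i : ℝ) * y i) atTop (𝓝 (z / 4))) :
    Tendsto (fun i => lag (k i) a (y i)) atTop (𝓝 (besF a z)) := by
  simp_rw [lag_eq_tsum, besF]
  refine tendsto_tsum_of_dominated_convergence
    (bound := fun m : ℕ => (|z / 4| + 1) ^ m / m.factorial) (Real.summable_pow_div_factorial _) ?_ ?_
  · intro m
    have h1 := ((choose_tendsto m).comp hk).mul (hy.pow m)
    have h2 := h1.const_mul ((-1 : ℝ) ^ m / lagP a m)
    have e : (-1 : ℝ) ^ m / lagP a m * (1 / m.factorial * (z / 4) ^ m) =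
        ((-1 : ℝ) ^ m / (4 ^ m * m.factorial * lagP a m)) * z ^ m := by
      rw [div_pow]; field_simp
    rw [e] at h2
    refine h2.congr' ?_
    filter_upwards [hk.eventually_gt_atTop 0] with i hi
    have : (k i : ℝ) ≠ 0 := by positivity
    simp only [Function.comp]
    rw [mul_pow]
    field_simp
  · have := hy.abs.eventually_lt_const (u := |z / 4| + 1) (by linarith)
    filter_upwards [this] with i hi m
    have h1 := lagP_ge_one ha m
    have hc : ((k i).choose m : ℝ) ≤ (k i : ℝ) ^ m / m.factorial := Nat.choose_le_pow_div m (k i)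
    rw [norm_mul, norm_div, norm_mul, norm_pow, norm_pow, Real.norm_eq_abs, Real.norm_eq_abs,
      Real.norm_eq_abs, Real.norm_eq_abs, abs_neg, abs_one, one_pow, one_mul,
      abs_of_pos (lagP_pos ha m), abs_of_nonneg (by positivity : (0:ℝ) ≤ (k i).choose m)]
    calc ((k i).choose m : ℝ) / lagP a m * |y i| ^ m
        ≤ ((k i).choose m : ℝ) * |y i| ^ m := by
          gcongr
          exact div_le_self (by positivity) h1
      _ ≤ (k i : ℝ) ^ m / m.factorial * |y i| ^ m := by gcongr
      _ = |k i * y i| ^ m / m.factorial := by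
          rw [abs_mul, mul_pow, Nat.abs_cast]; ring
      _ ≤ _ := by gcongr

lemma lag_neg_le (n : ℕ) {a : ℝ} (ha : 0 ≤ a) {y : ℝ} (hy : 0 ≤ y) :
    lag n a (-y) ≤ Real.exp (2 * √(n * y)) := by
  have h1 : lag n a (-y) ≤ ∑ m ∈ range (n + 1), (√(n * y) ^ m / m.factorial) ^ 2 := by
    apply sum_le_sum
    intro m _
    have hP := lagP_ge_factorial ha m
    have hc : (n.choose m : ℝ) ≤ (n : ℝ) ^ m / m.factorial := Nat.choose_le_pow_div m n
    have hf : (0:ℝ) < m.factorial := by positivity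
    calc (-1 : ℝ) ^ m * n.choose m / lagP a m * (-y) ^ m
        = n.choose m / lagP a m * y ^ m := by
          rw [neg_pow y]
          have : ((-1:ℝ) ^ m) * (-1) ^ m = 1 := by rw [← mul_pow]; simp
          linear_combination (n.choose m / lagP a m * y ^ m) * this
      _ ≤ ((n : ℝ) ^ m / m.factorial) / m.factorial * y ^ m := by gcongr
      _ = (√(n * y) ^ m / m.factorial) ^ 2 := by
          rw [div_pow, ← pow_mul, mul_comm m 2, pow_mul, Real.sq_sqrt (by positivity), mul_pow]
          field_simp
  refine h1.trans ((sum_sq_le_sq_sum_of_nonneg (fun i _ => by positivity)).trans ?_)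
  rw [two_mul, Real.exp_add, ← sq]
  gcongr
  exact Real.sum_le_exp_of_nonneg (Real.sqrt_nonneg _) _

lemma root_bound (n : ℕ) {a : ℝ} (ha : 0 ≤ a) (b : ℕ → ℝ) (hb : ∀ i < n, 0 < b i ∧ lag n a (b i) = 0)
    (hb2 : ∀ i j, i < j → j < n → b i < b j) {j : ℕ} (hj : j < n) :
    1 / (4 * n * b j) ≤ 4 / ((j : ℝ) + 1) ^ 2 := by
  have hbj := (hb j hj).1
  have hn : (0:ℝ) < n := by exact_mod_cast (by omega : 0 < n)
  have h1 : (2:ℝ) ^ (j + 1) ≤ lag n a (-(b j)) := by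
    rw [lag_prod n a b hb hb2]
    calc (2:ℝ) ^ (j + 1) = ∏ i ∈ range (j + 1), (2:ℝ) := by simp
      _ ≤ ∏ i ∈ range (j + 1), (1 - -(b j) / b i) := by
          apply prod_le_prod (fun _ _ => by norm_num)
          intro i hi
          have hi' : i < j + 1 := by simpa using hi
          have hbi := (hb i (by omega)).1
          have : b i ≤ b j := by
            rcases Nat.lt_succ_iff_lt_or_eq.1 hi' with h | h
            · exact (hb2 i j h hj).le
            · rw [h]
          rw [neg_div, sub_neg_eq_add]
          have := (one_le_div hbi).2 this
          linarith
      _ ≤ ∏ i ∈ range n, (1 - -(b j) / b i) := by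
          apply prod_le_prod_of_subset_of_one_le
          · intro i hi
            simp only [mem_range] at hi ⊢
            omega
          · intro i hi
            have hi' : i < j + 1 := by simpa using hi
            have hbi := (hb i (by omega)).1
            rw [neg_div, sub_neg_eq_add]
            positivity
          · intro i hi _
            have hbi := (hb i (by simpa using hi)).1
            rw [neg_div, sub_neg_eq_add]
            have : 0 ≤ b j / b i := by positivity
            linarith
  have h2 := h1.trans (lag_neg_le n ha hbj.le)
  have h3 := Real.log_le_log (by positivity) h2
  rw [Real.log_exp, Real.log_pow] at h3
  have h4 : ((j:ℝ) + 1) / 2 ≤ 2 * √(n * b j) := by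
    have := Real.log_two_gt_d9
    push_cast at h3
    nlinarith [(by positivity : (0:ℝ) < (j:ℝ) + 1)]
  have h5 := pow_le_pow_left₀ (by positivity) h4 2
  rw [mul_pow, Real.sq_sqrt (by positivity)] at h5
  rw [div_le_div_iff₀ (by positivity) (by positivity)]
  nlinarith

lemma approx {a : ℝ} (ha : 0 ≤ a) : ∃ U : ℕ → ℕ → ℝ, ∀ n, 
    (∀ j, 0 ≤ U n j) ∧ (∀ j, U n j ≤ 4 / ((j : ℝ) + 1) ^ 2) ∧ Antitone (U n) ∧
    (∀ j, n ≤ j → U n j = 0) ∧ (∀ i j, i < j → j < n → U n j < U n i) ∧ (∀ j < n, 0 < U n j) ∧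
    ∀ z, lag n a (z / (4 * n)) = ∏ j ∈ range n, (1 - z * U n j) := by
  choose b hb1 hb2 using fun n => lag_roots n a ha
  refine ⟨fun n j => if j < n then 1 / (4 * n * b n j) else 0, fun n => ?_⟩
  have hn : ∀ j, j < n → (0:ℝ) < n := fun j hj => by exact_mod_cast (by omega : 0 < n)
  have hpos : ∀ j < n, 0 < 1 / (4 * n * b n j) := by
    intro j hj
    have := (hb1 n j hj).1
    have := hn j hj
    positivity
  have hlt : ∀ i j, i < j → j < n → 1 / (4 * n * b n j) < 1 / (4 * n * b n i) := by
    intro i j hij hj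
    have := (hb1 n i (by omega)).1
    have := hb2 n i j hij hj
    have := hn j hj
    apply one_div_lt_one_div_of_lt (by positivity)
    gcongr
  refine ⟨?_, ?_, ?_, ?_, ?_, ?_, ?_⟩
  · intro j
    dsimp only
    split_ifs with h
    · exact (hpos j h).le
    · exact le_rfl
  · intro j
    dsimp only
    split_ifs with h
    · exact root_bound n ha (b n) (hb1 n) (hb2 n) h
    · positivity
  · intro i j hij
    dsimp only
    split_ifs with h1 h2 h2
    · rcases hij.eq_or_lt with h | h
      · rw [h]
      · exact (hlt i j h h1).le
    · omega
    · exact (hpos i h2).le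
    · exact le_rfl
  · intro j hj
    simp [not_lt.2 hj]
  · intro i j hij hj
    simp only [hj, hij.trans hj, if_true]
    exact hlt i j hij hj
  · intro j hj
    simp only [hj, if_true]
    exact hpos j hj
  · intro z
    rw [lag_prod n a (b n) (hb1 n) (hb2 n)]
    apply prod_congr rfl
    intro j hj
    dsimp only
    rw [if_pos (mem_range.1 hj)]
    ring

lemma approx_subseq {a : ℝ} (ha : 0 ≤ a) : ∃ (U : ℕ → ℕ → ℝ) (k : ℕ → ℕ) (u : ℕ → ℝ),
    Tendsto k atTop atTop ∧ (∀ j, Tendsto (fun i => U i j) atTop (𝓝 (u j))) ∧ ∀ n, 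
    (∀ j, 0 ≤ U n j) ∧ (∀ j, U n j ≤ 4 / ((j : ℝ) + 1) ^ 2) ∧ Antitone (U n) ∧
    (∀ j, k n ≤ j → U n j = 0) ∧ (∀ i j, i < j → j < k n → U n j < U n i) ∧
    (∀ j < k n, 0 < U n j) ∧
    ∀ z, lag (k n) a (z / (4 * k n)) = ∏ j ∈ range (k n), (1 - z * U n j) := by
  obtain ⟨U, hU⟩ := approx ha
  have hK : IsCompact (Set.univ.pi fun j : ℕ => Set.Icc (0:ℝ) (4 / ((j : ℝ) + 1) ^ 2)) :=
    isCompact_univ_pi fun j => isCompact_Icc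
  obtain ⟨u, _, k, hk, hu⟩ := hK.tendsto_subseq (x := U)
    (fun n j _ => ⟨(hU n).1 j, (hU n).2.1 j⟩)
  refine ⟨fun n => U (k n), k, u, hk.tendsto_atTop, ?_, fun n => hU (k n)⟩
  intro j
  exact (tendsto_pi_nhds.1 hu j)

lemma besF_coef_succ {a : ℝ} (ha : 0 ≤ a) (m : ℕ) :
    ((-1 : ℝ) ^ (m + 1) / (4 ^ (m + 1) * (m + 1).factorial * lagP a (m + 1))) * (m + 1) =
    -(1 / (4 * (a + 1))) * ((-1 : ℝ) ^ m / (4 ^ m * m.factorial * lagP (a + 1) m)) := by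
  rw [lagP_succ', Nat.factorial_succ]
  have := (lagP_pos (by linarith : (0:ℝ) ≤ a + 1) m).ne'
  have h2 : a + 1 ≠ 0 := by positivity
  push_cast
  field_simp
  ring

lemma besF_split {a : ℝ} (ha : 0 ≤ a) (z : ℝ) : besF a z = 1 + ∑' m : ℕ,
    ((-1 : ℝ) ^ (m + 1) / (4 ^ (m + 1) * (m + 1).factorial * lagP a (m + 1))) * z ^ (m + 1) := by
  rw [besF, (besF_summable ha z).tsum_eq_zero_add]
  simp [lagP]

lemma besF_hasDerivAt {a : ℝ} (ha : 0 ≤ a) (z : ℝ) :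
    HasDerivAt (besF a) (-(1 / (4 * (a + 1))) * besF (a + 1) z) z := by
  have ha1 : 0 ≤ a + 1 := by linarith
  have h0 : (besF a) = fun z => 1 + ∑' m : ℕ,
    ((-1 : ℝ) ^ (m + 1) / (4 ^ (m + 1) * (m + 1).factorial * lagP a (m + 1))) * z ^ (m + 1) :=
    funext fun z => besF_split ha z
  rw [h0]
  apply HasDerivAt.const_add
  rw [besF, ← tsum_mul_left]
  refine hasDerivAt_tsum_of_isPreconnected (𝕜 := ℝ) (F := ℝ)
    (g := fun (m : ℕ) (z : ℝ) => ((-1 : ℝ) ^ (m + 1) /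
      (4 ^ (m + 1) * (m + 1).factorial * lagP a (m + 1))) * z ^ (m + 1))
    (g' := fun (m : ℕ) (z : ℝ) => -(1 / (4 * (a + 1))) *
      ((-1 : ℝ) ^ m / (4 ^ m * m.factorial * lagP (a + 1) m) * z ^ m)) (t := Metric.ball (0:ℝ) (|z| + 1)) (y₀ := 0)
    (u := fun m : ℕ => |-(1 / (4 * (a + 1)))| * ((|z| + 1) ^ m / m.factorial))
    ((Real.summable_pow_div_factorial _).mul_left _) Metric.isOpen_ball
    (convex_ball (0:ℝ) _).isPreconnected ?_ ?_ (Metric.mem_ball_self (by positivity)) ?_ ?_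
  · intro m y _
    have := (hasDerivAt_pow (m + 1) y).const_mul
      ((-1 : ℝ) ^ (m + 1) / (4 ^ (m + 1) * (m + 1).factorial * lagP a (m + 1)))
    refine this.congr_deriv ?_
    have e := besF_coef_succ ha m
    push_cast
    linear_combination (y ^ m) * e
  · intro m y hy
    rw [norm_mul, Real.norm_eq_abs (-_)]
    refine mul_le_mul_of_nonneg_left ((besF_term_bound ha1 y m).trans ?_) (abs_nonneg _)
    have : |y| ≤ |z| + 1 := by
      have := Metric.mem_ball.1 hy
      rw [Real.dist_eq, sub_zero] at this
      exact this.le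
    gcongr
  · exact (summable_nat_add_iff 1).2 (besF_summable ha 0)
  · rw [Metric.mem_ball, Real.dist_eq, sub_zero]; linarith

lemma besF_rec {a : ℝ} (ha : 0 ≤ a) (z : ℝ) :
    besF (a + 1) z - besF a z = z / (4 * (a + 1) * (a + 2)) * besF (a + 2) z := by
  have ha1 : 0 ≤ a + 1 := by linarith
  have ha2 : 0 ≤ a + 2 := by linarith
  rw [besF_split ha, besF_split ha1, add_sub_add_left_eq_sub, ← Summable.tsum_sub
    ((summable_nat_add_iff 1).2 (besF_summable ha1 z))
    ((summable_nat_add_iff 1).2 (besF_summable ha z)), besF, ← tsum_mul_left]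
  apply tsum_congr
  intro m
  have e2 : a + 1 + 1 = a + 2 := by ring
  have h1 := lagP_succ' a (m + 1)
  have h2 := lagP_succ' (a + 1) m
  have h3 := lagP_succ a (m + 1)
  rw [e2] at h2
  rw [h1, h2] at h3
  have hp := (lagP_pos ha2 m).ne'
  have hq := (lagP_pos ha (m + 1)).ne'
  have hm : a + 1 + ((m + 1 : ℕ) : ℝ) ≠ 0 := by positivity
  have h5 : a + 1 ≠ 0 := by positivity
  have h6 : a + 2 ≠ 0 := by positivity
  have h4 : lagP a (m + 1) = (a + 1) * ((a + 2) * lagP (a + 2) m) / (a + 1 + ((m + 1 : ℕ) : ℝ)) := by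
    rw [h3]; field_simp
  rw [h4, h2, Nat.factorial_succ]
  push_cast at hm ⊢
  field_simp
  ring

lemma besF_near_one {a : ℝ} (ha : 0 ≤ a) (z : ℝ) :
    |besF a z - 1| ≤ |z| / (a + 1) * Real.exp |z| := by
  have ha1 : 0 ≤ a + 1 := by linarith
  rw [besF_split ha, add_sub_cancel_left, ← Real.norm_eq_abs]
  refine tsum_of_norm_bounded (g := fun m : ℕ => |z| / (a + 1) * (|z| ^ m / m.factorial)) ?_ ?_
  · apply HasSum.mul_left
    rw [Real.exp_eq_exp_ℝ]
    exact NormedSpace.expSeries_div_hasSum_exp (𝔸 := ℝ) |z|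
  · intro m
    have e := besF_coef_succ ha m
    have e' : ((-1 : ℝ) ^ (m + 1) / (4 ^ (m + 1) * (m + 1).factorial * lagP a (m + 1))) * z ^ (m + 1)
        = (-(1 / (4 * (a + 1))) * z / (m + 1)) *
          (((-1 : ℝ) ^ m / (4 ^ m * m.factorial * lagP (a + 1) m)) * z ^ m) := by
      have : (m:ℝ) + 1 ≠ 0 := by positivity
      have e3 : (-(1 / (4 * (a + 1))) * z / (m + 1)) *
          (((-1 : ℝ) ^ m / (4 ^ m * m.factorial * lagP (a + 1) m)) * z ^ m) =
          (-(1 / (4 * (a + 1))) * ((-1 : ℝ) ^ m / (4 ^ m * m.factorial * lagP (a + 1) m))) *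
          z ^ (m + 1) / (m + 1) := by ring
      rw [e3, ← e, mul_right_comm _ ((m : ℝ) + 1), mul_div_cancel_right₀ _ this]
    rw [e', norm_mul]
    refine mul_le_mul ?_ (besF_term_bound ha1 z m) (norm_nonneg _) (by positivity)
    rw [norm_div, norm_mul, norm_neg, Real.norm_of_nonneg (by positivity : 0 ≤ 1 / (4 * (a + 1))),
      Real.norm_of_nonneg (by positivity : (0:ℝ) ≤ m + 1), Real.norm_eq_abs]
    refine (div_le_self (by positivity) (by linarith [(by positivity : (0:ℝ) ≤ m)])).trans ?_
    rw [one_div_mul_eq_div]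
    apply div_le_div_of_nonneg_left (by positivity) (by positivity)
    linarith

lemma besF_no_double {a : ℝ} (ha : 0 ≤ a) {z : ℝ} (hz : 0 < z) (h0 : besF a z = 0)
    (h1 : besF (a + 1) z = 0) : False := by
  have key : ∀ k : ℕ, besF (a + k) z = 0 ∧ besF (a + k + 1) z = 0 := by
    intro k
    induction k with
    | zero => simpa using ⟨h0, h1⟩
    | succ k ih =>
      have hk : 0 ≤ a + k := by positivity
      have hr := besF_rec hk z
      rw [ih.1, ih.2, sub_zero, eq_comm, mul_eq_zero] at hr
      have e1 : a + ((k + 1 : ℕ) : ℝ) = a + k + 1 := by push_cast; ring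
      have e2 : a + (k:ℝ) + 1 + 1 = a + k + 2 := by ring
      rw [e1, e2]
      refine ⟨ih.2, hr.resolve_left ?_⟩
      positivity
  obtain ⟨k, hk⟩ := exists_nat_gt (|z| * Real.exp |z|)
  have := besF_near_one (by positivity : 0 ≤ a + k) z
  rw [(key k).1, zero_sub, abs_neg, abs_one, div_mul_eq_mul_div, le_div_iff₀ (by positivity)] at this
  linarith

lemma weierstrass (s : Finset ℕ) (f : ℕ → ℝ) (h0 : ∀ i ∈ s, 0 ≤ f i) (h1 : ∀ i ∈ s, f i ≤ 1) :
    1 - ∑ i ∈ s, f i ≤ ∏ i ∈ s, (1 - f i) := by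
  induction s using Finset.cons_induction with
  | empty => simp
  | cons i s hi ih =>
    rw [sum_cons, prod_cons]
    have ih' := ih (fun j hj => h0 j (mem_cons_of_mem hj)) (fun j hj => h1 j (mem_cons_of_mem hj))
    have a0 := h0 i (mem_cons_self i s)
    have a1 := h1 i (mem_cons_self i s)
    have s0 : 0 ≤ ∑ j ∈ s, f j := sum_nonneg fun j hj => h0 j (mem_cons_of_mem hj)
    nlinarith [mul_le_mul_of_nonneg_left ih' (sub_nonneg.2 a1), mul_nonneg a0 s0]

lemma summable_bd : Summable fun j : ℕ => 4 / ((j : ℝ) + 1) ^ 2 := by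
  have h := (summable_nat_add_iff 1).2 (Real.summable_one_div_nat_pow.2 (by norm_num : 1 < 2))
  refine (h.mul_left 4).congr fun j => ?_
  push_cast
  ring

/-- The main structural fact. -/
lemma besF_zeros {a : ℝ} (ha : 0 ≤ a) : ∃ u : ℕ → ℝ, (∀ j, 0 ≤ u j) ∧ Summable u ∧ Antitone u ∧
    (∀ j, 0 < u j → besF a (1 / u j) = 0) ∧
    (∀ z, 0 < z → besF a z = 0 → ∃ j, z * u j = 1) ∧
    (∀ i j, i < j → 0 < u i → u i = u j → False) ∧
    (∀ z, 0 ≤ z → z * u 0 < 1 →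
      (∑' j, u j / (1 - z * u j)) * besF a z = 1 / (4 * (a + 1)) * besF (a + 1) z) := by
  obtain ⟨U, k, u, hk, hu, H⟩ := approx_subseq ha
  have ha1 : 0 ≤ a + 1 := by linarith
  have hkR : Tendsto (fun i => (k i : ℝ)) atTop atTop := tendsto_natCast_atTop_atTop.comp hk
  have hu0 : ∀ j, 0 ≤ u j := fun j => ge_of_tendsto' (hu j) fun n => (H n).1 j
  have hub : ∀ j, u j ≤ 4 / ((j : ℝ) + 1) ^ 2 := fun j => le_of_tendsto' (hu j) fun n => (H n).2.1 j
  have hus : Summable u := Summable.of_nonneg_of_le hu0 hub summable_bd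
  have hanti : Antitone u := fun i j hij =>
    le_of_tendsto_of_tendsto' (hu j) (hu i) fun n => (H n).2.2.1 hij
  -- continuous convergence
  have conv : ∀ (x : ℕ → ℝ) (z : ℝ), Tendsto x atTop (𝓝 z) →
      Tendsto (fun i => lag (k i) a (x i / (4 * k i))) atTop (𝓝 (besF a z)) := by
    intro x z hx
    apply lag_tendsto ha hk
    refine (hx.div_const 4).congr' ?_
    filter_upwards [hk.eventually_gt_atTop 0] with i hi
    have : (k i : ℝ) ≠ 0 := by positivity
    field_simp
  have conv' : ∀ (x : ℕ → ℝ) (z : ℝ), Tendsto x atTop (𝓝 z) →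
      Tendsto (fun i => lag (k i - 1) (a + 1) (x i / (4 * k i))) atTop (𝓝 (besF (a + 1) z)) := by
    intro x z hx
    apply lag_tendsto ha1 (tendsto_sub_atTop_nat 1 |>.comp hk)
    have h1 : Tendsto (fun i => 1 - 1 / (k i : ℝ)) atTop (𝓝 1) := by
      have := (tendsto_const_nhds (x := (1:ℝ))).sub (hkR.const_div_atTop 1)
      simpa using this
    have := h1.mul (hx.div_const 4)
    rw [one_mul] at this
    refine this.congr' ?_
    filter_upwards [hk.eventually_gt_atTop 0] with i hi
    have h : (k i : ℝ) ≠ 0 := by positivity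
    simp only [Function.comp]
    rw [Nat.cast_sub (by omega)]
    field_simp
    push_cast
    ring
  -- derivative of the approximants
  have hder : ∀ i, 0 < k i → ∀ z, HasDerivAt (fun z => lag (k i) a (z / (4 * k i)))
      (-(1 / (4 * (a + 1))) * lag (k i - 1) (a + 1) (z / (4 * k i))) z := by
    intro i hi z
    obtain ⟨n, hn⟩ : ∃ n, k i = n + 1 := ⟨k i - 1, by omega⟩
    have h1 := lag_hasDerivAt n ha (z / (4 * k i))
    have h2 : HasDerivAt (fun z : ℝ => z / (4 * k i)) (1 / (4 * k i)) z :=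
      (hasDerivAt_id z).div_const _
    have h3 := h1.comp z h2
    rw [hn] at h3 ⊢
    refine h3.congr_deriv ?_
    have : (n:ℝ) + 1 ≠ 0 := by positivity
    have : a + 1 ≠ 0 := by positivity
    simp only [Nat.add_sub_cancel]
    push_cast
    field_simp
  have hzero : ∀ j, 0 < u j → besF a (1 / u j) = 0 := by
    intro j hj
    have h1 := conv (fun i => 1 / U i j) (1 / u j) (tendsto_const_nhds.div (hu j) hj.ne')
    refine tendsto_nhds_unique h1 (tendsto_const_nhds.congr' ?_)
    filter_upwards [hk.eventually_gt_atTop j] with i hi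
    rw [(H i).2.2.2.2.2.2, eq_comm, prod_eq_zero_iff]
    refine ⟨j, mem_range.2 hi, ?_⟩
    have := ((H i).2.2.2.2.2.1 j hi).ne'
    field_simp
    simp
  have hzero' : ∀ z, 0 < z → besF a z = 0 → ∃ j, z * u j = 1 := by
    intro z hz h0
    have ht := tendsto_sum_nat_add (fun j : ℕ => 4 / ((j : ℝ) + 1) ^ 2)
    have ht2 := (ht.const_mul z).eventually_lt_const (u := 1 / 2) (by norm_num)
    obtain ⟨J, hJ⟩ := ht2.exists
    have hlow : ∀ n, J ≤ n → ∀ i, 1 / 2 ≤ ∏ j ∈ Ico J n, (1 - z * U i j) := by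
      intro n hn i
      have hs : ∑ j ∈ Ico J n, z * U i j ≤ 1 / 2 := by
        rw [← mul_sum]
        refine le_trans (mul_le_mul_of_nonneg_left ?_ hz.le) hJ.le
        refine (sum_le_sum fun j _ => (H i).2.1 j).trans ?_
        rw [sum_Ico_eq_sum_range]
        simp_rw [add_comm J]
        exact Summable.sum_le_tsum _ (fun j _ => by positivity)
          ((summable_nat_add_iff J).2 summable_bd)
      have hnn : ∀ j ∈ Ico J n, 0 ≤ z * U i j := fun j _ => mul_nonneg hz.le ((H i).1 j)
      have := weierstrass (Ico J n) (fun j => z * U i j) hnn (fun j hj =>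
        (single_le_sum hnn hj).trans (hs.trans (by norm_num)))
      linarith
    have hlim : Tendsto (fun i => ∏ j ∈ range J, (1 - z * U i j)) atTop
        (𝓝 (∏ j ∈ range J, (1 - z * u j))) :=
      tendsto_finsetProd _ fun j _ => tendsto_const_nhds.sub ((hu j).const_mul z)
    have hlim0 : Tendsto (fun i => ∏ j ∈ range J, (1 - z * U i j)) atTop (𝓝 0) := by
      have hc := conv (fun _ => z) z tendsto_const_nhds
      rw [h0] at hc
      have hc2 := (hc.abs).const_mul 2
      rw [abs_zero, mul_zero] at hc2
      refine squeeze_zero_norm' ?_ hc2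
      filter_upwards [hk.eventually_ge_atTop J] with i hi
      rw [(H i).2.2.2.2.2.2, ← prod_range_mul_prod_Ico _ hi, abs_mul, Real.norm_eq_abs]
      have h2 := hlow (k i) hi i
      rw [abs_of_pos (lt_of_lt_of_le (by norm_num) h2)]
      nlinarith [abs_nonneg (∏ j ∈ range J, (1 - z * U i j))]
    have := tendsto_nhds_unique hlim hlim0
    obtain ⟨j, _, hj⟩ := prod_eq_zero_iff.1 this
    exact ⟨j, by linarith⟩
  refine ⟨u, hu0, hus, hanti, hzero, hzero', ?_, ?_⟩
  · intro i j hij hi heq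
    have hj : 0 < u j := heq ▸ hi
    have hex : ∀ n, ∃ x, j < k n → 1 / U n i ≤ x ∧ x ≤ 1 / U n j ∧
        lag (k n - 1) (a + 1) (x / (4 * k n)) = 0 := by
      intro n
      by_cases hjn : j < k n
      · have p1 := (H n).2.2.2.2.2.1 i (hij.trans hjn)
        have p2 := (H n).2.2.2.2.2.1 j hjn
        have p3 := one_div_lt_one_div_of_lt p2 ((H n).2.2.2.2.1 i j hij hjn)
        have z0 : ∀ l < k n, lag (k n) a ((1 / U n l) / (4 * k n)) = 0 := by
          intro l hl
          rw [(H n).2.2.2.2.2.2, prod_eq_zero_iff]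
          refine ⟨l, mem_range.2 hl, ?_⟩
          have := ((H n).2.2.2.2.2.1 l hl).ne'
          field_simp
          simp
        obtain ⟨x, hx, hx'⟩ := exists_hasDerivAt_eq_zero
          (f := fun z => lag (k n) a (z / (4 * k n))) p3
          (fun x _ => (hder n (by omega) x).continuousAt.continuousWithinAt)
          ((z0 i (hij.trans hjn)).trans (z0 j hjn).symm)
          (fun x _ => hder n (by omega) x)
        refine ⟨x, fun _ => ⟨hx.1.le, hx.2.le, ?_⟩⟩
        have h5 : -(1 / (4 * (a + 1))) ≠ 0 := by
          have : 0 < 1 / (4 * (a + 1)) := by positivity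
          linarith [this] |> fun (h : -(1 / (4 * (a + 1))) < 0) => h.ne
        exact (mul_eq_zero.1 hx').resolve_left h5
      · exact ⟨0, fun h => absurd h hjn⟩
    choose x hx using hex
    have hxl : Tendsto x atTop (𝓝 (1 / u j)) := by
      have t1 : Tendsto (fun n => 1 / U n i) atTop (𝓝 (1 / u j)) := by
        rw [← heq]; exact tendsto_const_nhds.div (hu i) hi.ne'
      have t2 : Tendsto (fun n => 1 / U n j) atTop (𝓝 (1 / u j)) :=
        tendsto_const_nhds.div (hu j) hj.ne'
      refine tendsto_of_tendsto_of_tendsto_of_le_of_le' t1 t2 ?_ ?_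
      · filter_upwards [hk.eventually_gt_atTop j] with n hn using (hx n hn).1
      · filter_upwards [hk.eventually_gt_atTop j] with n hn using (hx n hn).2.1
    have h1 := conv' x _ hxl
    have h2 : besF (a + 1) (1 / u j) = 0 := by
      refine tendsto_nhds_unique h1 (tendsto_const_nhds.congr' ?_)
      filter_upwards [hk.eventually_gt_atTop j] with n hn using (hx n hn).2.2.symm
    exact besF_no_double ha (by positivity) (hzero j hj) h2
  · intro z hz hz1
    obtain ⟨θ, hθ1, hθ2⟩ := exists_between hz1
    have hev : ∀ᶠ n in atTop, z * U n 0 < θ := ((hu 0).const_mul z).eventually_lt_const hθ1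
    have hev2 : ∀ᶠ n in atTop, ∀ j, 1 - θ ≤ 1 - z * U n j := by
      filter_upwards [hev] with n hn j
      have := mul_le_mul_of_nonneg_left ((H n).2.2.1 (Nat.zero_le j)) hz
      linarith
    have hθ : 0 < 1 - θ := by linarith
    have hne : ∀ j, 1 - z * u j ≠ 0 := by
      intro j
      have := mul_le_mul_of_nonneg_left (hanti (Nat.zero_le j)) hz
      have : 0 < 1 - z * u j := by linarith
      exact this.ne'
    have hS : Tendsto (fun n => ∑' j, U n j / (1 - z * U n j)) atTop
        (𝓝 (∑' j, u j / (1 - z * u j))) := by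
      refine tendsto_tsum_of_dominated_convergence
        (bound := fun j : ℕ => 4 / ((j : ℝ) + 1) ^ 2 / (1 - θ)) (summable_bd.div_const _) ?_ ?_
      · intro j
        exact (hu j).div (tendsto_const_nhds.sub ((hu j).const_mul z)) (hne j)
      · filter_upwards [hev2] with n hn j
        have h1 := hn j
        have h2 : 0 < 1 - z * U n j := by linarith
        rw [Real.norm_of_nonneg (div_nonneg ((H n).1 j) h2.le)]
        exact div_le_div₀ (by positivity) ((H n).2.1 j) hθ h1
    have hL := hS.mul (conv (fun _ => z) z tendsto_const_nhds)
    have hR := (conv' (fun _ => z) z tendsto_const_nhds).const_mul (1 / (4 * (a + 1)))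
    refine tendsto_nhds_unique hL (hR.congr' ?_)
    filter_upwards [hev2, hk.eventually_gt_atTop 0] with n hn hkn
    have hn0 : ∀ j, 1 - z * U n j ≠ 0 := fun j => (hθ.trans_le (hn j)).ne'
    rw [tsum_eq_sum (s := range (k n)) (fun j hj => by
      rw [(H n).2.2.2.1 j (by simpa using hj)]; simp)]
    have hd1 : ∀ j, HasDerivAt (fun y => 1 - y * U n j) (-(U n j)) z := by
      intro j
      have := ((hasDerivAt_id z).mul_const (U n j)).const_sub 1
      simpa using this
    have hl := logDeriv_prod (s := range (k n)) (f := fun j y => 1 - y * U n j) (x := z)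
      (fun j _ => hn0 j) (fun j _ => (hd1 j).differentiableAt)
    have hfun : (fun y => lag (k n) a (y / (4 * k n))) = fun y => ∏ j ∈ range (k n), (1 - y * U n j) :=
      funext fun y => (H n).2.2.2.2.2.2 y
    have hd := hder n hkn z
    rw [hfun] at hd
    have hpn : ∏ j ∈ range (k n), (1 - z * U n j) ≠ 0 := prod_ne_zero_iff.2 fun j _ => hn0 j
    rw [logDeriv_apply, hd.deriv, div_eq_iff hpn] at hl
    simp_rw [logDeriv_apply, (hd1 _).deriv, neg_div, sum_neg_distrib] at hl
    rw [(H n).2.2.2.2.2.2 z]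
    linarith

lemma gamma_lagP {a : ℝ} (ha : 0 ≤ a) (m : ℕ) :
    Real.Gamma (a + m + 1) = Real.Gamma (a + 1) * lagP a m := by
  induction m with
  | zero => simp [lagP]
  | succ m ih =>
    have e : a + ((m + 1 : ℕ) : ℝ) + 1 = (a + m + 1) + 1 := by push_cast; ring
    rw [e, Real.Gamma_add_one (by positivity), ih, lagP_succ]
    ring

lemma phi_eq {a : ℝ} (ha : 0 ≤ a) (z : ℝ) : phi a z = z * besF a z := by
  unfold phi besF
  congr 1
  apply tsum_congr
  intro m
  rw [gamma_lagP ha]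
  have h1 := (Real.Gamma_pos_of_pos (by linarith : 0 < a + 1)).ne'
  have h2 := (lagP_pos ha m).ne'
  field_simp

lemma besselJ_eq {a : ℝ} (ha : 0 ≤ a) {x : ℝ} (hx : 0 < x) :
    besselJ a x = (x / 2) ^ a / Real.Gamma (a + 1) * besF a (x ^ 2) := by
  unfold besselJ besF
  rw [← tsum_mul_left]
  apply tsum_congr
  intro m
  have h1 := (Real.Gamma_pos_of_pos (by linarith : 0 < a + 1)).ne'
  have h2 := (lagP_pos ha m).ne'
  rw [add_comm (m:ℝ) a, gamma_lagP ha, Real.rpow_add (by positivity)]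
  have : (x / 2) ^ (2 * (m:ℝ)) = (x ^ 2) ^ m / 4 ^ m := by
    rw [show 2 * (m:ℝ) = ((2 * m : ℕ) : ℝ) by push_cast; ring, Real.rpow_natCast, pow_mul, div_pow,
      div_pow]
    norm_num
  rw [this]
  field_simp

lemma mem_besselZeros {a : ℝ} (ha : 0 ≤ a) {x : ℝ} :
    x ∈ besselZeros a ↔ 0 < x ∧ besF a (x ^ 2) = 0 := by
  refine and_congr_right fun hx => ?_
  rw [besselJ_eq ha hx]
  have h1 := (Real.Gamma_pos_of_pos (by linarith : 0 < a + 1))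
  have h2 : 0 < (x / 2) ^ a := Real.rpow_pos_of_pos (by positivity) _
  have h3 : (x / 2) ^ a / Real.Gamma (a + 1) ≠ 0 := by positivity
  simp [mul_eq_zero, h3]

/-- For all sufficiently large `ν ≥ 0`: the derivative `φ_ν'` has a smallest positive
zero `s`, `s < x²` for every positive zero `x` of `J_ν`, and
`Σ_{k=1}^∞ s^k σ_k(ν)` converges with sum `1`. -/
theorem phi_deriv_smallest_zero_rayleigh_series :
    ∃ ν₀ : ℝ, 0 ≤ ν₀ ∧ ∀ ν : ℝ, ν₀ ≤ ν →
      ∃ s : ℝ, IsLeast {x : ℝ | 0 < x ∧ deriv (phi ν) x = 0} s ∧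
        (∀ x ∈ besselZeros ν, s < x ^ 2) ∧
        Summable (fun k : ℕ => s ^ (k + 1) * rayleigh (k + 1) ν) ∧
        ∑' k : ℕ, s ^ (k + 1) * rayleigh (k + 1) ν = 1 := by
  refine ⟨0, le_rfl, fun ν hν => ?_⟩
  have hν1 : 0 ≤ ν + 1 := by linarith
  obtain ⟨u, hu0, hus, hanti, hz1, hz2, hinj, hlog⟩ := besF_zeros hν
  have hphi : phi ν = fun z => z * besF ν z := funext fun z => phi_eq hν z
  set d : ℝ → ℝ := fun z => besF ν z + z * (-(1 / (4 * (ν + 1))) * besF (ν + 1) z) with hd_def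
  have hd : ∀ z, HasDerivAt (phi ν) (d z) z := by
    intro z
    rw [hphi]
    have := (hasDerivAt_id z).mul (besF_hasDerivAt hν z)
    refine this.congr_deriv ?_
    simp [hd_def]
  have hderiv : ∀ z, deriv (phi ν) z = d z := fun z => (hd z).deriv
  have hcF : ∀ {b : ℝ}, 0 ≤ b → Continuous (besF b) := fun hb =>
    continuous_iff_continuousAt.2 fun z => (besF_hasDerivAt hb z).continuousAt
  have hcd : Continuous d := by
    have h1 := hcF hν
    have h2 := hcF hν1
    simp only [hd_def]
    fun_prop
  have hF0 : ∀ b : ℝ, 0 ≤ b → besF b 0 = 1 := by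
    intro b hb
    rw [besF_split hb]; simp
  have hd0 : d 0 = 1 := by simp [hd_def, hF0 ν hν]
  have hu00 : 0 < u 0 := by
    by_contra h
    have hall : ∀ j, u j = 0 := fun j =>
      le_antisymm ((hanti (Nat.zero_le j)).trans (not_lt.1 h)) (hu0 j)
    have := hlog 0 le_rfl (by simp)
    simp only [hall, hF0 ν hν, hF0 _ hν1, zero_div, tsum_zero, zero_mul, mul_one] at this
    have h2 : 0 < 1 / (4 * (ν + 1)) := by positivity
    linarith
  obtain ⟨c, hc, hc0⟩ : ∃ c ∈ Set.Ioo 0 (1 / u 0), d c = 0 := by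
    refine exists_hasDerivAt_eq_zero (f := phi ν) (by positivity)
      (fun x _ => (hd x).continuousAt.continuousWithinAt) ?_ (fun x _ => hd x)
    rw [phi_eq hν, phi_eq hν, hz1 0 hu00]; simp
  let S : Set ℝ := Set.Ici 0 ∩ d ⁻¹' {0}
  have hSc : IsClosed S := isClosed_Ici.inter (isClosed_singleton.preimage hcd)
  have hcS : c ∈ S := ⟨hc.1.le, hc0⟩
  have hSb : BddBelow S := ⟨0, fun x hx => hx.1⟩
  have hmem := hSc.csInf_mem ⟨c, hcS⟩ hSb
  set s := sInf S with hs_def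
  have hsd : d s = 0 := hmem.2
  have hs0 : 0 < s := by
    rcases (show (0:ℝ) ≤ s from hmem.1).eq_or_lt with h | h
    · rw [← h, hd0] at hsd; norm_num at hsd
    · exact h
  have hsc : s ≤ c := csInf_le hSb hcS
  have hsu : s * u 0 < 1 := by
    have := hsc.trans_lt hc.2
    rwa [lt_div_iff₀ hu00] at this
  have hsuj : ∀ j, s * u j < 1 := fun j =>
    (mul_le_mul_of_nonneg_left (hanti (Nat.zero_le j)) hs0.le).trans_lt hsu
  have hFs : besF ν s ≠ 0 := by
    intro h
    obtain ⟨j, hj⟩ := hz2 s hs0 h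
    exact (hsuj j).ne hj
  have hsum1 : ∑' j, s * u j / (1 - s * u j) = 1 := by
    have h1 := hlog s hs0.le hsu
    have h2 : (∑' j, s * u j / (1 - s * u j)) = s * ∑' j, u j / (1 - s * u j) := by
      rw [← tsum_mul_left]
      exact tsum_congr fun j => by ring
    rw [h2]
    apply mul_right_cancel₀ hFs
    simp only [hd_def] at hsd
    linear_combination s * h1 - hsd
  -- Rayleigh sums
  have hray : ∀ k : ℕ, rayleigh (k + 1) ν = ∑' j, u j ^ (k + 1) := by
    intro k
    let e : {j // 0 < u j} → besselZeros ν := fun j => ⟨1 / √(u j), by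
      rw [mem_besselZeros hν]
      have := Real.sqrt_pos.2 j.2
      refine ⟨by positivity, ?_⟩
      rw [div_pow, one_pow, Real.sq_sqrt j.2.le]
      exact hz1 j j.2⟩
    have he : Function.Bijective e := by
      constructor
      · intro i j hij
        have h1 : 1 / √(u i) = 1 / √(u j) := congrArg Subtype.val hij
        have h2 : u i = u j := by
          rw [one_div, one_div, inv_inj] at h1
          rw [← Real.sq_sqrt i.2.le, ← Real.sq_sqrt j.2.le, h1]
        rcases lt_trichotomy i.1 j.1 with h | h | h
        · exact (hinj _ _ h i.2 h2).elim
        · exact Subtype.ext h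
        · exact (hinj _ _ h j.2 h2.symm).elim
      · rintro ⟨x, hx⟩
        obtain ⟨hx0, hxF⟩ := (mem_besselZeros hν).1 hx
        obtain ⟨j, hj⟩ := hz2 (x ^ 2) (by positivity) hxF
        have huj : u j = (1 / x) ^ 2 := by
          field_simp
          linarith
        have hpos : 0 < u j := by rw [huj]; positivity
        refine ⟨⟨j, hpos⟩, Subtype.ext ?_⟩
        show 1 / √(u j) = x
        rw [huj, Real.sqrt_sq (by positivity), one_div_one_div]
    unfold rayleigh
    rw [← (Equiv.ofBijective e he).tsum_eq]
    have h1 : ∀ j : {j // 0 < u j},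
        ((((Equiv.ofBijective e he) j : besselZeros ν) : ℝ) ^ (2 * (k + 1)))⁻¹ = u j ^ (k + 1) := by
      intro j
      show ((1 / √(u j)) ^ (2 * (k + 1)))⁻¹ = u j ^ (k + 1)
      rw [pow_mul, div_pow, Real.sq_sqrt j.2.le]
      simp
    simp_rw [h1]
    refine tsum_subtype_eq_of_support_subset (f := fun j => u j ^ (k + 1)) (s := {j | 0 < u j}) ?_
    intro j hj
    refine lt_of_le_of_ne (hu0 j) fun h => hj ?_
    simp [← h]
  have hgeo : ∀ j, HasSum (fun k : ℕ => (s * u j) ^ (k + 1)) (s * u j / (1 - s * u j)) := by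
    intro j
    have := (hasSum_geometric_of_lt_one (mul_nonneg hs0.le (hu0 j)) (hsuj j)).mul_left (s * u j)
    simpa [pow_succ', div_eq_mul_inv] using this
  have hsumm : Summable fun j => s * u j / (1 - s * u j) := by
    by_contra h
    rw [tsum_eq_zero_of_not_summable h] at hsum1
    norm_num at hsum1
  have hprod : Summable fun p : ℕ × ℕ => (s * u p.1) ^ (p.2 + 1) := by
    rw [summable_prod_of_nonneg (fun p => pow_nonneg (mul_nonneg hs0.le (hu0 p.1)) _)]
    refine ⟨fun j => (hgeo j).summable, ?_⟩
    simpa only [(hgeo _).tsum_eq] using hsumm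
  have hterm : ∀ k : ℕ, s ^ (k + 1) * rayleigh (k + 1) ν = ∑' j, (s * u j) ^ (k + 1) := by
    intro k
    rw [hray, ← tsum_mul_left]
    exact tsum_congr fun j => (mul_pow _ _ _).symm
  refine ⟨s, ⟨⟨hs0, by rw [hderiv, hsd]⟩, ?_⟩, ?_, ?_, ?_⟩
  · rintro x ⟨hx0, hx⟩
    rw [hderiv] at hx
    exact csInf_le hSb ⟨hx0.le, hx⟩
  · intro x hx
    obtain ⟨hx0, hxF⟩ := (mem_besselZeros hν).1 hx
    obtain ⟨j, hj⟩ := hz2 (x ^ 2) (by positivity) hxF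
    by_contra h
    have := mul_le_mul_of_nonneg_right (not_lt.1 h) (hu0 j)
    linarith [hsuj j]
  · simp_rw [hterm]
    exact hprod.prod_symm.prod
  · simp_rw [hterm]
    rw [Summable.tsum_comm (f := fun j k => (s * u j) ^ (k + 1)) hprod]
    simp_rw [(hgeo _).tsum_eq]
    exact hsum1
end
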